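/- Let μ be a finite Radon measure on ℝ² with linear growth μ(B(x,r)) ≤ r for all x ∈ ℝ² and r > 0, and compact support. Then c²(μ) + μ(ℝ²) is comparable, with absolute constants, to ∬₀^∞ β_{μ,2}(x,r)² Θ_μ¹(x,r) (dr/r) dμ(x) + μ(ℝ²), where Θ_μ¹(x,r) = μ(B(x,r))/r. -/

import Mathlib

open MeasureTheory Metric Set Filter
open scoped ENNReal NNReal

noncomputable section

/-- The squared `L²` Jones beta number for `n = 1`, `d = 2` (infimum over affine lines). -/
def beta2sq (μ : Measure (EuclideanSpace ℝ (Fin 2)))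
    (x : EuclideanSpace ℝ (Fin 2)) (r : ℝ) : ℝ≥0∞ :=
  ⨅ L : {L : AffineSubspace ℝ (EuclideanSpace ℝ (Fin 2)) //
      Module.finrank ℝ L.direction = 1},
    (∫⁻ y in closedBall x r,
        ENNReal.ofReal ((infDist y (L.1 : Set (EuclideanSpace ℝ (Fin 2))) / r) ^ 2) ∂μ) /
      ENNReal.ofReal r

/-- The inverse of the radius of the circle through `x, y, z`: by the law of sines,
`1/R(x,y,z) = 2 sin ∠(y,x,z) / dist y z` (interpreted as `0` for degenerate triples). -/
def invCircumradius (x y z : EuclideanSpace ℝ (Fin 2)) : ℝ :=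
  2 * Real.sin (EuclideanGeometry.angle y x z) / dist y z

/-- The Menger curvature `c²(μ) = ∭ R(x,y,z)^{-2} dμ(x)dμ(y)dμ(z)`. -/
def mengerCurvature (μ : Measure (EuclideanSpace ℝ (Fin 2))) : ℝ≥0∞ :=
  ∫⁻ x, ∫⁻ y, ∫⁻ z, ENNReal.ofReal ((invCircumradius x y z) ^ 2) ∂μ ∂μ ∂μ

/-- The Jones square-function energy `∬₀^∞ β_{μ,2}(x,r)² Θ_μ¹(x,r) dr/r dμ(x)`. -/
def jonesEnergy (μ : Measure (EuclideanSpace ℝ (Fin 2))) : ℝ≥0∞ :=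
  ∫⁻ x, (∫⁻ r in Set.Ioi (0 : ℝ),
    beta2sq μ x r * (μ (closedBall x r) / ENNReal.ofReal r) / ENNReal.ofReal r) ∂μ


namespace MJ


/-- the tent function -/
def Hh (t : ℝ) : ℝ := max 0 (1 - |t|)

/-- the dilated tent -/
def mm (t : ℝ) : ℝ := Hh (t / 2) / 2

lemma mm_eq (t : ℝ) : mm t = Hh (t - 1) / 4 + Hh t / 2 + Hh (t + 1) / 4 := by
  unfold mm Hh
  rw [abs_div, abs_two]
  rcases le_total 0 t with h | h <;> rcases le_total 0 (t-1) with h1 | h1 <;>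
  rcases le_total 0 (t+1) with h2 | h2 <;>
  simp only [abs_of_nonneg, abs_of_nonpos, h, h1, h2] <;>
  simp only [max_def] <;> split_ifs <;> linarith

lemma Hh_nonneg (t : ℝ) : 0 ≤ Hh t := le_max_left _ _
lemma Hh_le_one (t : ℝ) : Hh t ≤ 1 := by
  unfold Hh; apply max_le <;> linarith [abs_nonneg t]
lemma Hh_neg (t : ℝ) : Hh (-t) = Hh t := by unfold Hh; rw [abs_neg]
lemma Hh_zero {t : ℝ} (h : 1 ≤ |t|) : Hh t = 0 := by
  unfold Hh; apply max_eq_left; linarith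
lemma Hh_lip (s t : ℝ) : |Hh s - Hh t| ≤ |s - t| := by
  unfold Hh
  have := abs_max_sub_max_le_abs (1 - |s|) (1 - |t|) 0
  rw [max_comm 0, max_comm 0]
  refine this.trans ?_
  have := abs_abs_sub_abs_le s t
  rw [abs_le] at *
  constructor <;> linarith
lemma Hh_cont : Continuous Hh := by unfold Hh; fun_prop

lemma mm_nonneg (t : ℝ) : 0 ≤ mm t := by unfold mm; linarith [Hh_nonneg (t/2)]
lemma mm_le (t : ℝ) : mm t ≤ 1/2 := by unfold mm; linarith [Hh_le_one (t/2)]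
lemma mm_neg (t : ℝ) : mm (-t) = mm t := by unfold mm; rw [neg_div, Hh_neg]
lemma mm_zero {t : ℝ} (h : 2 ≤ |t|) : mm t = 0 := by
  unfold mm; rw [Hh_zero]; · simp
  rw [abs_div, abs_two]; linarith
lemma mm_lip (s t : ℝ) : |mm s - mm t| ≤ |s - t| := by
  unfold mm
  have h := Hh_lip (s/2) (t/2)
  have e : |s/2 - t/2| = |s-t|/2 := by rw [← sub_div, abs_div, abs_two]
  have h2 := abs_nonneg (s-t)
  rw [e] at h
  rw [← sub_div, abs_div, abs_two]; linarith
lemma mm_cont : Continuous mm := by unfold mm; have := Hh_cont; fun_prop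

structure Nice (f : ℝ → ℝ) : Prop where
  cont : Continuous f
  lip : ∀ s t, |f s - f t| ≤ 3 * |s - t|
  bdd : ∀ t, |f t| ≤ 3
  supp : ∀ t, 2 < |t| → f t = 0

def ph (j t : ℝ) : ℝ := Hh (t - j) - mm t
def ch (j t : ℝ) : ℝ := Hh (t - j) + 2 * mm t
def pl (t : ℝ) : ℝ := Hh t + mm t

lemma nice_H : Nice Hh := ⟨Hh_cont, fun s t => by linarith [Hh_lip s t, abs_nonneg (s-t)],
  fun t => by rw [abs_of_nonneg (Hh_nonneg t)]; linarith [Hh_le_one t],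
  fun t h => Hh_zero (by linarith)⟩
lemma nice_m : Nice mm := ⟨mm_cont, fun s t => by linarith [mm_lip s t, abs_nonneg (s-t)],
  fun t => by rw [abs_of_nonneg (mm_nonneg t)]; linarith [mm_le t],
  fun t h => mm_zero (by linarith)⟩

lemma Hj_supp {j t : ℝ} (hj : |j| ≤ 1) (h : 2 < |t|) : Hh (t - j) = 0 := by
  apply Hh_zero
  have := abs_sub_abs_le_abs_sub t j
  linarith

lemma nice_ph {j : ℝ} (hj : |j| ≤ 1) : Nice (ph j) := by
  refine ⟨by unfold ph; have := Hh_cont; have := mm_cont; fun_prop, fun s t => ?_, fun t => ?_, fun t h => ?_⟩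
  · unfold ph
    have h1 := Hh_lip (s-j) (t-j)
    have h2 := mm_lip s t
    have h3 := abs_nonneg (s-t)
    rw [show s - j - (t-j) = s - t by ring] at h1
    rw [abs_le] at *
    constructor <;> linarith
  · unfold ph
    have := Hh_nonneg (t-j); have := Hh_le_one (t-j); have := mm_nonneg t; have := mm_le t
    rw [abs_le]; constructor <;> linarith
  · unfold ph; rw [Hj_supp hj h, mm_zero h.le]; simp

lemma nice_ch {j : ℝ} (hj : |j| ≤ 1) : Nice (ch j) := by
  refine ⟨by unfold ch; have := Hh_cont; have := mm_cont; fun_prop, fun s t => ?_, fun t => ?_, fun t h => ?_⟩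
  · unfold ch
    have h1 := Hh_lip (s-j) (t-j)
    have h2 := mm_lip s t
    have h3 := abs_nonneg (s-t)
    rw [show s - j - (t-j) = s - t by ring] at h1
    rw [abs_le] at *
    constructor <;> linarith
  · unfold ch
    have := Hh_nonneg (t-j); have := Hh_le_one (t-j); have := mm_nonneg t; have := mm_le t
    rw [abs_le]; constructor <;> linarith
  · unfold ch; rw [Hj_supp hj h, mm_zero h.le]; simp

lemma nice_pl : Nice pl := by
  refine ⟨by unfold pl; have := Hh_cont; have := mm_cont; fun_prop, fun s t => ?_, fun t => ?_, fun t h => ?_⟩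
  · unfold pl
    have h1 := Hh_lip s t
    have h2 := mm_lip s t
    have h3 := abs_nonneg (s-t)
    rw [abs_le] at *
    constructor <;> linarith
  · unfold pl
    have := Hh_nonneg t; have := Hh_le_one t; have := mm_nonneg t; have := mm_le t
    rw [abs_le]; constructor <;> linarith
  · unfold pl; rw [Hh_zero (by linarith), mm_zero h.le]; simp

lemma int_bound {F : ℝ → ℝ} {K a a' : ℝ} (hb : ∀ p, |F p| ≤ K)
    (hz : ∀ p, 2 < |a - p| → 2 < |a' - p| → F p = 0) : |∫ p, F p| ≤ 8 * K := by
  have hK : 0 ≤ K := (abs_nonneg _).trans (hb 0)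
  have key : ∀ c : ℝ, Integrable ((Icc (c-2) (c+2)).indicator (fun _ => K)) volume := by
    intro c
    rw [integrable_indicator_iff measurableSet_Icc]
    exact integrableOn_const (by simp)
  have h1 : ‖∫ p, F p‖ ≤ ∫ p, ((Icc (a-2) (a+2)).indicator (fun _ => K) p + (Icc (a'-2) (a'+2)).indicator (fun _ => K) p) := by
    apply norm_integral_le_of_norm_le ((key a).add (key a'))
    refine Filter.Eventually.of_forall fun p => ?_
    by_cases h : p ∈ Icc (a-2) (a+2)
    · simp only [Pi.add_apply, indicator_of_mem h]
      have : 0 ≤ (Icc (a'-2) (a'+2)).indicator (fun _ => K) p := indicator_nonneg (fun _ _ => hK) _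
      have := hb p
      rw [Real.norm_eq_abs]; linarith
    · by_cases h' : p ∈ Icc (a'-2) (a'+2)
      · simp only [Pi.add_apply, indicator_of_mem h', indicator_of_notMem h]
        have := hb p
        rw [Real.norm_eq_abs]; linarith
      · have : F p = 0 := by
          apply hz
          · by_contra hh; push Not at hh; rw [abs_le] at hh; exact h ⟨by linarith, by linarith⟩
          · by_contra hh; push Not at hh; rw [abs_le] at hh; exact h' ⟨by linarith, by linarith⟩
        simp [this, indicator_of_notMem h, indicator_of_notMem h']
  rw [integral_add (key a) (key a'), integral_indicator measurableSet_Icc, integral_indicator measurableSet_Icc] at h1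
  simp only [integral_const, MeasurableSet.univ, measureReal_restrict_apply, univ_inter, Real.volume_real_Icc, smul_eq_mul] at h1
  rw [Real.norm_eq_abs] at h1
  rw [show a + 2 - (a-2) = 4 by ring, show a' + 2 - (a'-2) = 4 by ring] at h1
  norm_num at h1
  linarith

lemma nice_integrable {f g : ℝ → ℝ} (hf : Nice f) (hg : Continuous g) (a : ℝ) :
    Integrable (fun p => f (a - p) * g p) := by
  have h1 := hf.cont
  apply Continuous.integrable_of_hasCompactSupport (by fun_prop)
  apply HasCompactSupport.of_support_subset_isCompact (isCompact_Icc (a := a-2) (b := a+2))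
  intro p hp
  by_contra hh
  apply hp
  have : f (a - p) = 0 := by
    apply hf.supp
    by_contra h; push Not at h; rw [abs_le] at h; exact hh ⟨by linarith, by linarith⟩
  simp [this]

def T (f g h : ℝ → ℝ) (a b c : ℝ) : ℝ := ∫ p, f (a - p) * g (b - p) * h (c - p)
def T2 (f g : ℝ → ℝ) (a b : ℝ) : ℝ := ∫ p, f (a - p) * g (b - p)

lemma T_int {f g h : ℝ → ℝ} (hf : Nice f) (hg : Nice g) (hh : Nice h) (a b c : ℝ) :
    Integrable (fun p => f (a - p) * g (b - p) * h (c - p)) := by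
  have h1 := hg.cont
  have h2 := hh.cont
  have := nice_integrable hf (g := fun p => g (b - p) * h (c - p)) (by fun_prop) a
  simpa only [mul_assoc] using this

lemma T2_int {f g : ℝ → ℝ} (hf : Nice f) (hg : Nice g) (a b : ℝ) :
    Integrable (fun p => f (a - p) * g (b - p)) := by
  have h1 := hg.cont
  exact nice_integrable hf (g := fun p => g (b - p)) (by fun_prop) a

lemma T_rot (f g h : ℝ → ℝ) (a b c : ℝ) : T f g h a b c = T g h f b c a := by
  unfold T; congr 1; ext p; ring
lemma T_swap (f g h : ℝ → ℝ) (a b c : ℝ) : T f g h a b c = T g f h b a c := by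
  unfold T; congr 1; ext p; ring

lemma T_trans (f g h : ℝ → ℝ) (a b c s : ℝ) : T f g h (a+s) (b+s) (c+s) = T f g h a b c := by
  unfold T
  rw [← integral_add_right_eq_self _ s]
  simp only [add_sub_add_right_eq_sub]

lemma T2_trans (f g : ℝ → ℝ) (a b s : ℝ) : T2 f g (a+s) (b+s) = T2 f g a b := by
  unfold T2
  rw [← integral_add_right_eq_self _ s]
  simp only [add_sub_add_right_eq_sub]

lemma T_neg (f g h : ℝ → ℝ) (a b c : ℝ) : T f g h (-a) (-b) (-c) =
    T (fun t => f (-t)) (fun t => g (-t)) (fun t => h (-t)) a b c := by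
  unfold T
  rw [← integral_neg_eq_self]
  congr 1; ext p; congr 2 <;> ring_nf

lemma T2_neg (f g : ℝ → ℝ) (a b : ℝ) : T2 f g (-a) (-b) =
    T2 (fun t => f (-t)) (fun t => g (-t)) a b := by
  unfold T2
  rw [← integral_neg_eq_self]
  congr 1; ext p; congr 2 <;> ring_nf

lemma int4 {α : Type*} [MeasurableSpace α] {ν : Measure α} {f1 f2 f3 f4 : α → ℝ} (h1 : Integrable f1 ν) (h2 : Integrable f2 ν)
    (h3 : Integrable f3 ν) (h4 : Integrable f4 ν) :
    ∫ p, f1 p ∂ν - ∫ p, f2 p ∂ν - ∫ p, f3 p ∂ν + ∫ p, f4 p ∂ν = ∫ p, (f1 p - f2 p - f3 p + f4 p) ∂ν := by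
  have e1 : Integrable (fun p => f1 p - f2 p) ν := h1.sub h2
  have e2 : Integrable (fun p => f1 p - f2 p - f3 p) ν := e1.sub h3
  rw [integral_add e2 h4, integral_sub e1 h3, integral_sub h1 h2]

lemma T_diff {f g h : ℝ → ℝ} (hf : Nice f) (hg : Nice g) (hh : Nice h) (a a' b b' c : ℝ) :
    |T f g h a b c - T f g h a' b c - T f g h a b' c + T f g h a' b' c| ≤ 216 * |a - a'| * |b - b'| := by
  have e : T f g h a b c - T f g h a' b c - T f g h a b' c + T f g h a' b' c =
      ∫ p, (f (a - p) - f (a' - p)) * (g (b - p) - g (b' - p)) * h (c - p) := by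
    unfold T
    rw [int4 (T_int hf hg hh _ _ _) (T_int hf hg hh _ _ _) (T_int hf hg hh _ _ _) (T_int hf hg hh _ _ _)]
    congr 1; ext p; ring
  rw [e]
  have := int_bound (F := fun p => (f (a - p) - f (a' - p)) * (g (b - p) - g (b' - p)) * h (c - p))
    (K := (3 * |a - a'|) * (3 * |b - b'|) * 3) (a := c) (a' := c) ?_ ?_
  · refine this.trans (le_of_eq (by ring))
  · intro p
    rw [abs_mul, abs_mul]
    have h1 := hf.lip (a-p) (a'-p)
    have h2 := hg.lip (b-p) (b'-p)
    rw [sub_sub_sub_cancel_right] at h1 h2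
    have h3 := hh.bdd (c-p)
    gcongr
  · intro p h1 h2
    simp [hh.supp _ h1]

lemma T2_diff {f g : ℝ → ℝ} (hf : Nice f) (hg : Nice g) (a a' b b' : ℝ) :
    |T2 f g a b - T2 f g a' b - T2 f g a b' + T2 f g a' b'| ≤ 72 * |a - a'| * |b - b'| := by
  have e : T2 f g a b - T2 f g a' b - T2 f g a b' + T2 f g a' b' =
      ∫ p, (f (a - p) - f (a' - p)) * (g (b - p) - g (b' - p)) := by
    unfold T2
    rw [int4 (T2_int hf hg _ _) (T2_int hf hg _ _) (T2_int hf hg _ _) (T2_int hf hg _ _)]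
    congr 1; ext p; ring
  rw [e]
  have := int_bound (F := fun p => (f (a - p) - f (a' - p)) * (g (b - p) - g (b' - p)))
    (K := (3 * |a - a'|) * (3 * |b - b'|)) (a := a) (a' := a') ?_ ?_
  · refine this.trans (le_of_eq (by ring))
  · intro p
    rw [abs_mul]
    have h1 := hf.lip (a-p) (a'-p)
    have h2 := hg.lip (b-p) (b'-p)
    rw [sub_sub_sub_cancel_right] at h1 h2
    gcongr
  · intro p h1 h2
    simp [hf.supp _ h1, hf.supp _ h2]


def kap (a b c : ℝ) : ℝ := T (ph (-1)) (ph (-1)) (ch (-1)) a b c / 4 + T (ph 0) (ph 0) (ch 0) a b c / 2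
  + T (ph 1) (ph 1) (ch 1) a b c / 4
def KK (a b c : ℝ) : ℝ := T Hh Hh Hh a b c
def gg (t : ℝ) : ℝ := T2 Hh Hh t 0
def GG (t : ℝ) : ℝ := T2 (ph 0) pl t 0

lemma absm1 : |(-1:ℝ)| ≤ 1 := by norm_num
lemma abs0 : |(0:ℝ)| ≤ 1 := by norm_num
lemma abs1 : |(1:ℝ)| ≤ 1 := by norm_num

lemma T_sum_eq (j a b c : ℝ) : T (fun t => Hh (t - j)) (fun t => Hh (t - j)) (fun t => Hh (t - j)) a b c = KK a b c := by
  rw [KK, ← T_trans Hh Hh Hh a b c (-j)]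
  unfold T; congr 1; ext p; congr 2 <;> ring_nf

lemma T_mm (a b c : ℝ) : T mm mm mm a b c = KK (a/2) (b/2) (c/2) / 4 := by
  unfold KK T
  have := Measure.integral_comp_div (fun q : ℝ => Hh (a/2 - q) * Hh (b/2 - q) * Hh (c/2 - q) / 8) (2:ℝ)
  have e : (fun p : ℝ => mm (a - p) * mm (b - p) * mm (c - p)) = fun x => Hh (a/2 - x/2) * Hh (b/2 - x/2) * Hh (c/2 - x/2) / 8 := by
    ext p; unfold mm; rw [sub_div, sub_div, sub_div]; ring
  rw [e, this, abs_two, smul_eq_mul, integral_div]; ring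

lemma nice_shift {j : ℝ} (hj : |j| ≤ 1) : Nice (fun t => Hh (t - j)) := by
  refine ⟨by have := Hh_cont; fun_prop, fun s t => ?_, fun t => nice_H.bdd _, fun t h => Hj_supp hj h⟩
  have := nice_H.lip (s-j) (t-j); rwa [sub_sub_sub_cancel_right] at this

lemma kap_eq (a b c : ℝ) : kap a b c = ∫ p, (ph (-1) (a-p) * ph (-1) (b-p) * ch (-1) (c-p) / 4 +
    ph 0 (a-p) * ph 0 (b-p) * ch 0 (c-p) / 2 + ph 1 (a-p) * ph 1 (b-p) * ch 1 (c-p) / 4) := by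
  have i1 := (T_int (nice_ph absm1) (nice_ph absm1) (nice_ch absm1) a b c).div_const 4
  have i2 := (T_int (nice_ph abs0) (nice_ph abs0) (nice_ch abs0) a b c).div_const 2
  have i3 := (T_int (nice_ph abs1) (nice_ph abs1) (nice_ch abs1) a b c).div_const 4
  have i12 := i1.add i2
  simp only [Pi.add_def] at i12
  rw [integral_add i12 i3, integral_add i1 i2, integral_div, integral_div, integral_div]
  rfl

lemma kap_int (a b c : ℝ) : Integrable (fun p => ph (-1) (a-p) * ph (-1) (b-p) * ch (-1) (c-p) / 4 +
    ph 0 (a-p) * ph 0 (b-p) * ch 0 (c-p) / 2 + ph 1 (a-p) * ph 1 (b-p) * ch 1 (c-p) / 4) :=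
  (((T_int (nice_ph absm1) (nice_ph absm1) (nice_ch absm1) a b c).div_const 4).add 
  ((T_int (nice_ph abs0) (nice_ph abs0) (nice_ch abs0) a b c).div_const 2)).add
  ((T_int (nice_ph abs1) (nice_ph abs1) (nice_ch abs1) a b c).div_const 4)

lemma KK_ident (a b c : ℝ) :
    KK a b c - KK (a/2) (b/2) (c/2) / 4 = (kap a b c + kap b c a + kap c a b) / 3 := by
  have i1 := (T_int (nice_shift absm1) (nice_shift absm1) (nice_shift absm1) a b c).div_const 4
  have i2 := (T_int (nice_shift abs0) (nice_shift abs0) (nice_shift abs0) a b c).div_const 2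
  have i3 := (T_int (nice_shift abs1) (nice_shift abs1) (nice_shift abs1) a b c).div_const 4
  have i4 := (T_int nice_m nice_m nice_m a b c)
  have i12 := i1.add i2
  simp only [Pi.add_def] at i12
  have i123 := i12.add i3
  simp only [Pi.add_def] at i123
  have L : KK a b c - T mm mm mm a b c = ∫ p, (Hh (a - p - -1) * Hh (b - p - -1) * Hh (c - p - -1) / 4
     + Hh (a - p - 0) * Hh (b - p - 0) * Hh (c - p - 0) / 2 + Hh (a - p - 1) * Hh (b - p - 1) * Hh (c - p - 1) / 4
     - mm (a - p) * mm (b - p) * mm (c - p)) := by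
    rw [integral_sub i123 i4, integral_add i12 i3, integral_add i1 i2, integral_div, integral_div, integral_div]
    have e1 := T_sum_eq (-1) a b c
    have e2 := T_sum_eq 0 a b c
    have e3 := T_sum_eq 1 a b c
    unfold T at e1 e2 e3
    rw [e1, e2, e3]; unfold T; ring
  rw [← T_mm, L, kap_eq, kap_eq, kap_eq, ← integral_add (kap_int _ _ _) (kap_int _ _ _)]
  have h := (kap_int a b c).add (kap_int b c a)
  simp only [Pi.add_def] at h
  rw [← integral_add h (kap_int _ _ _), ← integral_div]
  congr 1; ext p
  have ha := mm_eq (a-p)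
  have hb := mm_eq (b-p)
  have hc := mm_eq (c-p)
  simp only [ph, ch, sub_neg_eq_add, sub_zero]
  generalize mm (a-p) = A at *
  generalize mm (b-p) = B at *
  generalize mm (c-p) = C at *
  subst ha hb hc
  ring

structure Inv3 (C : ℝ) (f : ℝ → ℝ → ℝ → ℝ) : Prop where
  trans : ∀ a b c s, f (a+s) (b+s) (c+s) = f a b c
  neg : ∀ a b c, f (-a) (-b) (-c) = f a b c
  d12 : ∀ a a' b b' c, |f a b c - f a' b c - f a b' c + f a' b' c| ≤ C * |a - a'| * |b - b'|
  d13 : ∀ a a' b c c', |f a b c - f a' b c - f a b c' + f a' b c'| ≤ C * |a - a'| * |c - c'|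
  d23 : ∀ a b b' c c', |f a b c - f a b' c - f a b c' + f a b' c'| ≤ C * |b - b'| * |c - c'|

lemma Inv3.swap {C : ℝ} {f} (hf : Inv3 C f) : Inv3 C (fun a b c => f b a c) := by
  refine ⟨fun a b c s => hf.trans _ _ _ _, fun a b c => hf.neg _ _ _, fun a a' b b' c => ?_,
    fun a a' b c c' => hf.d23 _ _ _ _ _, fun a b b' c c' => hf.d13 _ _ _ _ _⟩
  have := hf.d12 b b' a a' c
  rw [show f b a c - f b a' c - f b' a c + f b' a' c = f b a c - f b' a c - f b a' c + f b' a' c by ring]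
  refine this.trans (le_of_eq (by ring))

lemma Inv3.lip1 {C : ℝ} {f} (hf : Inv3 C f) (a a' b c : ℝ) :
    |f a b c - f a' b c| ≤ C / 2 * |a - a'| * (|2*b-a-a'| + |2*c-a-a'|) := by
  have e1 : ∀ a a' b c, f a' b c = f a (a+a'-b) (a+a'-c) := by
    intro a a' b c
    rw [← hf.neg a' b c, ← hf.trans _ _ _ (a+a')]
    congr 1 <;> ring
  have h1 := e1 a a' b c
  have h2 := e1 a' a b c
  rw [add_comm a' a] at h2
  have h3 := hf.d12 a a' b (a+a'-b) c
  have h4 := hf.d13 a a' (a+a'-b) c (a+a'-c)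
  rw [show b - (a+a'-b) = 2*b-a-a' by ring] at h3
  rw [show c - (a+a'-c) = 2*c-a-a' by ring] at h4
  have e : f a b c - f a' b c = ((f a b c - f a' b c - f a (a+a'-b) c + f a' (a+a'-b) c) +
    (f a (a+a'-b) c - f a' (a+a'-b) c - f a (a+a'-b) (a+a'-c) + f a' (a+a'-b) (a+a'-c)))/2 := by
    linarith
  rw [e, abs_div, abs_two]
  have := (abs_add_le _ _).trans (add_le_add h3 h4)
  linarith

lemma Inv3.near {C : ℝ} {f} (hf : Inv3 C f) (hC : 0 ≤ C) {a a' b b' l δ : ℝ} (ha : |a| ≤ l) (ha' : |a'| ≤ l)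
    (hb : |b| ≤ l) (hb' : |b'| ≤ l) (h1 : |a - a'| ≤ δ) (h2 : |b - b'| ≤ δ) :
    |f a b 0 - f a' b' 0| ≤ 6 * C * (δ * l) := by
  have k1 := hf.lip1 a a' b 0
  have k2 := hf.swap.lip1 b b' a' 0
  have hl : 0 ≤ l := (abs_nonneg _).trans ha
  have hδ : 0 ≤ δ := (abs_nonneg _).trans h1
  have m1 : |2*b-a-a'| + |2*0-a-a'| ≤ 6*l := by
    have : |2*b-a-a'| ≤ 4*l := by rw [abs_le] at *; constructor <;> linarith
    have : |2*0-a-a'| ≤ 2*l := by rw [abs_le] at *; constructor <;> linarith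
    linarith
  have m2 : |2*a'-b-b'| + |2*0-b-b'| ≤ 6*l := by
    have : |2*a'-b-b'| ≤ 4*l := by rw [abs_le] at *; constructor <;> linarith
    have : |2*0-b-b'| ≤ 2*l := by rw [abs_le] at *; constructor <;> linarith
    linarith
  have n1 : C / 2 * |a - a'| * (|2*b-a-a'| + |2*0-a-a'|) ≤ C/2 * δ * (6*l) := by gcongr
  have n2 : C / 2 * |b - b'| * (|2*a'-b-b'| + |2*0-b-b'|) ≤ C/2 * δ * (6*l) := by gcongr
  have := abs_sub_le (f a b 0) (f a' b 0) (f a' b' 0)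
  linarith

lemma kap_inv : Inv3 216 kap := by
  have hph : ∀ j t, ph j (-t) = ph (-j) t := by
    intro j t; unfold ph; rw [mm_neg, ← Hh_neg]; ring_nf
  have hch : ∀ j t, ch j (-t) = ch (-j) t := by
    intro j t; unfold ch; rw [mm_neg, ← Hh_neg]; ring_nf
  have sw : ∀ j a b c, T (ph j) (ph j) (ch j) a b c = T (ph j) (ch j) (ph j) b c a := fun j a b c => T_rot _ _ _ _ _ _
  have sw2 : ∀ j a b c, T (ph j) (ph j) (ch j) a b c = T (ph j) (ch j) (ph j) a c b := fun j a b c => by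
    rw [T_swap, T_rot]
  refine ⟨fun a b c s => ?_, fun a b c => ?_, fun a a' b b' c => ?_, fun a a' b c c' => ?_, fun a b b' c c' => ?_⟩
  · unfold kap; rw [T_trans, T_trans, T_trans]
  · unfold kap; rw [T_neg, T_neg, T_neg]; simp only [hph, hch, neg_neg, neg_zero]; ring
  · unfold kap
    have h1 := T_diff (nice_ph absm1) (nice_ph absm1) (nice_ch absm1) a a' b b' c
    have h2 := T_diff (nice_ph abs0) (nice_ph abs0) (nice_ch abs0) a a' b b' c
    have h3 := T_diff (nice_ph abs1) (nice_ph abs1) (nice_ch abs1) a a' b b' c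
    rw [abs_le] at *
    constructor <;> linarith
  · unfold kap
    simp only [sw2]
    have h1 := T_diff (nice_ph absm1) (nice_ch absm1) (nice_ph absm1) a a' c c' b
    have h2 := T_diff (nice_ph abs0) (nice_ch abs0) (nice_ph abs0) a a' c c' b
    have h3 := T_diff (nice_ph abs1) (nice_ch abs1) (nice_ph abs1) a a' c c' b
    rw [abs_le] at *
    constructor <;> linarith
  · unfold kap
    simp only [sw]
    have h1 := T_diff (nice_ph absm1) (nice_ch absm1) (nice_ph absm1) b b' c c' a
    have h2 := T_diff (nice_ph abs0) (nice_ch abs0) (nice_ph abs0) b b' c c' a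
    have h3 := T_diff (nice_ph abs1) (nice_ch abs1) (nice_ph abs1) b b' c c' a
    rw [abs_le] at *
    constructor <;> linarith

lemma even_diff {f g : ℝ → ℝ} (hf : Nice f) (hg : Nice g) (hfe : ∀ t, f (-t) = f t) (hge : ∀ t, g (-t) = g t)
    (t t' : ℝ) : |T2 f g t 0 - T2 f g t' 0| ≤ 36 * |t^2 - t'^2| := by
  have h := T2_diff hf hg t t' 0 (t+t')
  have e1 : T2 f g t' (t+t') = T2 f g t 0 := by
    have h1 := T2_trans f g t' (t+t') (-(t+t'))
    have h2 := T2_neg f g t 0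
    simp only [hfe, hge, neg_zero] at h2
    rw [← h1, ← h2]; congr 1 <;> ring
  have e2 : T2 f g t (t+t') = T2 f g t' 0 := by
    have h1 := T2_trans f g t (t+t') (-(t+t'))
    have h2 := T2_neg f g t' 0
    simp only [hfe, hge, neg_zero] at h2
    rw [← h1, ← h2]; congr 1 <;> ring
  rw [e1, e2] at h
  rw [show T2 f g t 0 - T2 f g t' 0 - T2 f g t' 0 + T2 f g t 0 = 2 * (T2 f g t 0 - T2 f g t' 0) by ring, abs_mul, abs_two,
    show (0 : ℝ) - (t+t') = -(t+t') by ring, abs_neg, mul_assoc, ← abs_mul] at h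
  rw [show t^2-t'^2 = (t-t')*(t+t') by ring]
  linarith

lemma ph0_neg (t : ℝ) : ph 0 (-t) = ph 0 t := by unfold ph; rw [mm_neg, sub_zero, sub_zero, Hh_neg]
lemma pl_neg (t : ℝ) : pl (-t) = pl t := by unfold pl; rw [mm_neg, Hh_neg]

lemma gg_diff (t t' : ℝ) : |gg t - gg t'| ≤ 36 * |t^2 - t'^2| := even_diff nice_H nice_H Hh_neg Hh_neg t t'
lemma GG_diff (t t' : ℝ) : |GG t - GG t'| ≤ 36 * |t^2 - t'^2| := even_diff (nice_ph abs0) nice_pl ph0_neg pl_neg t t'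

lemma GG_eq (t : ℝ) : GG t = gg t - gg (t/2) / 2 := by
  have i1 := T2_int nice_H nice_H t 0
  have i2 := T2_int nice_m nice_H t 0
  have i3 := T2_int nice_H nice_m t 0
  have i4 := T2_int nice_m nice_m t 0
  have e : GG t = T2 Hh Hh t 0 - T2 mm Hh t 0 + T2 Hh mm t 0 - T2 mm mm t 0 := by
    unfold GG T2
    rw [sub_add_eq_add_sub]
    have h2 : (∫ p, Hh (t - p) * Hh (0 - p)) + (∫ p, Hh (t - p) * mm (0 - p)) - (∫ p, mm (t - p) * Hh (0 - p)) - (∫ p, mm (t - p) * mm (0 - p))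
      = ∫ p, ph 0 (t - p) * pl (0 - p) := by
      have : ∀ x y z w : ℝ, x + y - z - w = x - z - w + y := by intros; ring
      rw [this, int4 i1 i2 i4 i3]
      congr 1; ext p; unfold ph pl; rw [sub_zero (t-p)]; ring
    rw [← h2]
  have e2 : T2 Hh mm t 0 = T2 mm Hh t 0 := by
    have a1 : T2 Hh mm t 0 = T2 mm Hh 0 t := by unfold T2; congr 1; ext p; ring
    have a2 := T2_trans mm Hh 0 t (-t)
    have a3 := T2_neg mm Hh t 0
    simp only [mm_neg, Hh_neg, neg_zero] at a3
    change _ = T2 mm Hh t 0 at a3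
    rw [a1, ← a2, ← a3]; congr 1 <;> ring
  have e3 : T2 mm mm t 0 = gg (t/2) / 2 := by
    unfold gg T2
    have := Measure.integral_comp_div (fun q : ℝ => Hh (t/2 - q) * Hh (0 - q) / 4) (2:ℝ)
    have e : (fun p : ℝ => mm (t - p) * mm (0 - p)) = fun x => Hh (t/2 - x/2) * Hh (0 - x/2) / 4 := by
      ext p; unfold mm; rw [sub_div, sub_div]; ring_nf
    rw [e, this, abs_two, smul_eq_mul, integral_div]; ring
  rw [e, e2, e3]; unfold gg; ring

lemma sep {a b p s : ℝ} (h : 2 * s < |a - b|) : s < |a - p| ∨ s < |b - p| := by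
  by_contra hh; push Not at hh
  have := abs_sub_le a p b
  rw [abs_sub_comm p b] at this
  linarith [hh.1, hh.2]

lemma GG_bdd (t : ℝ) : |GG t| ≤ 72 := by
  have := int_bound (F := fun p => ph 0 (t - p) * pl (0 - p)) (K := 3*3) (a := t) (a' := t) ?_ ?_
  · unfold GG T2; linarith
  · intro p; rw [abs_mul]; have := (nice_ph abs0).bdd (t-p); have := nice_pl.bdd (0-p); gcongr
  · intro p h _; simp [(nice_ph abs0).supp _ h]

lemma GG_supp {t : ℝ} (h : 4 < |t|) : GG t = 0 := by
  unfold GG T2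
  refine integral_eq_zero_of_ae (Filter.Eventually.of_forall fun p => ?_)
  simp only [Pi.zero_apply]
  rcases sep (a := t) (b := 0) (p := p) (s := 2) (by rw [sub_zero]; linarith) with h | h
  · simp [(nice_ph abs0).supp _ h]
  · simp only [nice_pl.supp _ h, mul_zero]

lemma gg_nonneg (t : ℝ) : 0 ≤ gg t := by
  unfold gg T2; apply integral_nonneg; intro p
  exact mul_nonneg (Hh_nonneg _) (Hh_nonneg _)

lemma gg_le (t : ℝ) : gg t ≤ 8 := by
  have := int_bound (F := fun p => Hh (t - p) * Hh (0 - p)) (K := 1*1) (a := t) (a' := t) ?_ ?_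
  · unfold gg T2; linarith [le_abs_self (∫ p, Hh (t - p) * Hh (0 - p))]
  · intro p; rw [abs_of_nonneg (mul_nonneg (Hh_nonneg _) (Hh_nonneg _))]
    have := Hh_le_one (t-p); have := Hh_le_one (0-p); have := Hh_nonneg (0-p); gcongr
  · intro p h _; rw [nice_H.supp _ h, zero_mul]

lemma gg_supp {t : ℝ} (h : 2 < |t|) : gg t = 0 := by
  unfold gg T2
  refine integral_eq_zero_of_ae (Filter.Eventually.of_forall fun p => ?_)
  simp only [Pi.zero_apply]
  rcases sep (a := t) (b := 0) (p := p) (s := 1) (by rw [sub_zero]; linarith) with h | h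
  · rw [Hh_zero h.le, zero_mul]
  · rw [Hh_zero h.le, mul_zero]

lemma gg_lower {t : ℝ} (h : |t| ≤ 1) : 1/32 ≤ gg t := by
  unfold gg T2
  have hi := T2_int nice_H nice_H t 0
  have h1 : ∫ p in Icc (t/2-1/4) (t/2+1/4), (1/16:ℝ) ≤ ∫ p in Icc (t/2-1/4) (t/2+1/4), Hh (t - p) * Hh (0 - p) := by
    apply setIntegral_mono_on (integrableOn_const (by simp)) hi.integrableOn measurableSet_Icc
    intro p hp
    rw [abs_le] at h
    have a1 : 1/4 ≤ Hh (t - p) := by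
      refine le_trans ?_ (le_max_right _ _)
      have : |t - p| ≤ 3/4 := by rw [abs_le]; constructor <;> linarith [hp.1, hp.2]
      linarith
    have a2 : 1/4 ≤ Hh (0 - p) := by
      refine le_trans ?_ (le_max_right _ _)
      have : |0 - p| ≤ 3/4 := by rw [abs_le]; constructor <;> linarith [hp.1, hp.2]
      linarith
    nlinarith
  have h2 := setIntegral_le_integral (s := Icc (t/2-1/4) (t/2+1/4)) hi (Filter.Eventually.of_forall fun p => mul_nonneg (Hh_nonneg _) (Hh_nonneg _))
  have h3 : ∫ p in Icc (t/2-1/4) (t/2+1/4), (1/16:ℝ) = 1/32 := by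
    rw [setIntegral_const, Real.volume_real_Icc, smul_eq_mul]
    rw [show t/2+1/4 - (t/2-1/4) = 1/2 by ring]; norm_num
  linarith

lemma KK_nonneg (a b c : ℝ) : 0 ≤ KK a b c := by
  unfold KK T; apply integral_nonneg; intro p
  exact mul_nonneg (mul_nonneg (Hh_nonneg _) (Hh_nonneg _)) (Hh_nonneg _)

lemma T_bdd {f g h : ℝ → ℝ} (hf : Nice f) (hg : Nice g) (hh : Nice h) (a b c : ℝ) : |T f g h a b c| ≤ 216 := by
  have := int_bound (F := fun p => f (a - p) * g (b - p) * h (c - p)) (K := 3*3*3) (a := a) (a' := a) ?_ ?_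
  · unfold T; linarith
  · intro p; rw [abs_mul, abs_mul]; have := hf.bdd (a-p); have := hg.bdd (b-p); have := hh.bdd (c-p); gcongr
  · intro p h _; simp [hf.supp _ h]

lemma KK_bdd (a b c : ℝ) : |KK a b c| ≤ 216 := T_bdd nice_H nice_H nice_H a b c
lemma kap_bdd (a b c : ℝ) : |kap a b c| ≤ 216 := by
  unfold kap
  have h1 := T_bdd (nice_ph absm1) (nice_ph absm1) (nice_ch absm1) a b c
  have h2 := T_bdd (nice_ph abs0) (nice_ph abs0) (nice_ch abs0) a b c
  have h3 := T_bdd (nice_ph abs1) (nice_ph abs1) (nice_ch abs1) a b c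
  rw [abs_le] at *
  constructor <;> linarith

lemma T_supp {f g : ℝ → ℝ} (h : ℝ → ℝ) (hf : Nice f) (hg : Nice g) {a b : ℝ} (c : ℝ) (hab : 4 < |a - b|) : T f g h a b c = 0 := by
  unfold T
  rw [← integral_zero ℝ ℝ]; congr 1; ext p
  rcases sep (a := a) (b := b) (p := p) (s := 2) (by linarith) with h | h
  · simp [hf.supp _ h]
  · simp [hg.supp _ h]

lemma kap_supp {a b c : ℝ} (h : 4 < |a - b| ∨ 4 < |b - c| ∨ 4 < |c - a|) : kap a b c = 0 := by
  unfold kap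
  rcases h with h | h | h
  · rw [T_supp _ (nice_ph absm1) (nice_ph absm1) _ h, T_supp _ (nice_ph abs0) (nice_ph abs0) _ h, T_supp _ (nice_ph abs1) (nice_ph abs1) _ h]; simp
  · simp only [T_rot _ _ _ a b c]
    rw [T_supp _ (nice_ph absm1) (nice_ch absm1) _ h, T_supp _ (nice_ph abs0) (nice_ch abs0) _ h, T_supp _ (nice_ph abs1) (nice_ch abs1) _ h]; simp
  · simp only [T_rot _ _ _ a b c, T_rot _ _ _ b c a]
    rw [T_supp _ (nice_ch absm1) (nice_ph absm1) _ h, T_supp _ (nice_ch abs0) (nice_ph abs0) _ h, T_supp _ (nice_ch abs1) (nice_ph abs1) _ h]; simp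

lemma KK_supp1 {a b : ℝ} (c : ℝ) (h : 2 < |a - b|) : KK a b c = 0 := by
  unfold KK T
  rw [← integral_zero ℝ ℝ]; congr 1; ext p
  rcases sep (a := a) (b := b) (p := p) (s := 1) (by linarith) with h | h
  · simp [Hh_zero h.le]
  · simp [Hh_zero h.le]

lemma KK_rot (a b c : ℝ) : KK a b c = KK b c a := T_rot _ _ _ _ _ _

lemma KK_supp {a b c : ℝ} (h : 2 < |a - b| ∨ 2 < |b - c| ∨ 2 < |c - a|) : KK a b c = 0 := by
  rcases h with h | h | h
  · exact KK_supp1 _ h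
  · rw [KK_rot]; exact KK_supp1 _ h
  · rw [KK_rot, KK_rot]; exact KK_supp1 _ h

lemma T_meas {f g h : ℝ → ℝ} (hf : Nice f) (hg : Nice g) (hh : Nice h) :
    Measurable (fun q : ℝ × ℝ × ℝ => T f g h q.1 q.2.1 q.2.2) := by
  have h1 := hf.cont; have h2 := hg.cont; have h3 := hh.cont
  unfold T
  have : StronglyMeasurable (fun w : (ℝ × ℝ × ℝ) × ℝ => f (w.1.1 - w.2) * g (w.1.2.1 - w.2) * h (w.1.2.2 - w.2)) :=
    Continuous.stronglyMeasurable (by fun_prop)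
  exact this.integral_prod_right'.measurable

lemma T2_meas {f g : ℝ → ℝ} (hf : Nice f) (hg : Nice g) :
    Measurable (fun q : ℝ => T2 f g q 0) := by
  have h1 := hf.cont; have h2 := hg.cont
  unfold T2
  have : StronglyMeasurable (fun w : ℝ × ℝ => f (w.1 - w.2) * g (0 - w.2)) :=
    Continuous.stronglyMeasurable (by fun_prop)
  exact this.integral_prod_right'.measurable

lemma KK_meas : Measurable (fun q : ℝ × ℝ × ℝ => KK q.1 q.2.1 q.2.2) := T_meas nice_H nice_H nice_H
lemma kap_meas : Measurable (fun q : ℝ × ℝ × ℝ => kap q.1 q.2.1 q.2.2) := by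
  unfold kap
  exact (((T_meas (nice_ph absm1) (nice_ph absm1) (nice_ch absm1)).div_const 4).add
    ((T_meas (nice_ph abs0) (nice_ph abs0) (nice_ch abs0)).div_const 2)).add
    ((T_meas (nice_ph abs1) (nice_ph abs1) (nice_ch abs1)).div_const 4)
lemma gg_meas : Measurable gg := T2_meas nice_H nice_H
lemma GG_meas : Measurable GG := T2_meas (nice_ph abs0) nice_pl


lemma prod_int {α : Type*} [MeasurableSpace α] (ν : Measure α) [IsFiniteMeasure ν] {F : α × ℝ → ℝ}
    (hF : Measurable F) {K c : ℝ} (hb : ∀ q, |F q| ≤ K) (hz : ∀ q, 2 < |c - q.2| → F q = 0) :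
    Integrable F (ν.prod volume) := by
  have key : Integrable ((Icc (c-2) (c+2)).indicator (fun _ => K)) (volume : Measure ℝ) := by
    rw [integrable_indicator_iff measurableSet_Icc]
    exact integrableOn_const (by simp)
  have h2 := (integrable_const (μ := ν) (1:ℝ)).mul_prod key
  refine h2.mono' hF.aestronglyMeasurable (Filter.Eventually.of_forall fun q => ?_)
  by_cases h : q.2 ∈ Icc (c-2) (c+2)
  · simp only [indicator_of_mem h, one_mul]; exact hb q
  · have : F q = 0 := by
      apply hz
      by_contra hh; push Not at hh; rw [abs_le] at hh; exact h ⟨by linarith, by linarith⟩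
    simp [this, indicator_of_notMem h]

section psd
variable {α : Type*} [MeasurableSpace α] (ν : Measure α) [IsFiniteMeasure ν] {a : α → ℝ}

lemma Phi_meas (ha : Measurable a) {f : ℝ → ℝ} (hf : Nice f) : Measurable (fun p : ℝ => ∫ x, f (a x - p) ∂ν) := by
  have : StronglyMeasurable (fun w : ℝ × α => f (a w.2 - w.1)) := by
    have := hf.cont.measurable
    apply Measurable.stronglyMeasurable
    fun_prop
  exact this.integral_prod_right'.measurable

lemma Phi_bdd {f : ℝ → ℝ} (hf : Nice f) (p : ℝ) : |∫ x, f (a x - p) ∂ν| ≤ 3 * ν.real univ := by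
  have := norm_integral_le_of_norm_le_const (μ := ν) (f := fun x => f (a x - p)) (C := 3)
    (Filter.Eventually.of_forall fun x => hf.bdd _)
  simpa using this

lemma psd_T (ha : Measurable a) {f h : ℝ → ℝ} (hf : Nice f) (hh : Nice h) (c : ℝ) :
    ∫ q, T f f h (a q.1) (a q.2) c ∂(ν.prod ν) = ∫ p, h (c - p) * (∫ x, f (a x - p) ∂ν)^2 := by
  have h1 := hf.cont.measurable
  have h2 := hh.cont.measurable
  unfold T
  rw [integral_integral_swap]
  · congr 1; ext p
    rw [integral_mul_const, integral_prod_mul (μ := ν) (ν := ν) (fun x => f (a x - p)) (fun x => f (a x - p))]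
    ring
  · apply prod_int (ν.prod ν) (K := 3*3*3) (c := c)
    · unfold Function.uncurry; fun_prop
    · rintro ⟨q, p⟩
      simp only [Function.uncurry]
      rw [abs_mul, abs_mul]; have := hf.bdd (a q.1-p); have := hf.bdd (a q.2-p); have := hh.bdd (c-p); gcongr
    · rintro ⟨q, p⟩ hq
      simp only [Function.uncurry]
      simp [hh.supp _ hq]

lemma lin_T (ha : Measurable a) {f h : ℝ → ℝ} (hf : Nice f) (hh : Nice h) (c : ℝ) :
    ∫ x, T2 f h (a x) c ∂ν = ∫ p, h (c - p) * (∫ x, f (a x - p) ∂ν) := by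
  have h1 := hf.cont.measurable
  have h2 := hh.cont.measurable
  unfold T2
  rw [integral_integral_swap]
  · congr 1; ext p
    rw [integral_mul_const]
    ring
  · apply prod_int ν (K := 3*3) (c := c)
    · unfold Function.uncurry; fun_prop
    · rintro ⟨q, p⟩
      simp only [Function.uncurry]
      rw [abs_mul]; have := hf.bdd (a q-p); have := hh.bdd (c-p); gcongr
    · rintro ⟨q, p⟩ hq
      simp only [Function.uncurry]
      simp [hh.supp _ hq]

lemma bdd_int_prod (ha : Measurable a) {F : α × α → ℝ} (hF : Measurable F) {K : ℝ} (hb : ∀ q, |F q| ≤ K) : Integrable F (ν.prod ν) := by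
  clear ha
  exact Integrable.of_bound hF.aestronglyMeasurable K (Filter.Eventually.of_forall hb)

lemma wint (ha : Measurable a) {h : ℝ → ℝ} (hh : Nice h) (c : ℝ) {P : ℝ → ℝ} (hP : Measurable P) {K : ℝ} (hb : ∀ p, |P p| ≤ K) :
    Integrable (fun p => h (c - p) * P p) := by
  have h1 : Integrable (fun p => h (c - p)) := by
    have := nice_integrable hh (g := fun _ => 1) continuous_const c
    simpa using this
  exact h1.mul_bdd hP.aestronglyMeasurable (Filter.Eventually.of_forall hb)

lemma psd_main (ha : Measurable a) (c : ℝ) : (∫ x, GG (a x - c) ∂ν)^2 ≤ 48 * ∫ q, kap (a q.1) (a q.2) c ∂(ν.prod ν) := by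
  have e1 : ∫ x, GG (a x - c) ∂ν = ∫ p, pl (c - p) * (∫ x, ph 0 (a x - p) ∂ν) := by
    rw [← lin_T ν ha (nice_ph abs0) nice_pl]
    congr 1; ext x; unfold GG
    rw [← T2_trans _ _ _ _ c]; simp
  have mT : ∀ {f h : ℝ → ℝ}, Nice f → Nice h → Integrable (fun q : α × α => T f f h (a q.1) (a q.2) c) (ν.prod ν) := by
    intro f h hf hh
    apply bdd_int_prod ν ha (K := 216)
    · have : Measurable (fun q : α × α => ((a q.1, a q.2, c) : ℝ × ℝ × ℝ)) := by fun_prop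
      exact (T_meas hf hf hh).comp this
    · intro q; exact T_bdd hf hf hh _ _ _
  have e2 : ∫ q, kap (a q.1) (a q.2) c ∂(ν.prod ν) = (∫ p, ch (-1) (c - p) * (∫ x, ph (-1) (a x - p) ∂ν)^2) / 4
     + (∫ p, ch 0 (c - p) * (∫ x, ph 0 (a x - p) ∂ν)^2) / 2 + (∫ p, ch 1 (c - p) * (∫ x, ph 1 (a x - p) ∂ν)^2) / 4 := by
    rw [← psd_T ν ha (nice_ph absm1) (nice_ch absm1), ← psd_T ν ha (nice_ph abs0) (nice_ch abs0), ← psd_T ν ha (nice_ph abs1) (nice_ch abs1)]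
    unfold kap
    have i1 := (mT (nice_ph absm1) (nice_ch absm1)).div_const 4
    have i2 := (mT (nice_ph abs0) (nice_ch abs0)).div_const 2
    have i3 := (mT (nice_ph abs1) (nice_ch abs1)).div_const 4
    have i12 := i1.add i2
    simp only [Pi.add_def] at i12
    rw [integral_add i12 i3, integral_add i1 i2, integral_div, integral_div, integral_div]
  have chn : ∀ j t, 0 ≤ ch j t := fun j t => by unfold ch; linarith [Hh_nonneg (t-j), mm_nonneg t]
  have pln : ∀ t, 0 ≤ pl t := fun t => by unfold pl; linarith [Hh_nonneg t, mm_nonneg t]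
  have p1 : ∀ j, 0 ≤ ∫ p, ch j (c - p) * (∫ x, ph j (a x - p) ∂ν)^2 := fun j =>
    integral_nonneg fun p => mul_nonneg (chn _ _) (sq_nonneg _)
  have hm := Phi_meas ν ha (nice_ph abs0)
  have hb := Phi_bdd ν (a := a) (nice_ph abs0)
  set P : ℝ → ℝ := fun p => ∫ x, ph 0 (a x - p) ∂ν with hP
  have hb2 : ∀ p, |P p ^ 2| ≤ (3 * ν.real univ)^2 := fun p => by
    rw [abs_pow]; exact pow_le_pow_left₀ (abs_nonneg _) (hb p) 2
  have hi1 := wint ha nice_pl c hm hb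
  have hi2 := wint ha nice_pl c (hm.pow_const 2) hb2
  have hi3 := wint ha (nice_ch abs0) c (hm.pow_const 2) hb2
  have hi0 : Integrable (fun p => pl (c - p)) := by
    have := nice_integrable nice_pl (g := fun _ => 1) continuous_const c
    simpa using this
  have cmp : ∫ p, pl (c - p) * P p ^ 2 ≤ ∫ p, ch 0 (c - p) * P p ^ 2 := by
    apply integral_mono hi2 hi3
    intro p
    apply mul_le_mul_of_nonneg_right _ (sq_nonneg _)
    unfold pl ch; rw [sub_zero]; linarith [mm_nonneg (c-p)]
  have hW : ∫ p, pl (c - p) ≤ 24 := by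
    have := int_bound (F := fun p => pl (c - p)) (K := 3) (a := c) (a' := c) (fun p => nice_pl.bdd _) (fun p h _ => nice_pl.supp _ h)
    linarith [le_abs_self (∫ p, pl (c - p))]
  set I := ∫ p, pl (c - p) * P p with hI
  have cs : 0 ≤ ∫ p, (pl (c - p) * P p ^ 2 - (I/12) * (pl (c - p) * P p) + (I/24)^2 * pl (c - p)) := by
    apply integral_nonneg; intro p
    have : pl (c - p) * P p ^ 2 - (I/12) * (pl (c - p) * P p) + (I/24)^2 * pl (c - p) = pl (c-p) * (P p - I/24)^2 := by ring
    simp only [Pi.zero_apply]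
    rw [this]; exact mul_nonneg (pln _) (sq_nonneg _)
  have j1 := hi1.const_mul (I/12)
  have j2 := hi0.const_mul ((I/24)^2)
  have j3 := hi2.sub j1
  simp only [Pi.sub_def] at j3
  rw [integral_add j3 j2, integral_sub hi2 j1, integral_const_mul, integral_const_mul, ← hI] at cs
  rw [e1, e2]
  have q1 := p1 (-1)
  have q2 := p1 1
  have : (I/24)^2 * ∫ p, pl (c - p) ≤ (I/24)^2 * 24 := by gcongr
  nlinarith

end psd


abbrev E := EuclideanSpace ℝ (Fin 2)

def det (u v : E) : ℝ := u 0 * v 1 - u 1 * v 0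
def ip (u v : E) : ℝ := u 0 * v 0 + u 1 * v 1

lemma nsq (u : E) : ‖u‖^2 = u 0 ^2 + u 1 ^2 := by
  rw [EuclideanSpace.real_norm_sq_eq, Fin.sum_univ_two]

lemma dsq (u v : E) : dist u v ^2 = (u 0 - v 0)^2 + (u 1 - v 1)^2 := by
  rw [dist_eq_norm, nsq]; simp

lemma abs_coord (u : E) (i : Fin 2) : |u i| ≤ ‖u‖ := by
  apply abs_le_of_sq_le_sq _ (norm_nonneg _)
  rw [nsq]; fin_cases i <;> simp <;> positivity

lemma norm_le_coord (u : E) {s : ℝ} (h0 : |u 0| ≤ s) (h1 : |u 1| ≤ s) : ‖u‖ ≤ 3/2 * s := by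
  have hs : 0 ≤ s := (abs_nonneg _).trans h0
  apply le_of_sq_le_sq _ (by positivity)
  rw [nsq]
  have a0 : u 0 ^2 ≤ s^2 := sq_le_sq' (by linarith [abs_le.1 h0]) (abs_le.1 h0).2
  have a1 : u 1 ^2 ≤ s^2 := sq_le_sq' (by linarith [abs_le.1 h1]) (abs_le.1 h1).2
  nlinarith

lemma infDist_line (S : Set E) (p v : E) (hv : v 0 ^2 + v 1 ^2 = 1)
    (hS : ∀ q, q ∈ S ↔ ∃ t : ℝ, q = p + t • v) (y : E) :
    infDist y S = |v 0 * (y 1 - p 1) - v 1 * (y 0 - p 0)| := by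
  apply le_antisymm
  · have hm : p + (v 0 * (y 0 - p 0) + v 1 * (y 1 - p 1)) • v ∈ S := (hS _).2 ⟨_, rfl⟩
    refine (infDist_le_dist_of_mem hm).trans ?_
    apply le_of_sq_le_sq _ (abs_nonneg _)
    rw [sq_abs, dsq]
    simp only [PiLp.add_apply, PiLp.smul_apply, smul_eq_mul]
    apply le_of_eq
    have h1 : v 1 ^2 = 1 - v 0^2 := by linarith
    linear_combination (((v 0 * (y 0 - p 0) + v 1 * (y 1 - p 1))^2) - ((y 0 - p 0)^2 + (y 1 - p 1)^2)) * hv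
  · have hne : S.Nonempty := ⟨p, (hS p).2 ⟨0, by simp⟩⟩
    rw [le_infDist hne]
    intro q hq
    obtain ⟨t, rfl⟩ := (hS q).1 hq
    apply le_of_sq_le_sq _ dist_nonneg
    rw [sq_abs, dsq]
    simp only [PiLp.add_apply, PiLp.smul_apply, smul_eq_mul]
    have : v 0 * (y 1 - p 1) - v 1 * (y 0 - p 0) = v 0 * (y 1 - (p 1 + t * v 1)) - v 1 * (y 0 - (p 0 + t * v 0)) := by ring
    rw [this]
    generalize y 1 - (p 1 + t * v 1) = B
    generalize y 0 - (p 0 + t * v 0) = A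
    nlinarith [sq_nonneg (v 0 * A + v 1 * B)]

abbrev Lines := {L : AffineSubspace ℝ (EuclideanSpace ℝ (Fin 2)) // Module.finrank ℝ L.direction = 1}

lemma unit_of_ne {v : E} (hv : v ≠ 0) : (‖v‖⁻¹ • v) 0 ^2 + (‖v‖⁻¹ • v) 1 ^2 = 1 := by
  rw [← nsq, norm_smul, norm_inv, norm_norm, inv_mul_cancel₀ (norm_ne_zero_iff.2 hv)]; norm_num

lemma line_repr (L : Lines) : ∃ n0 n1 b : ℝ, n0^2 + n1^2 = 1 ∧ ∀ y : E, infDist y (L.1 : Set E) ^ 2 = (n0 * y 0 + n1 * y 1 - b)^2 := by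
  obtain ⟨L, hL⟩ := L
  obtain ⟨v, hv, hspan⟩ := finrank_eq_one_iff'.1 hL
  have hne : (L : Set E).Nonempty := by
    rw [AffineSubspace.nonempty_iff_ne_bot]
    rintro rfl
    rw [AffineSubspace.direction_bot] at hL
    simp at hL
  obtain ⟨p, hp⟩ := hne
  have hv' : (v : E) ≠ 0 := by simpa using hv
  have key := infDist_line (L : Set E) p (‖(v:E)‖⁻¹ • (v : E)) (unit_of_ne hv') ?_
  · have hu := unit_of_ne hv'
    generalize ‖(v:E)‖⁻¹ • (v : E) = u at *
    refine ⟨- u 1, u 0, u 0 * p 1 - u 1 * p 0, by rw [neg_sq]; linarith, fun y => ?_⟩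
    rw [key, sq_abs]; ring
  · intro q
    constructor
    · intro hq
      obtain ⟨c, hc⟩ := hspan ⟨q -ᵥ p, AffineSubspace.vsub_mem_direction hq hp⟩
      have hc' : c • (v : E) = q - p := by
        have := congrArg Subtype.val hc; simpa using this
      refine ⟨c * ‖(v:E)‖, ?_⟩
      rw [smul_smul, mul_assoc, mul_inv_cancel₀ (norm_ne_zero_iff.2 hv'), mul_one, hc']; abel
    · rintro ⟨t, rfl⟩
      rw [add_comm, smul_smul]
      exact AffineSubspace.vadd_mem_of_mem_direction (L.direction.smul_mem _ v.2) hp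

lemma thru {y z : E} (h : y ≠ z) : ∃ L : Lines, ∀ w : E, infDist w (L.1 : Set E) ^ 2 = det (y - w) (z - w) ^ 2 / dist y z ^ 2 := by
  have hv : z - y ≠ 0 := sub_ne_zero.2 h.symm
  have hn : ‖z - y‖ ≠ 0 := norm_ne_zero_iff.2 hv
  refine ⟨⟨AffineSubspace.mk' y (Submodule.span ℝ {z - y}), ?_⟩, fun w => ?_⟩
  · rw [AffineSubspace.direction_mk', finrank_span_singleton hv]
  · have key := infDist_line (AffineSubspace.mk' y (Submodule.span ℝ {z - y}) : Set E) y (‖z - y‖⁻¹ • (z - y)) (unit_of_ne hv) ?_ w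
    · simp only
      rw [key, sq_abs, dist_comm, dist_eq_norm]
      simp only [PiLp.smul_apply, PiLp.sub_apply, smul_eq_mul, det]
      field_simp
      ring
    · intro q
      rw [SetLike.mem_coe, AffineSubspace.mem_mk', Submodule.mem_span_singleton]
      constructor
      · rintro ⟨a, ha⟩
        refine ⟨a * ‖z - y‖, ?_⟩
        rw [smul_smul, mul_assoc, mul_inv_cancel₀ hn, mul_one, ha]; simp
      · rintro ⟨t, rfl⟩
        exact ⟨t * ‖z-y‖⁻¹, by simp [smul_smul]⟩

lemma core {wt wn vt vn l : ℝ} (hl : l^2 = wt^2 + wn^2) (hl0 : 0 < l) (hv : vt^2 + vn^2 ≤ l^2) (hw : 0 ≤ wt) :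
    |(wt * vt + wn * vn) / l - vt| ≤ (wn^2 + (wn^2 + vn^2)/2) / l := by
  have h1 : (wt * vt + wn * vn) / l - vt = (wt * vt + wn * vn - l * vt) / l := by field_simp
  rw [h1, abs_div, abs_of_pos hl0]
  apply div_le_div_of_nonneg_right _ hl0.le
  have hvt : |vt| ≤ l := abs_le_of_sq_le_sq (by nlinarith [sq_nonneg vn]) hl0.le
  have hwl : wt ≤ l := le_of_sq_le_sq (by nlinarith [sq_nonneg wn]) hl0.le
  have h2 : |(l - wt) * vt| ≤ wn^2 := by
    rw [abs_mul, abs_of_nonneg (by linarith)]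
    calc (l - wt) * |vt| ≤ (l - wt) * l := by gcongr
      _ ≤ (l-wt) * (l+wt) := by nlinarith
      _ = wn^2 := by linarith
  have h3 : |wn * vn| ≤ (wn^2+vn^2)/2 := by
    rw [abs_le]; constructor <;> nlinarith [sq_nonneg (wn+vn), sq_nonneg (wn-vn)]
  have : wt * vt + wn * vn - l * vt = -((l-wt)*vt) + wn * vn := by ring
  rw [this]
  refine (abs_add_le _ _).trans ?_
  rw [abs_neg]; linarith

/-- `e` is the unit direction of a longest side of `x,y,z`. -/
def IsDir (e x y z : E) : Prop := ∃ p ∈ ({x, y, z} : Set E), ∃ q ∈ ({x, y, z} : Set E),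
  e = ‖p - q‖⁻¹ • (p - q) ∧ ‖x - z‖ ≤ ‖p - q‖ ∧ ‖y - z‖ ≤ ‖p - q‖ ∧ ‖x - y‖ ≤ ‖p - q‖

lemma AP {C : ℝ} {f : ℝ → ℝ → ℝ → ℝ} (hf : Inv3 C f) (hC : 0 ≤ C) {e x y z : E} (he : IsDir e x y z)
    {n0 n1 : ℝ} (b : ℝ) (hn : n0^2 + n1^2 = 1) {r : ℝ} (hr : 0 < r) {D t : E → ℝ} (hD : ∀ y, D y = n0 * y 0 + n1 * y 1 - b)
    (ht : ∀ y, t y = -n1 * y 0 + n0 * y 1) :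
    |f (ip e x / r) (ip e y / r) (ip e z / r) - f (t x / r) (t y / r) (t z / r)| ≤
      30 * C * (D x ^2 + D y ^2 + D z ^2) / r^2 := by
  obtain ⟨p, hp, q, hq, rfl, h1, h2, h3⟩ := he
  set l := ‖p - q‖ with hl
  rcases eq_or_lt_of_le (norm_nonneg (p-q)) with h0 | h0
  · rw [← hl] at h0
    rw [← h0] at h1 h2
    have e1 : x = z := by simpa [sub_eq_zero] using h1
    have e2 : y = z := by simpa [sub_eq_zero] using h2
    subst e1; subst e2
    have : ∀ a, f a a a = f 0 0 0 := fun a => by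
      have := hf.trans 0 0 0 a; simpa using this
    rw [this (ip _ y / r), this (t y / r), sub_self, abs_zero]; positivity
  rw [← hl] at h0
  set S := D x ^2 + D y ^2 + D z ^2 with hS
  -- difference of D
  have hDd : ∀ u ∈ ({x, y, z} : Set E), ∀ v ∈ ({x, y, z} : Set E), (n0 * (u 0 - v 0) + n1 * (u 1 - v 1))^2 ≤ 2 * S := by
    intro u hu v hv
    have e : n0 * (u 0 - v 0) + n1 * (u 1 - v 1) = D u - D v := by rw [hD, hD]; ring
    rw [e, hS]
    simp only [mem_insert_iff, mem_singleton_iff] at hu hv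
    have s1 := sq_nonneg (D x); have s2 := sq_nonneg (D y); have s3 := sq_nonneg (D z)
    have s4 := sq_nonneg (D x + D y); have s5 := sq_nonneg (D x + D z); have s6 := sq_nonneg (D y + D z)
    have : D u = D x ∨ D u = D y ∨ D u = D z := by
      rcases hu with rfl | rfl | rfl <;> simp
    have h' : D v = D x ∨ D v = D y ∨ D v = D z := by
      rcases hv with rfl | rfl | rfl <;> simp
    rcases this with h | h | h <;> rcases h' with h' | h' | h' <;> rw [h, h'] <;> linarith
  have pyth : ∀ u : E, (-n1 * u 0 + n0 * u 1)^2 + (n0 * u 0 + n1 * u 1)^2 = ‖u‖^2 := by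
    intro u; rw [nsq]; linear_combination (u 0^2 + u 1^2) * hn
  have main : ∀ u ∈ ({x, y} : Set E), ∀ σ : ℝ, (σ = 1 ∨ σ = -1) → 0 ≤ σ * (-n1 * (p-q) 0 + n0 * (p-q) 1) → 
      |ip (l⁻¹ • (p - q)) (u - z) - σ * (-n1 * (u-z) 0 + n0 * (u-z) 1)| ≤ 4 * S / l := by
    intro u hu σ hσ hs
    have hu' : u ∈ ({x, y, z} : Set E) := by
      simp only [mem_insert_iff, mem_singleton_iff] at hu ⊢; tauto
    have hσ2 : σ^2 = 1 := by rcases hσ with rfl | rfl <;> norm_num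
    have hul : ‖u - z‖ ≤ l := by
      simp only [mem_insert_iff, mem_singleton_iff] at hu
      rcases hu with rfl | rfl <;> assumption
    have k := core (wt := σ * (-n1 * (p-q) 0 + n0 * (p-q) 1)) (wn := n0 * (p-q) 0 + n1 * (p-q) 1)
      (vt := σ * (-n1 * (u-z) 0 + n0 * (u-z) 1)) (vn := n0 * (u-z) 0 + n1 * (u-z) 1) (l := l) ?_ h0 ?_ hs
    · have e : ip (l⁻¹ • (p - q)) (u - z) = (σ * (-n1 * (p-q) 0 + n0 * (p-q) 1) * (σ * (-n1 * (u-z) 0 + n0 * (u-z) 1)) +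
         (n0 * (p-q) 0 + n1 * (p-q) 1) * (n0 * (u-z) 0 + n1 * (u-z) 1)) / l := by
        unfold ip
        simp only [PiLp.smul_apply, smul_eq_mul]
        generalize (p-q) 0 = A; generalize (p-q) 1 = B; generalize (u-z) 0 = A'; generalize (u-z) 1 = B'
        rw [eq_div_iff h0.ne']
        have : (l⁻¹ * A * A' + l⁻¹ * B * B') * l = A * A' + B * B' := by field_simp
        rw [this]
        linear_combination (-(-n1 * A + n0 * B)*(-n1*A' + n0*B')) * hσ2 - (A * A' + B * B') * hn
      rw [e]
      refine k.trans ?_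
      apply div_le_div_of_nonneg_right _ h0.le
      have a1 := hDd p hp q hq
      have a2 := hDd u hu' z (by simp)
      simp only [PiLp.sub_apply]
      linarith
    · rw [mul_pow, hσ2, one_mul, pyth]
    · rw [mul_pow, hσ2, one_mul, pyth]
      exact pow_le_pow_left₀ (norm_nonneg _) hul 2
  -- choose the sign
  obtain ⟨σ, hσ, hs⟩ : ∃ σ : ℝ, (σ = 1 ∨ σ = -1) ∧ 0 ≤ σ * (-n1 * (p-q) 0 + n0 * (p-q) 1) := by
    rcases le_total 0 (-n1 * (p-q) 0 + n0 * (p-q) 1) with h | h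
    · exact ⟨1, Or.inl rfl, by linarith⟩
    · exact ⟨-1, Or.inr rfl, by linarith⟩
  have hσa : |σ| = 1 := by rcases hσ with rfl | rfl <;> norm_num
  have mx := main x (by simp) σ hσ hs
  have my := main y (by simp) σ hσ hs
  -- rewrite
  have E1 : f (ip (l⁻¹ • (p - q)) x / r) (ip (l⁻¹ • (p - q)) y / r) (ip (l⁻¹ • (p - q)) z / r) =
      f (ip (l⁻¹ • (p - q)) (x-z) / r) (ip (l⁻¹ • (p - q)) (y-z) / r) 0 := by
    rw [← hf.trans _ _ 0 (ip (l⁻¹ • (p - q)) z / r)]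
    unfold ip
    simp only [PiLp.sub_apply]
    congr 1 <;> ring
  have E2 : f (t x / r) (t y / r) (t z / r) = f (σ * (-n1 * (x-z) 0 + n0 * (x-z) 1) / r) (σ * (-n1 * (y-z) 0 + n0 * (y-z) 1) / r) 0 := by
    have : f (t x / r) (t y / r) (t z / r) = f ((-n1 * (x-z) 0 + n0 * (x-z) 1) / r) ((-n1 * (y-z) 0 + n0 * (y-z) 1) / r) 0 := by
      rw [← hf.trans _ _ 0 (t z / r), ht, ht, ht]
      simp only [PiLp.sub_apply]
      congr 1 <;> ring
    rw [this]
    rcases hσ with rfl | rfl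
    · simp
    · rw [← hf.neg]; congr 1 <;> ring
  rw [E1, E2]
  have bd : ∀ u : E, ‖u‖ ≤ l → |ip (l⁻¹ • (p - q)) u| ≤ l ∧ |σ * (-n1 * u 0 + n0 * u 1)| ≤ l := by
    intro u hu
    have hu2 : ‖u‖^2 ≤ l^2 := pow_le_pow_left₀ (norm_nonneg _) hu 2
    constructor
    · apply abs_le_of_sq_le_sq _ h0.le
      have h5 := unit_of_ne (v := p - q) (norm_pos_iff.1 h0)
      rw [← hl] at h5
      rw [nsq] at hu2
      unfold ip
      generalize l⁻¹ • (p-q) = w at *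
      nlinarith [sq_nonneg (w 0 * u 1 - w 1 * u 0)]
    · rw [abs_mul, hσa, one_mul]
      apply abs_le_of_sq_le_sq _ h0.le
      have := pyth u
      nlinarith [sq_nonneg (n0 * u 0 + n1 * u 1)]
  have bx := bd _ h1
  have by' := bd _ h2
  have dv : ∀ {a s : ℝ}, |a| ≤ s → |a / r| ≤ s / r := by
    intro a s h; rw [abs_div, abs_of_pos hr]; gcongr
  have := hf.near hC (dv bx.1) (dv bx.2) (dv by'.1) (dv by'.2) (δ := 4 * S / l / r) (by rw [← sub_div]; exact dv mx) (by rw [← sub_div]; exact dv my)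
  refine this.trans ?_
  have e : 6 * C * (4 * S / l / r * (l / r)) = 24 * C * S / r^2 := by field_simp; ring
  rw [e]
  have : 0 ≤ S := by positivity
  gcongr
  norm_num

lemma far_dir {e x y z : E} (he : IsDir e x y z) {r s : ℝ} (hr : 0 < r)
    (h : s * r < ‖x - y‖ ∨ s * r < ‖y - z‖ ∨ s * r < ‖x - z‖) (hs : 0 ≤ s) :
    s < |ip e x / r - ip e y / r| ∨ s < |ip e y / r - ip e z / r| ∨ s < |ip e z / r - ip e x / r| := by
  obtain ⟨p, hp, q, hq, rfl, h1, h2, h3⟩ := he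
  have hl : s * r < ‖p - q‖ := by rcases h with h | h | h <;> linarith
  have h0 : 0 < ‖p - q‖ := lt_of_le_of_lt (by positivity) hl
  have e0 : ip (‖p - q‖⁻¹ • (p - q)) p - ip (‖p - q‖⁻¹ • (p - q)) q = ‖p - q‖ := by
    have := nsq (p - q)
    unfold ip
    simp only [PiLp.smul_apply, smul_eq_mul, PiLp.sub_apply] at *
    field_simp
    rw [this]; ring
  have key : s < |ip (‖p - q‖⁻¹ • (p - q)) p / r - ip (‖p - q‖⁻¹ • (p - q)) q / r| := by
    rw [← sub_div, e0, abs_of_nonneg (by positivity), lt_div_iff₀ hr]; exact hl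
  generalize ‖p - q‖⁻¹ • (p - q) = e at *
  simp only [mem_insert_iff, mem_singleton_iff] at hp hq
  have z0 : ∀ a : ℝ, ¬ s < |a - a| := fun a => by simp [hs]
  rcases hp with rfl | rfl | rfl <;> rcases hq with rfl | rfl | rfl <;>
   first
   | exact absurd key (z0 _)
   | exact Or.inl key
   | exact Or.inr (Or.inl key)
   | exact Or.inr (Or.inr key)
   | (rw [abs_sub_comm] at key
      first
      | exact Or.inl key
      | exact Or.inr (Or.inl key)
      | exact Or.inr (Or.inr key))

lemma det_le {x y z : E} {n0 n1 : ℝ} (b : ℝ) (hn : n0^2 + n1^2 = 1) {r : ℝ} (hy : ‖y - x‖ ≤ r) (hz : ‖z - x‖ ≤ r)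
    {D : E → ℝ} (hD : ∀ y, D y = n0 * y 0 + n1 * y 1 - b) :
    det (y - x) (z - x) ^ 2 ≤ 8 * r^2 * (D x ^2 + D y ^2 + D z ^2) := by
  have hr : 0 ≤ r := (norm_nonneg _).trans hy
  have pyth : ∀ u : E, (-n1 * u 0 + n0 * u 1)^2 + (n0 * u 0 + n1 * u 1)^2 = ‖u‖^2 := by
    intro u; rw [nsq]; linear_combination (u 0^2 + u 1^2) * hn
  have e1 : D y - D x = n0 * (y-x) 0 + n1 * (y-x) 1 := by rw [hD, hD]; simp only [PiLp.sub_apply]; ring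
  have e2 : D z - D x = n0 * (z-x) 0 + n1 * (z-x) 1 := by rw [hD, hD]; simp only [PiLp.sub_apply]; ring
  have p1 := pyth (y-x)
  have p2 := pyth (z-x)
  have hy2 : ‖y-x‖^2 ≤ r^2 := pow_le_pow_left₀ (norm_nonneg _) hy 2
  have hz2 : ‖z-x‖^2 ≤ r^2 := pow_le_pow_left₀ (norm_nonneg _) hz 2
  rw [← e1] at p1
  rw [← e2] at p2
  have ed : det (y-x) (z-x) = (D y - D x) * (-n1 * (z-x) 0 + n0 * (z-x) 1) - (D z - D x) * (-n1 * (y-x) 0 + n0 * (y-x) 1) := by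
    rw [e1, e2]; unfold det
    linear_combination (-((y-x) 0 * (z-x) 1 - (y-x) 1 * (z-x) 0)) * hn
  rw [ed]
  generalize (-n1 * (z-x) 0 + n0 * (z-x) 1) = B at *
  generalize (-n1 * (y-x) 0 + n0 * (y-x) 1) = A at *
  have hA : A^2 ≤ r^2 := by nlinarith [sq_nonneg (D y - D x)]
  have hB : B^2 ≤ r^2 := by nlinarith [sq_nonneg (D z - D x)]
  have s1 : ((D y - D x) * B - (D z - D x) * A)^2 ≤ 2 * ((D y - D x)^2 * B^2 + (D z - D x)^2 * A^2) := by
    nlinarith [sq_nonneg ((D y - D x) * B + (D z - D x) * A)]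
  have s2 : (D y - D x)^2 * B^2 ≤ (D y - D x)^2 * r^2 := by gcongr
  have s3 : (D z - D x)^2 * A^2 ≤ (D z - D x)^2 * r^2 := by gcongr
  have s4 : (D y - D x)^2 + (D z - D x)^2 ≤ 4 * (D x ^2 + D y ^2 + D z ^2) := by
    nlinarith [sq_nonneg (D y + D x), sq_nonneg (D z + D x), sq_nonneg (D y), sq_nonneg (D z)]
  have s5 := mul_le_mul_of_nonneg_right s4 (sq_nonneg r)
  linarith


def cidx (r : ℝ) (x : E) : ℤ × ℤ := (⌊x 0 / r⌋, ⌊x 1 / r⌋)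
def Qc (r : ℝ) (n : ℤ × ℤ) : Set E := cidx r ⁻¹' {n}
def Bc (r : ℝ) (n : ℤ × ℤ) : Set E := cidx r ⁻¹' {m | |m.1 - n.1| ≤ 5 ∧ |m.2 - n.2| ≤ 5}
def In (μ : Measure E) (r : ℝ) (n : ℤ × ℤ) : ℝ≥0∞ :=
  ⨅ L : Lines, ∫⁻ y in Bc r n, ENNReal.ofReal (infDist y (L.1 : Set E) ^ 2) ∂μ
def Err (μ : Measure E) (r : ℝ) : ℝ≥0∞ := ∑' n, μ (Bc r n) ^ 2 * In μ r n

lemma cidx_meas (r : ℝ) : Measurable (cidx r) := by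
  unfold cidx
  have h0 : Measurable (fun x : E => x 0) := by fun_prop
  have h1 : Measurable (fun x : E => x 1) := by fun_prop
  exact (Int.measurable_floor.comp (h0.div_const r)).prodMk (Int.measurable_floor.comp (h1.div_const r))

lemma Qc_meas (r : ℝ) (n) : MeasurableSet (Qc r n) := cidx_meas r (measurableSet_singleton n)
lemma Bc_meas (r : ℝ) (n) : MeasurableSet (Bc r n) := cidx_meas r (MeasurableSet.of_discrete)

lemma Qc_disj (r : ℝ) : Pairwise (Function.onFun Disjoint (Qc r)) := by
  intro m n h
  exact Disjoint.preimage _ (by simpa using h)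

lemma Qc_union (r : ℝ) : ⋃ n, Qc r n = univ := by
  ext x; simp [Qc]

lemma Qc_sub_Bc (r : ℝ) (n) : Qc r n ⊆ Bc r n := by
  intro x hx
  have : cidx r x = n := hx
  simp [Bc, this]

lemma lint_cells (μ : Measure E) (r : ℝ) (f : E → ℝ≥0∞) : ∫⁻ x, f x ∂μ = ∑' n, ∫⁻ x in Qc r n, f x ∂μ := by
  rw [← lintegral_iUnion (Qc_meas r) (Qc_disj r), Qc_union, Measure.restrict_univ]

lemma ofReal_le_tsum {ι : Type*} {f : ι → ℝ} {s : ℝ} (h : HasSum f s) :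
    ENNReal.ofReal s ≤ ∑' i, ENNReal.ofReal (f i) := by
  have := (ENNReal.continuous_ofReal.tendsto s).comp h
  refine le_of_tendsto this (Filter.Eventually.of_forall fun t => ?_)
  refine le_trans ?_ (ENNReal.sum_le_tsum t)
  simp only [Function.comp]
  exact Finset.le_sum_of_subadditive _ ENNReal.ofReal_zero.le (fun a b => ENNReal.ofReal_add_le) _ _

lemma int_cells (μ : Measure E) (r : ℝ) {f : E → ℝ} (hf : Integrable f μ) :
    ENNReal.ofReal (∫ x, f x ∂μ) ≤ ∑' n, ENNReal.ofReal (∫ x in Qc r n, f x ∂μ) := by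
  apply ofReal_le_tsum
  have := hasSum_integral_iUnion (μ := μ) (Qc_meas r) (Qc_disj r) (f := f) hf.integrableOn
  rwa [Qc_union, Measure.restrict_univ] at this

lemma floor_near {a b : ℝ} (h : |a - b| ≤ 4) : |⌊a⌋ - ⌊b⌋| ≤ 5 := by
  rw [abs_le] at *
  have h1 := Int.floor_le a
  have h2 := Int.lt_floor_add_one a
  have h3 := Int.floor_le b
  have h4 := Int.lt_floor_add_one b
  constructor
  · have : (⌊b⌋ : ℝ) < ⌊a⌋ + 6 := by linarith
    have : ⌊b⌋ < ⌊a⌋ + 6 := by exact_mod_cast this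
    lia
  · have : (⌊a⌋ : ℝ) < ⌊b⌋ + 6 := by linarith
    have : ⌊a⌋ < ⌊b⌋ + 6 := by exact_mod_cast this
    lia

lemma near_mem_Bc {r : ℝ} (hr : 0 < r) {n} {x z : E} (hz : z ∈ Qc r n) (h : ‖x - z‖ ≤ 4 * r) : x ∈ Bc r n := by
  have hz' : cidx r z = n := hz
  subst hz'
  have key : ∀ i : Fin 2, |x i / r - z i / r| ≤ 4 := by
    intro i
    rw [← sub_div, abs_div, abs_of_pos hr, div_le_iff₀ hr]
    have := abs_coord (x - z) i
    simp only [PiLp.sub_apply] at this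
    linarith
  exact ⟨floor_near (key 0), floor_near (key 1)⟩

lemma floor_far {a b : ℝ} {M : ℤ} (h : |⌊a⌋ - ⌊b⌋| ≤ M) : |a - b| ≤ M + 1 := by
  have h1 := Int.floor_le a
  have h2 := Int.lt_floor_add_one a
  have h3 := Int.floor_le b
  have h4 := Int.lt_floor_add_one b
  rw [abs_le] at *
  have a1 : (-M : ℝ) ≤ ⌊a⌋ - ⌊b⌋ := by exact_mod_cast h.1
  have a2 : (⌊a⌋ - ⌊b⌋ : ℝ) ≤ M := by exact_mod_cast h.2
  constructor <;> linarith

lemma idx_far {r : ℝ} (hr : 0 < r) {x y : E} {M : ℤ} (h0 : |(cidx r x).1 - (cidx r y).1| ≤ M) (h1 : |(cidx r x).2 - (cidx r y).2| ≤ M) :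
    dist x y ≤ 3/2 * ((M+1) * r) := by
  rw [dist_eq_norm]
  apply norm_le_coord
  · have := floor_far h0
    rw [← sub_div, abs_div, abs_of_pos hr, div_le_iff₀ hr] at this
    simpa using this
  · have := floor_far h1
    rw [← sub_div, abs_div, abs_of_pos hr, div_le_iff₀ hr] at this
    simpa using this

def JJ : Finset (ℤ × ℤ) := Finset.Icc (-5) 5 ×ˢ Finset.Icc (-5) 5

lemma mem_JJ {j : ℤ × ℤ} : j ∈ JJ ↔ |j.1| ≤ 5 ∧ |j.2| ≤ 5 := by
  simp [JJ, Finset.mem_product, abs_le]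

lemma Bc_sub (r : ℝ) (n : ℤ × ℤ) : Bc r n ⊆ ⋃ j ∈ JJ, Qc r (n + j) := by
  intro x hx
  simp only [mem_iUnion]
  refine ⟨cidx r x - n, ?_, ?_⟩
  · rw [mem_JJ]; exact hx
  · simp [Qc]

lemma muB_sq (μ : Measure E) (r : ℝ) (n) : μ (Bc r n) ^ 2 ≤ 14641 * ∑ j ∈ JJ, μ (Qc r (n + j)) ^ 2 := by
  have h1 : μ (Bc r n) ≤ ∑ j ∈ JJ, μ (Qc r (n + j)) :=
    (measure_mono (Bc_sub r n)).trans (measure_biUnion_finset_le _ _)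
  obtain ⟨j, hj, hmax⟩ := Finset.exists_max_image JJ (fun j => μ (Qc r (n + j))) ⟨0, by rw [mem_JJ]; simp⟩
  have h2 : ∑ j ∈ JJ, μ (Qc r (n + j)) ≤ 121 * μ (Qc r (n+j)) := by
    refine (Finset.sum_le_card_nsmul _ _ _ hmax).trans ?_
    have : JJ.card = 121 := by rfl
    rw [this]; simp
  calc μ (Bc r n) ^ 2 ≤ (121 * μ (Qc r (n+j)))^2 := by gcongr; exact h1.trans h2
    _ = 14641 * μ (Qc r (n+j))^2 := by rw [mul_pow]; norm_num
    _ ≤ _ := by gcongr; exact Finset.single_le_sum (f := fun j => μ (Qc r (n + j)) ^ 2) (fun _ _ => zero_le) hj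

def Fj (μ : Measure E) (x : E) (r : ℝ) : ℝ≥0∞ :=
  beta2sq μ x r * (μ (closedBall x r) / ENNReal.ofReal r) / ENNReal.ofReal r

lemma div_ofReal (a : ℝ≥0∞) {r : ℝ} (hr : 0 < r) : a / ENNReal.ofReal r = ENNReal.ofReal r⁻¹ * a := by
  rw [div_eq_mul_inv, ENNReal.ofReal_inv_of_pos hr, mul_comm]

lemma beta_lower (μ : Measure E) {x : E} {ρ R : ℝ} (hρ : 0 < ρ) (hR : ρ ≤ R) {S : Set E} (hS : S ⊆ closedBall x ρ) :
    ENNReal.ofReal ((R^3)⁻¹) * (⨅ L : Lines, ∫⁻ y in S, ENNReal.ofReal (infDist y (L.1 : Set E) ^ 2) ∂μ) ≤ beta2sq μ x ρ := by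
  unfold beta2sq
  refine le_iInf fun L => ?_
  calc _ ≤ ENNReal.ofReal ((R^3)⁻¹) * ∫⁻ y in S, ENNReal.ofReal (infDist y (L.1 : Set E) ^ 2) ∂μ := by
        gcongr; exact iInf_le _ L
    _ ≤ ENNReal.ofReal ((R^3)⁻¹) * ∫⁻ y in closedBall x ρ, ENNReal.ofReal (infDist y (L.1 : Set E) ^ 2) ∂μ := by
        gcongr
    _ = ∫⁻ y in closedBall x ρ, ENNReal.ofReal ((R^3)⁻¹) * ENNReal.ofReal (infDist y (L.1 : Set E) ^ 2) ∂μ := by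
        rw [lintegral_const_mul' _ _ ENNReal.ofReal_ne_top]
    _ ≤ ∫⁻ y in closedBall x ρ, ENNReal.ofReal ρ⁻¹ * ENNReal.ofReal ((infDist y (L.1 : Set E) / ρ)^2) ∂μ := by
        apply lintegral_mono; intro y
        have hRp : 0 < R := hρ.trans_le hR
        simp only
        rw [← ENNReal.ofReal_mul (by positivity), ← ENNReal.ofReal_mul (by positivity)]
        apply ENNReal.ofReal_le_ofReal
        rw [div_pow]
        calc (R^3)⁻¹ * infDist y (L.1 : Set E) ^ 2 ≤ (ρ^3)⁻¹ * infDist y (L.1 : Set E) ^ 2 := by gcongr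
          _ = _ := by field_simp
    _ = _ := by
        rw [lintegral_const_mul' _ _ ENNReal.ofReal_ne_top, div_ofReal _ hρ]

lemma cell_bound (μ : Measure E) {r : ℝ} (hr : 0 < r) (n : ℤ × ℤ) {j : ℤ × ℤ} (hj : j ∈ JJ) :
    μ (Qc r (n+j)) ^ 2 * In μ r n ≤ ENNReal.ofReal (2^25 * r^4) * ∫⁻ x in Qc r (n+j), (∫⁻ ρ in Ioc (32*r) (64*r), Fj μ x ρ) ∂μ := by
  set c0 : ℝ≥0∞ := ENNReal.ofReal (((64*r)^5)⁻¹) * (In μ r n * μ (Qc r (n+j))) with hc0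
  have low : ∀ x ∈ Qc r (n+j), ∀ ρ ∈ Ioc (32*r) (64*r), c0 ≤ Fj μ x ρ := by
    intro x hx ρ hρ
    have hρ0 : 0 < ρ := lt_trans (by positivity) hρ.1
    rw [mem_JJ] at hj
    have hx' : cidx r x = n + j := hx
    have hB : Bc r n ⊆ closedBall x ρ := by
      intro y hy
      rw [mem_closedBall]
      have h1 : |(cidx r y).1 - n.1| ≤ 5 := hy.1
      have h2 : |(cidx r y).2 - n.2| ≤ 5 := hy.2
      refine (idx_far hr (M := 10) ?_ ?_).trans ?_
      · rw [hx', Prod.fst_add]; have := hj.1; rw [abs_le] at *; constructor <;> lia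
      · rw [hx', Prod.snd_add]; have := hj.2; rw [abs_le] at *; constructor <;> lia
      · push_cast; linarith [hρ.1]
    have hQ : Qc r (n+j) ⊆ closedBall x ρ := by
      intro y hy
      have hy' : cidx r y = n + j := hy
      rw [mem_closedBall]
      refine (idx_far hr (M := 10) ?_ ?_).trans ?_
      · rw [hx', hy']; simp
      · rw [hx', hy']; simp
      · push_cast; linarith [hρ.1]
    have b := beta_lower μ hρ0 hρ.2 hB
    unfold Fj
    rw [div_ofReal _ hρ0, div_ofReal _ hρ0]
    have e : c0 = ENNReal.ofReal ((64*r)⁻¹) * ((ENNReal.ofReal (((64*r)^3)⁻¹) * In μ r n) * (ENNReal.ofReal ((64*r)⁻¹) * μ (Qc r (n+j)))) := by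
      rw [hc0]
      have : ENNReal.ofReal (((64*r)^5)⁻¹) = ENNReal.ofReal ((64*r)⁻¹) * (ENNReal.ofReal (((64*r)^3)⁻¹) * ENNReal.ofReal ((64*r)⁻¹)) := by
        rw [← ENNReal.ofReal_mul (by positivity), ← ENNReal.ofReal_mul (by positivity)]
        congr 1; field_simp
      rw [this]; ring
    rw [e]
    have hh := hρ.2
    gcongr
    exact b
  have h1 : ∀ x ∈ Qc r (n+j), c0 * ENNReal.ofReal (32*r) ≤ ∫⁻ ρ in Ioc (32*r) (64*r), Fj μ x ρ := by
    intro x hx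
    calc c0 * ENNReal.ofReal (32*r) = ∫⁻ ρ in Ioc (32*r) (64*r), c0 := by
          rw [setLIntegral_const, Real.volume_Ioc]; congr 2; ring
      _ ≤ _ := setLIntegral_mono' measurableSet_Ioc (low x hx)
  have h2 : c0 * ENNReal.ofReal (32*r) * μ (Qc r (n+j)) ≤ ∫⁻ x in Qc r (n+j), (∫⁻ ρ in Ioc (32*r) (64*r), Fj μ x ρ) ∂μ := by
    calc _ = ∫⁻ x in Qc r (n+j), c0 * ENNReal.ofReal (32*r) ∂μ := by rw [setLIntegral_const]
      _ ≤ _ := setLIntegral_mono' (Qc_meas _ _) h1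
  refine le_trans (le_of_eq ?_) (mul_le_mul_right h2 _)
  rw [hc0]
  have : ENNReal.ofReal (2^25 * r^4) * (ENNReal.ofReal (((64*r)^5)⁻¹) * ENNReal.ofReal (32*r)) = 1 := by
    rw [← ENNReal.ofReal_mul (by positivity), ← ENNReal.ofReal_mul (by positivity), ← ENNReal.ofReal_one]
    congr 1; field_simp; norm_num
  calc _ = 1 * (μ (Qc r (n+j)) ^ 2 * In μ r n) := (one_mul _).symm
    _ = _ := by rw [← this]; ring

lemma Err_le (μ : Measure E) {r : ℝ} (hr : 0 < r) :
    Err μ r ≤ ENNReal.ofReal (2^46 * r^4) * ∫⁻ x, (∫⁻ ρ in Ioc (32*r) (64*r), Fj μ x ρ) ∂μ := by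
  set X := ∫⁻ x, (∫⁻ ρ in Ioc (32*r) (64*r), Fj μ x ρ) ∂μ with hX
  unfold Err
  calc ∑' n, μ (Bc r n) ^ 2 * In μ r n ≤ ∑' n, ∑ j ∈ JJ, 14641 * (ENNReal.ofReal (2^25 * r^4) * ∫⁻ x in Qc r (n+j), (∫⁻ ρ in Ioc (32*r) (64*r), Fj μ x ρ) ∂μ) := by
        apply ENNReal.tsum_le_tsum; intro n
        calc _ ≤ (14641 * ∑ j ∈ JJ, μ (Qc r (n + j)) ^ 2) * In μ r n := by gcongr; exact muB_sq μ r n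
          _ = ∑ j ∈ JJ, 14641 * (μ (Qc r (n + j)) ^ 2 * In μ r n) := by
            rw [Finset.mul_sum, Finset.sum_mul]; simp only [mul_assoc]
          _ ≤ _ := by
            apply Finset.sum_le_sum; intro j hj
            refine mul_le_mul_right ?_ _
            exact cell_bound μ hr n hj
    _ = ∑ j ∈ JJ, ∑' n, 14641 * (ENNReal.ofReal (2^25 * r^4) * ∫⁻ x in Qc r (n+j), (∫⁻ ρ in Ioc (32*r) (64*r), Fj μ x ρ) ∂μ) := by
        rw [Summable.tsum_finsetSum (fun _ _ => ENNReal.summable)]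
    _ = ∑ j ∈ JJ, 14641 * (ENNReal.ofReal (2^25 * r^4) * X) := by
        apply Finset.sum_congr rfl; intro j _
        rw [ENNReal.tsum_mul_left, ENNReal.tsum_mul_left, hX, lint_cells μ r]
        congr 2
        exact (Equiv.addRight j).tsum_eq (fun n => ∫⁻ x in Qc r n, (∫⁻ ρ in Ioc (32*r) (64*r), Fj μ x ρ) ∂μ)
    _ = 1771561 * (ENNReal.ofReal (2^25 * r^4) * X) := by
        rw [Finset.sum_const]
        have : JJ.card = 121 := by rfl
        rw [this, nsmul_eq_mul, ← mul_assoc]; norm_num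
    _ ≤ _ := by
        rw [← mul_assoc]
        gcongr
        rw [show (1771561 : ℝ≥0∞) = ENNReal.ofReal 1771561 by simp, ← ENNReal.ofReal_mul (by norm_num)]
        apply ENNReal.ofReal_le_ofReal
        nlinarith [pow_pos hr 4]

lemma sum_lint_le {α : Type*} [MeasurableSpace α] {ι : Type*} (μ : Measure α) (f : ι → α → ℝ≥0∞) :
    ∑' i, ∫⁻ x, f i x ∂μ ≤ ∫⁻ x, ∑' i, f i x ∂μ := by
  classical
  rw [ENNReal.tsum_eq_iSup_sum]
  refine iSup_le fun s => ?_
  have : ∑ i ∈ s, ∫⁻ x, f i x ∂μ ≤ ∫⁻ x, ∑ i ∈ s, f i x ∂μ := by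
    induction s using Finset.induction_on with
    | empty => simp
    | insert a s ha ih =>
      rw [Finset.sum_insert ha]
      simp only [Finset.sum_insert ha]
      exact (add_le_add_right ih _).trans (le_lintegral_add _ _)
  refine this.trans (lintegral_mono fun x => ENNReal.sum_le_tsum s)

/-- part (1) -/
lemma Err_jones (μ : Measure E) :
    ∑' k : ℤ, ENNReal.ofReal (((2:ℝ)^k)^4)⁻¹ * Err μ (2^k) ≤ ENNReal.ofReal (2^46) * jonesEnergy μ := by
  calc _ ≤ ∑' k : ℤ, ENNReal.ofReal (2^46) * ∫⁻ x, (∫⁻ ρ in Ioc (32*(2:ℝ)^k) (64*(2:ℝ)^k), Fj μ x ρ) ∂μ := by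
        apply ENNReal.tsum_le_tsum; intro k
        have hr : (0:ℝ) < 2^k := by positivity
        refine (mul_le_mul_right (Err_le μ hr) _).trans (le_of_eq ?_)
        rw [← mul_assoc, ← ENNReal.ofReal_mul (by positivity)]
        congr 2; field_simp
    _ ≤ ENNReal.ofReal (2^46) * ∫⁻ x, (∑' k : ℤ, ∫⁻ ρ in Ioc (32*(2:ℝ)^k) (64*(2:ℝ)^k), Fj μ x ρ) ∂μ := by
        rw [ENNReal.tsum_mul_left]; gcongr; exact sum_lint_le _ _
    _ ≤ _ := by
        unfold jonesEnergy
        gcongr with x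
        rw [← lintegral_iUnion (fun _ => measurableSet_Ioc)]
        · apply lintegral_mono_set
          intro ρ hρ
          simp only [mem_iUnion] at hρ
          obtain ⟨k, hk⟩ := hρ
          exact lt_trans (by positivity) hk.1
        · intro a b hab
          have key : ∀ a b : ℤ, a < b → Disjoint (Ioc (32*(2:ℝ)^a) (64*(2:ℝ)^a)) (Ioc (32*(2:ℝ)^b) (64*(2:ℝ)^b)) := by
            intro a b h
            rw [Set.disjoint_left]
            intro y hy hy'
            have h2 : (2:ℝ)^(a+1) ≤ 2^b := zpow_le_zpow_right₀ (by norm_num) (by lia)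
            rw [zpow_add_one₀ (by norm_num)] at h2
            linarith [hy.2, hy'.1]
          rcases lt_or_gt_of_ne hab with h | h
          · exact key a b h
          · exact (key b a h).symm

lemma lines_nonempty : Nonempty Lines := by
  obtain ⟨L, _⟩ := thru (y := (0:E)) (z := EuclideanSpace.single 0 1) (by
    intro h
    have := congrArg (fun v : E => v 0) h
    simp at this)
  exact ⟨L⟩

lemma le_mul_In {μ : Measure E} [IsFiniteMeasure μ] {r c : ℝ} {n} {a : ℝ≥0∞}
    (h : ∀ L : Lines, a ≤ ENNReal.ofReal c * (μ (Bc r n) ^ 2 * ∫⁻ y in Bc r n, ENNReal.ofReal (infDist y (L.1 : Set E) ^ 2) ∂μ)) :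
    a ≤ ENNReal.ofReal c * (μ (Bc r n) ^ 2 * In μ r n) := by
  have := lines_nonempty
  unfold In
  rw [ENNReal.mul_iInf' (fun h => absurd h (by simp)) (fun _ => inferInstance),
    ENNReal.mul_iInf' (fun h => absurd h (by simp)) (fun _ => inferInstance)]
  exact le_iInf h

def dl (L : Lines) (y : E) : ℝ≥0∞ := ENNReal.ofReal (infDist y (L.1 : Set E) ^ 2)
lemma dl_meas (L : Lines) : Measurable (dl L) := by
  unfold dl
  have : Measurable (fun y : E => infDist y (L.1 : Set E)) := (continuous_infDist_pt _).measurable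
  fun_prop

lemma near_det (μ : Measure E) [IsFiniteMeasure μ] {r : ℝ} (hr : 0 < r) :
    ∫⁻ x, ∫⁻ y in closedBall x (4*r), ∫⁻ z in closedBall x (4*r), ENNReal.ofReal (det (y-x) (z-x) ^ 2) ∂μ ∂μ ∂μ
      ≤ ENNReal.ofReal (384*r^2) * Err μ r := by
  rw [lint_cells μ r, Err, ← ENNReal.tsum_mul_left]
  apply ENNReal.tsum_le_tsum; intro n
  apply le_mul_In; intro L
  obtain ⟨n0, n1, b, hn, hD⟩ := line_repr L
  set M := μ (Bc r n) with hM
  set I := ∫⁻ y in Bc r n, ENNReal.ofReal (infDist y (L.1 : Set E) ^ 2) ∂μ with hI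
  have hI' : I = ∫⁻ y in Bc r n, dl L y ∂μ := rfl
  have pt : ∀ x y z : E, y ∈ closedBall x (4*r) → z ∈ closedBall x (4*r) →
      ENNReal.ofReal (det (y-x) (z-x) ^ 2) ≤ ENNReal.ofReal (128*r^2) * (dl L x + dl L y + dl L z) := by
    intro x y z hy hz
    rw [mem_closedBall, dist_eq_norm] at hy hz
    have := det_le (D := fun y => n0*y 0+n1*y 1-b) b hn hy hz (fun _ => rfl)
    simp only [dl]
    rw [← ENNReal.ofReal_add (by positivity) (by positivity), ← ENNReal.ofReal_add (by positivity) (by positivity),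
      ← ENNReal.ofReal_mul (by positivity)]
    apply ENNReal.ofReal_le_ofReal
    rw [hD, hD, hD]
    refine this.trans (le_of_eq ?_); ring
  have hx : ∀ x ∈ Qc r n, (∫⁻ y in closedBall x (4*r), ∫⁻ z in closedBall x (4*r), ENNReal.ofReal (det (y-x) (z-x) ^ 2) ∂μ ∂μ)
      ≤ ENNReal.ofReal (128*r^2) * (dl L x * M^2 + 2 * M * I) := by
    intro x hx
    have hsub : closedBall x (4*r) ⊆ Bc r n := by
      intro y hy
      rw [mem_closedBall, dist_eq_norm] at hy
      exact near_mem_Bc hr hx hy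
    calc _ ≤ ∫⁻ y in closedBall x (4*r), ∫⁻ z in closedBall x (4*r), ENNReal.ofReal (128*r^2) * (dl L x + dl L y + dl L z) ∂μ ∂μ :=
          setLIntegral_mono' isClosed_closedBall.measurableSet fun y hy =>
            setLIntegral_mono' isClosed_closedBall.measurableSet fun z hz => pt x y z hy hz
      _ ≤ ∫⁻ y in Bc r n, ∫⁻ z in Bc r n, ENNReal.ofReal (128*r^2) * (dl L x + dl L y + dl L z) ∂μ ∂μ := by
          refine (lintegral_mono_set hsub).trans (lintegral_mono fun y => lintegral_mono_set hsub)
      _ = ∫⁻ y in Bc r n, ENNReal.ofReal (128*r^2) * ((dl L x + dl L y) * M + I) ∂μ := by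
          congr 1; ext y
          rw [lintegral_const_mul' _ _ ENNReal.ofReal_ne_top, lintegral_add_left measurable_const, setLIntegral_const]
          rfl
      _ = ENNReal.ofReal (128*r^2) * ((dl L x * M + I * 1) * M + I * M) := by
          rw [lintegral_const_mul' _ _ ENNReal.ofReal_ne_top, lintegral_add_right _ measurable_const, setLIntegral_const,
            lintegral_mul_const _ ((dl_meas L).const_add _), lintegral_add_left measurable_const, setLIntegral_const, mul_one]
          rfl
      _ = _ := by ring
  calc _ ≤ ∫⁻ x in Qc r n, ENNReal.ofReal (128*r^2) * (dl L x * M^2 + 2 * M * I) ∂μ := setLIntegral_mono' (Qc_meas _ _) hx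
    _ ≤ ∫⁻ x in Bc r n, ENNReal.ofReal (128*r^2) * (dl L x * M^2 + 2 * M * I) ∂μ := lintegral_mono_set (Qc_sub_Bc r n)
    _ = ENNReal.ofReal (128*r^2) * (I * M^2 + 2 * M * I * M) := by
        rw [lintegral_const_mul' _ _ ENNReal.ofReal_ne_top, lintegral_add_right _ measurable_const, setLIntegral_const,
            lintegral_mul_const _ (dl_meas L)]
        rfl
    _ = ENNReal.ofReal (384*r^2) * (M^2 * I) := by
        have e3 : ENNReal.ofReal (384*r^2) = 3 * ENNReal.ofReal (128*r^2) := by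
          rw [show 384*r^2 = 3 * (128*r^2) by ring, ENNReal.ofReal_mul (by norm_num), ENNReal.ofReal_ofNat]
        rw [e3]
        ring

lemma IsDir_rot {e x y z : E} (h : IsDir e x y z) : IsDir e y z x := by
  obtain ⟨p, hp, q, hq, he, h1, h2, h3⟩ := h
  refine ⟨p, ?_, q, ?_, he, ?_, ?_, ?_⟩
  · simp only [mem_insert_iff, mem_singleton_iff] at *; tauto
  · simp only [mem_insert_iff, mem_singleton_iff] at *; tauto
  · rw [norm_sub_rev]; exact h3
  · rw [norm_sub_rev]; exact h1
  · exact h2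

def edir (x y z : E) : E :=
  if ‖y - z‖ ≤ ‖x - y‖ ∧ ‖x - z‖ ≤ ‖x - y‖ then ‖x - y‖⁻¹ • (x - y)
  else if ‖x - z‖ ≤ ‖y - z‖ then ‖y - z‖⁻¹ • (y - z) else ‖x - z‖⁻¹ • (x - z)

lemma edir_isDir (x y z : E) : IsDir (edir x y z) x y z := by
  unfold edir
  split_ifs with h h'
  · exact ⟨x, by simp, y, by simp, rfl, h.2, h.1, le_rfl⟩
  · refine ⟨y, by simp, z, by simp, rfl, h', le_rfl, ?_⟩
    by_contra hc
    push Not at hc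
    exact h ⟨hc.le, h'.trans hc.le⟩
  · push Not at h'
    refine ⟨x, by simp, z, by simp, rfl, le_rfl, h'.le, ?_⟩
    by_contra hc
    push Not at hc
    exact h ⟨h'.le.trans hc.le, hc.le⟩

lemma edir_meas : Measurable (fun p : E × E × E => edir p.1 p.2.1 p.2.2) := by
  unfold edir
  refine Measurable.ite ?_ (by fun_prop) (Measurable.ite ?_ (by fun_prop) (by fun_prop))
  · have h1 : MeasurableSet {p : E × E × E | ‖p.2.1 - p.2.2‖ ≤ ‖p.1 - p.2.1‖} := measurableSet_le (by fun_prop) (by fun_prop)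
    have h2 : MeasurableSet {p : E × E × E | ‖p.1 - p.2.2‖ ≤ ‖p.1 - p.2.1‖} := measurableSet_le (by fun_prop) (by fun_prop)
    exact h1.inter h2
  · have h1 : MeasurableSet {p : E × E × E | ‖p.1 - p.2.2‖ ≤ ‖p.2.1 - p.2.2‖} := measurableSet_le (by fun_prop) (by fun_prop)
    exact h1

lemma ip_meas {α : Type*} [MeasurableSpace α] {f g : α → E} (hf : Measurable f) (hg : Measurable g) :
    Measurable (fun a => ip (f a) (g a)) := by
  have h0 : ∀ {h : α → E}, Measurable h → ∀ i, Measurable (fun a => h a i) := by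
    intro h hh i
    have : Measurable (fun x : E => x i) := by fun_prop
    exact this.comp hh
  unfold ip
  exact ((h0 hf 0).mul (h0 hg 0)).add ((h0 hf 1).mul (h0 hg 1))

/-- rotation data: `p = (z,(x,y))` -/
def kr (f : ℝ → ℝ → ℝ → ℝ) (e : E → E → E → E) (r : ℝ) (x y z : E) : ℝ :=
  f (ip (e x y z) x / r) (ip (e x y z) y / r) (ip (e x y z) z / r)

lemma kr_meas {f : ℝ → ℝ → ℝ → ℝ} (hf : Measurable (fun q : ℝ × ℝ × ℝ => f q.1 q.2.1 q.2.2))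
    {e : E → E → E → E} (he : Measurable (fun p : E × E × E => e p.1 p.2.1 p.2.2)) (r : ℝ) {α : Type*} [MeasurableSpace α]
    {x y z : α → E} (hx : Measurable x) (hy : Measurable y) (hz : Measurable z) :
    Measurable (fun a => kr f e r (x a) (y a) (z a)) := by
  unfold kr
  have h : Measurable (fun a => e (x a) (y a) (z a)) := he.comp (hx.prodMk (hy.prodMk hz))
  exact hf.comp (((ip_meas h hx).div_const r).prodMk (((ip_meas h hy).div_const r).prodMk ((ip_meas h hz).div_const r)))

def PG (μ : Measure E) (r : ℝ) (z : E) : ℝ := ∫ x, GG (‖x - z‖ / r) ∂μ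

lemma bdd_int {α : Type*} [MeasurableSpace α] {ν : Measure α} [IsFiniteMeasure ν] {f : α → ℝ} (hf : Measurable f) {C : ℝ}
    (h : ∀ a, |f a| ≤ C) : Integrable f ν :=
  Integrable.of_bound hf.aestronglyMeasurable C (ae_of_all _ (by simpa using h))

lemma abs_int_le {α : Type*} [MeasurableSpace α] {ν : Measure α} [IsFiniteMeasure ν] {f : α → ℝ} {C : ℝ}
    (h : ∀ a, |f a| ≤ C) : |∫ a, f a ∂ν| ≤ C * ν.real univ := by
  have := norm_integral_le_of_norm_le_const (μ := ν) (f := f) (C := C) (ae_of_all _ (by simpa using h))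
  simpa using this

lemma PG_meas (μ : Measure E) [IsFiniteMeasure μ] (r : ℝ) : Measurable (PG μ r) := by
  unfold PG
  have : StronglyMeasurable (fun p : E × E => GG (‖p.2 - p.1‖ / r)) := by
    apply Measurable.stronglyMeasurable
    exact GG_meas.comp (by fun_prop)
  exact this.integral_prod_right.measurable

lemma PG_bdd (μ : Measure E) [IsFiniteMeasure μ] (r : ℝ) (z : E) : |PG μ r z| ≤ 72 * μ.real univ :=
  abs_int_le (fun _ => GG_bdd _)

/-- Cauchy-Schwarz against a finite measure. -/
lemma cs_one {α : Type*} [MeasurableSpace α] {ν : Measure α} [IsFiniteMeasure ν] {f : α → ℝ} (hf : Measurable f) {C : ℝ}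
    (h : ∀ a, |f a| ≤ C) : (∫ a, f a ∂ν)^2 ≤ ν.real univ * ∫ a, f a ^2 ∂ν := by
  set m := ν.real univ with hm
  set A := ∫ a, f a ∂ν with hA
  have hi : Integrable f ν := bdd_int hf h
  have hi2 : Integrable (fun a => f a ^2) ν := by
    refine bdd_int (hf.pow_const 2) (C := C^2) (fun a => ?_)
    rw [abs_pow]; exact pow_le_pow_left₀ (abs_nonneg _) (h a) 2
  have key : 0 ≤ ∫ a, (m * f a - A)^2 ∂ν := integral_nonneg fun a => sq_nonneg _
  have e : ∫ a, (m * f a - A)^2 ∂ν = m * (m * ∫ a, f a^2 ∂ν - A^2) := by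
    have : ∀ a, (m * f a - A)^2 = m^2 * f a ^2 - (2 * m * A) * f a + A^2 := fun a => by ring
    simp only [this]
    have i1 : Integrable (fun a => m^2 * f a^2) ν := hi2.const_mul _
    have i2 : Integrable (fun a => (2 * m * A) * f a) ν := hi.const_mul _
    have i3 : Integrable (fun a => m^2 * f a^2 - (2 * m * A) * f a) ν := i1.sub i2
    rw [integral_add i3 (integrable_const _), integral_sub i1 i2, integral_const_mul, integral_const_mul, integral_const, ← hm, ← hA]
    simp only [smul_eq_mul]; ring
  rw [e] at key
  have hm0 : 0 ≤ m := measureReal_nonneg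
  rcases eq_or_lt_of_le hm0 with h0 | h0
  · have : ν = 0 := by
      rw [← Measure.measure_univ_eq_zero]
      have := h0.symm
      rw [hm, measureReal_eq_zero_iff] at this
      exact this
    have hA0 : A = 0 := by rw [hA, this, integral_zero_measure]
    rw [hA0, ← h0]; simp
  · have := nonneg_of_mul_nonneg_right key h0
    linarith

set_option maxHeartbeats 1000000 in
lemma cell_pt (μ : Measure E) [IsFiniteMeasure μ] {r : ℝ} (hr : 0 < r) {e : E → E → E → E}
    (he : ∀ x y z, IsDir (e x y z) x y z) (hem : Measurable (fun p : E × E × E => e p.1 p.2.1 p.2.2))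
    {n0 n1 : ℝ} (b : ℝ) (hn : n0^2 + n1^2 = 1) {D : E → ℝ} (hD : ∀ y, D y = n0 * y 0 + n1 * y 1 - b)
    {n : ℤ × ℤ} {z : E} (hz : z ∈ Qc r n) (hDi : IntegrableOn (fun y => D y ^2) (Bc r n) μ) :
    PG μ r z ^2 - 96 * ∫ q, kr kap e r q.1 q.2 z ∂(μ.prod μ) ≤
      2000000 / r^2 * (μ.real (Bc r n) * ∫ y in Bc r n, D y ^2 ∂μ + μ.real (Bc r n) ^2 * D z ^2) := by
  set ν := μ.restrict (Bc r n) with hν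
  set M := μ.real (Bc r n) with hM
  set S := ∫ y, D y ^2 ∂ν with hS
  set t : E → ℝ := fun y => -n1 * y 0 + n0 * y 1 with ht
  have hDm : Measurable D := by
    have : D = fun y : E => n0 * y 0 + n1 * y 1 - b := funext hD
    rw [this]; fun_prop
  have htm : Measurable t := by rw [ht]; fun_prop
  have hMν : ν.real univ = M := by rw [hν, hM]; simp [measureReal_def]
  have hM0 : 0 ≤ M := measureReal_nonneg
  have hS0 : 0 ≤ S := integral_nonneg fun _ => sq_nonneg _
  have hDi' : Integrable (fun y => D y ^2) ν := hDi
  -- reduce to ν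
  have hP : PG μ r z = ∫ x, GG (‖x - z‖ / r) ∂ν := by
    unfold PG
    symm
    apply setIntegral_eq_integral_of_forall_compl_eq_zero
    intro x hx
    apply GG_supp
    rw [abs_of_nonneg (by positivity), lt_div_iff₀ hr]
    by_contra hc
    push Not at hc
    exact hx (near_mem_Bc hr hz hc)
  have hW : ∫ q, kr kap e r q.1 q.2 z ∂(μ.prod μ) = ∫ q, kr kap e r q.1 q.2 z ∂(ν.prod ν) := by
    rw [hν, Measure.prod_restrict]
    symm
    apply setIntegral_eq_integral_of_forall_compl_eq_zero
    intro q hq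
    unfold kr
    apply kap_supp
    apply far_dir (he _ _ _) hr _ (by norm_num)
    by_contra hc
    push Not at hc
    refine hq ⟨near_mem_Bc hr hz hc.2.2, near_mem_Bc hr hz hc.2.1⟩
  -- first comparison
  have hg1 : Measurable (fun x : E => GG (‖x - z‖ / r)) := GG_meas.comp (by fun_prop)
  have hg2 : Measurable (fun x : E => GG (t x / r - t z / r)) := GG_meas.comp ((htm.div_const r).sub_const _)
  have hdiff : ∀ x, (GG (‖x - z‖ / r) - GG (t x / r - t z / r))^2 ≤ 10368 / r^2 * (D x^2 + D z^2) := by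
    intro x
    have h1 := GG_diff (‖x - z‖ / r) (t x / r - t z / r)
    have h2 : (‖x - z‖ / r)^2 - (t x / r - t z / r)^2 = (D x - D z)^2 / r^2 := by
      rw [div_pow, nsq, ← sub_div, div_pow, ← sub_div, hD, hD, ht]
      congr 1
      simp only [PiLp.sub_apply]
      linear_combination -((x 0 - z 0)^2 + (x 1 - z 1)^2) * hn
    rw [h2, abs_of_nonneg (a := (D x - D z)^2 / r^2) (by positivity)] at h1
    have h3 : |GG (‖x - z‖ / r) - GG (t x / r - t z / r)| ≤ 144 := by
      refine (abs_sub _ _).trans ?_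
      linarith [GG_bdd (‖x - z‖ / r), GG_bdd (t x / r - t z / r)]
    rw [← sq_abs, sq]
    calc _ ≤ 144 * (36 * ((D x - D z)^2 / r^2)) := mul_le_mul h3 h1 (abs_nonneg _) (by norm_num)
      _ ≤ 144 * (36 * ((2 * D x^2 + 2 * D z^2) / r^2)) := by gcongr; nlinarith [sq_nonneg (D x + D z)]
      _ = _ := by ring
  have hc1 : (∫ x, (GG (‖x - z‖ / r) - GG (t x / r - t z / r)) ∂ν)^2 ≤ M * (10368 / r^2 * (S + M * D z^2)) := by
    have := cs_one (ν := ν) (hg1.sub hg2) (C := 144) (fun x => by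
      refine (abs_sub _ _).trans ?_
      linarith [GG_bdd (‖x - z‖ / r), GG_bdd (t x / r - t z / r)])
    rw [hMν] at this
    refine this.trans ?_
    gcongr
    have e1 : ∫ x, 10368 / r^2 * (D x^2 + D z^2) ∂ν = 10368 / r^2 * (S + M * D z^2) := by
      rw [integral_const_mul, integral_add hDi' (integrable_const _), integral_const, hMν, smul_eq_mul]
    rw [← e1]
    apply integral_mono_of_nonneg (ae_of_all _ fun _ => sq_nonneg _) ((hDi'.add (integrable_const _)).const_mul _)
    exact ae_of_all _ hdiff
  -- psd
  have hpsd := psd_main ν (htm.div_const r) (t z / r)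
  -- second comparison
  have hk1 : Integrable (fun q : E × E => kr kap e r q.1 q.2 z) (ν.prod ν) :=
    bdd_int (kr_meas kap_meas hem r measurable_fst measurable_snd measurable_const) (C := 216) (fun q => kap_bdd _ _ _)
  have hk2 : Integrable (fun q : E × E => kap (t q.1 / r) (t q.2 / r) (t z / r)) (ν.prod ν) := by
    refine bdd_int ?_ (C := 216) (fun q => kap_bdd _ _ _)
    show Measurable ((fun q : ℝ × ℝ × ℝ => kap q.1 q.2.1 q.2.2) ∘ (fun q : E × E => (t q.1 / r, t q.2 / r, t z / r)))
    exact kap_meas.comp (((htm.comp measurable_fst).div_const r).prodMk (((htm.comp measurable_snd).div_const r).prodMk measurable_const))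
  have hf1 : Integrable (fun q : E × E => D q.1 ^2) (ν.prod ν) := hDi'.comp_fst ν
  have hf2 : Integrable (fun q : E × E => D q.2 ^2) (ν.prod ν) := hDi'.comp_snd ν
  have j1 : Integrable (fun q : E × E => D q.1 ^2 + D q.2^2) (ν.prod ν) := hf1.add hf2
  have j2 : Integrable (fun q : E × E => (D q.1 ^2 + D q.2^2) + D z^2) (ν.prod ν) := j1.add (integrable_const _)
  have j3 : Integrable (fun q : E × E => 6480 / r^2 * ((D q.1 ^2 + D q.2^2) + D z^2)) (ν.prod ν) := j2.const_mul _
  have hc2 : ∫ q, kap (t q.1 / r) (t q.2 / r) (t z / r) ∂(ν.prod ν) ≤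
      ∫ q, kr kap e r q.1 q.2 z ∂(ν.prod ν) + 6480 / r^2 * (2 * (M * S) + M^2 * D z^2) := by
    have e1 : ∫ q, (kr kap e r q.1 q.2 z + 6480 / r^2 * ((D q.1^2 + D q.2^2) + D z^2)) ∂(ν.prod ν) =
        ∫ q, kr kap e r q.1 q.2 z ∂(ν.prod ν) + 6480 / r^2 * (2 * (M * S) + M^2 * D z^2) := by
      rw [integral_add hk1 j3, integral_const_mul,
        integral_add j1 (integrable_const _), integral_add hf1 hf2, integral_const,
        integral_fun_fst (fun x => D x^2), integral_fun_snd (fun x => D x^2), hMν]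
      have : (ν.prod ν).real univ = M^2 := by
        rw [← univ_prod_univ, measureReal_prod_prod, hMν]; ring
      rw [this]; simp only [smul_eq_mul]; rw [← hS]; ring
    rw [← e1]
    apply integral_mono hk2 (hk1.add j3)
    intro q
    have := AP kap_inv (by norm_num) (he q.1 q.2 z) b hn hr hD (t := t) (fun _ => rfl)
    have h2 := (abs_le.1 this).1
    simp only [kr, Pi.add_apply]
    have e3 : 30 * 216 * (D q.1 ^2 + D q.2 ^2 + D z ^2) / r^2 = 6480 / r^2 * ((D q.1^2 + D q.2^2) + D z^2) := by ring
    linarith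
  have hsub : ∫ x, (GG (‖x - z‖ / r) - GG (t x / r - t z / r)) ∂ν = PG μ r z - ∫ x, GG (t x / r - t z / r) ∂ν := by
    rw [hP, integral_sub (bdd_int hg1 (fun _ => GG_bdd _)) (bdd_int hg2 (fun _ => GG_bdd _))]
  rw [hsub] at hc1
  set P := PG μ r z
  set P' := ∫ x, GG (t x / r - t z / r) ∂ν
  rw [hW]
  have hP2 : P^2 ≤ 2 * P'^2 + 2 * (P - P')^2 := by nlinarith [sq_nonneg (P - 2 * P')]
  have hi : 0 < 1/r^2 := by positivity
  have hx1 : 0 ≤ 1/r^2 * (M * S) := by positivity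
  have hx2 : 0 ≤ 1/r^2 * (M^2 * D z^2) := by positivity
  have g1 : M * (10368 / r^2 * (S + M * D z^2)) = 10368 * (1/r^2 * (M * S)) + 10368 * (1/r^2 * (M^2 * D z^2)) := by ring
  have g2 : 6480 / r^2 * (2 * (M * S) + M^2 * D z^2) = 12960 * (1/r^2 * (M * S)) + 6480 * (1/r^2 * (M^2 * D z^2)) := by ring
  have g3 : 2000000 / r^2 * (M * S + M^2 * D z^2) = 2000000 * (1/r^2 * (M * S)) + 2000000 * (1/r^2 * (M^2 * D z^2)) := by ring
  rw [g3]
  rw [g1] at hc1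
  rw [g2] at hc2
  linarith

lemma cell_int (μ : Measure E) [IsFiniteMeasure μ] {r : ℝ} (hr : 0 < r) {e : E → E → E → E}
    (he : ∀ x y z, IsDir (e x y z) x y z) (hem : Measurable (fun p : E × E × E => e p.1 p.2.1 p.2.2))
    (hWi : Integrable (fun z => ∫ q, kr kap e r q.1 q.2 z ∂(μ.prod μ)) μ) (n : ℤ × ℤ) :
    ENNReal.ofReal (∫ z in Qc r n, (PG μ r z ^2 - 96 * ∫ q, kr kap e r q.1 q.2 z ∂(μ.prod μ)) ∂μ) ≤
      ENNReal.ofReal (4000000 / r^2) * (μ (Bc r n) ^ 2 * In μ r n) := by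
  apply le_mul_In; intro L
  obtain ⟨n0, n1, b, hn, hD⟩ := line_repr L
  set D : E → ℝ := fun y => n0*y 0+n1*y 1-b with hDdef
  have hDc : Continuous D := by rw [hDdef]; fun_prop
  by_cases hne : (Qc r n).Nonempty
  swap
  · rw [Set.not_nonempty_iff_eq_empty] at hne
    rw [hne]; simp
  obtain ⟨z0, hz0⟩ := hne
  have hz0' : cidx r z0 = n := hz0
  have hDi : IntegrableOn (fun y => D y ^2) (Bc r n) μ := by
    have h1 : IntegrableOn (fun y => D y ^2) (closedBall z0 (3/2 * ((5+1) * r))) μ :=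
      (hDc.pow 2).continuousOn.integrableOn_compact (isCompact_closedBall _ _)
    refine h1.mono_set ?_
    intro y hy
    rw [mem_closedBall]
    have := idx_far hr (x := y) (y := z0) (M := 5) (by rw [hz0']; exact hy.1) (by rw [hz0']; exact hy.2)
    exact_mod_cast this
  set M := μ.real (Bc r n) with hM
  set S := ∫ y in Bc r n, D y ^2 ∂μ with hS
  have hM0 : 0 ≤ M := measureReal_nonneg
  have hS0 : 0 ≤ S := integral_nonneg fun _ => sq_nonneg _
  have hPi : Integrable (fun z => PG μ r z ^2) μ := by
    refine bdd_int ((PG_meas μ r).pow_const 2) (C := (72 * μ.real univ)^2) (fun z => ?_)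
    rw [abs_pow]; exact pow_le_pow_left₀ (abs_nonneg _) (PG_bdd μ r z) 2
  have hDQ : IntegrableOn (fun y => D y ^2) (Qc r n) μ := hDi.mono_set (Qc_sub_Bc r n)
  have h1 : ∫ z in Qc r n, (PG μ r z ^2 - 96 * ∫ q, kr kap e r q.1 q.2 z ∂(μ.prod μ)) ∂μ ≤ 4000000 / r^2 * (M^2 * S) := by
    have i1 : Integrable (fun z => M * S + M^2 * D z^2) (μ.restrict (Qc r n)) := (integrable_const _).add (hDQ.const_mul _)
    calc _ ≤ ∫ z in Qc r n, 2000000 / r^2 * (M * S + M^2 * D z^2) ∂μ := by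
          apply setIntegral_mono_on (hPi.sub (hWi.const_mul _)).integrableOn (i1.const_mul _) (Qc_meas _ _)
          intro z hz
          exact cell_pt μ hr he hem b hn (fun _ => rfl) hz hDi
      _ = 2000000 / r^2 * (μ.real (Qc r n) * (M * S) + M^2 * ∫ z in Qc r n, D z^2 ∂μ) := by
          rw [integral_const_mul, integral_add (integrable_const _) (hDQ.const_mul _), integral_const, integral_const_mul (M^2)]
          simp [measureReal_def]
      _ ≤ 2000000 / r^2 * (M * (M * S) + M^2 * S) := by
          have a1 : μ.real (Qc r n) ≤ M := measureReal_mono (Qc_sub_Bc r n)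
          have a2 : ∫ z in Qc r n, D z^2 ∂μ ≤ S :=
            setIntegral_mono_set hDi (ae_of_all _ fun _ => sq_nonneg _) (LE.le.eventuallyLE (Qc_sub_Bc r n))
          gcongr
      _ = _ := by ring
  refine (ENNReal.ofReal_le_ofReal h1).trans (le_of_eq ?_)
  rw [ENNReal.ofReal_mul (by positivity), ENNReal.ofReal_mul (by positivity), ENNReal.ofReal_pow hM0, hM,
    ofReal_measureReal, hS, ofReal_integral_eq_lintegral_ofReal hDi (ae_of_all _ fun _ => sq_nonneg _)]
  simp only [hD]
  rfl

lemma one_e (μ : Measure E) [IsFiniteMeasure μ] {r : ℝ} (hr : 0 < r) {e : E → E → E → E}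
    (he : ∀ x y z, IsDir (e x y z) x y z) (hem : Measurable (fun p : E × E × E => e p.1 p.2.1 p.2.2)) :
    ENNReal.ofReal (∫ z, PG μ r z ^2 ∂μ - 96 * ∫ p, kr kap e r p.2.1 p.2.2 p.1 ∂(μ.prod (μ.prod μ))) ≤
      ENNReal.ofReal (4000000 / r^2) * Err μ r := by
  have hk : Integrable (fun p : E × E × E => kr kap e r p.2.1 p.2.2 p.1) (μ.prod (μ.prod μ)) :=
    bdd_int (kr_meas kap_meas hem r (by fun_prop) (by fun_prop) (by fun_prop)) (C := 216) (fun q => kap_bdd _ _ _)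
  have hWi : Integrable (fun z => ∫ q, kr kap e r q.1 q.2 z ∂(μ.prod μ)) μ := hk.integral_prod_left
  have hPi : Integrable (fun z => PG μ r z ^2) μ := by
    refine bdd_int ((PG_meas μ r).pow_const 2) (C := (72 * μ.real univ)^2) (fun z => ?_)
    rw [abs_pow]; exact pow_le_pow_left₀ (abs_nonneg _) (PG_bdd μ r z) 2
  rw [integral_prod _ hk, ← integral_const_mul, ← integral_sub hPi (hWi.const_mul _)]
  refine (int_cells μ r (hPi.sub (hWi.const_mul _))).trans ?_
  rw [Err, ← ENNReal.tsum_mul_left]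
  exact ENNReal.tsum_le_tsum fun n => cell_int μ hr he hem hWi n

lemma rot_int (μ : Measure E) [IsFiniteMeasure μ] (f : E → E → E → ℝ) :
    ∫ p, f p.2.1 p.2.2 p.1 ∂(μ.prod (μ.prod μ)) = ∫ p, f p.1 p.2.1 p.2.2 ∂(μ.prod (μ.prod μ)) := by
  have h1 : MeasurePreserving (MeasurableEquiv.prodComm (α := E) (β := E × E)) (μ.prod (μ.prod μ)) ((μ.prod μ).prod μ) :=
    Measure.measurePreserving_swap
  have h2 : MeasurePreserving (MeasurableEquiv.prodAssoc (α := E) (β := E) (γ := E)) ((μ.prod μ).prod μ) (μ.prod (μ.prod μ)) :=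
    measurePreserving_prodAssoc μ μ μ
  rw [← h2.integral_comp' (fun p => f p.1 p.2.1 p.2.2)]
  rw [← h1.integral_comp' (fun p => f (MeasurableEquiv.prodAssoc p).1 (MeasurableEquiv.prodAssoc p).2.1 (MeasurableEquiv.prodAssoc p).2.2)]
  rfl

def tau (μ : Measure E) (r : ℝ) : ℝ := (r^2)⁻¹ * ∫ p, kr KK edir r p.2.1 p.2.2 p.1 ∂(μ.prod (μ.prod μ))

lemma three_e (μ : Measure E) [IsFiniteMeasure μ] {r : ℝ} (hr : 0 < r) :
    ENNReal.ofReal ((r^2)⁻¹ * ∫ z, PG μ r z ^2 ∂μ - 96 * (tau μ r - tau μ (2*r))) ≤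
      ENNReal.ofReal (4000000 * (r^4)⁻¹) * Err μ r := by
  set V := ∫ z, PG μ r z ^2 ∂μ with hV
  set m3 := μ.prod (μ.prod μ) with hm3
  set K1 := ∫ p, kr kap edir r p.2.1 p.2.2 p.1 ∂m3 with hK1
  set K2 := ∫ p, kr kap (fun x y z => edir z x y) r p.2.1 p.2.2 p.1 ∂m3 with hK2
  set K3 := ∫ p, kr kap (fun x y z => edir y z x) r p.2.1 p.2.2 p.1 ∂m3 with hK3
  have o1 := one_e μ hr (e := edir) edir_isDir edir_meas
  have o2 := one_e μ hr (e := fun x y z => edir z x y) (fun x y z => IsDir_rot (edir_isDir z x y))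
    (edir_meas.comp (f := fun p : E × E × E => (p.2.2, p.1, p.2.1)) (by fun_prop))
  have o3 := one_e μ hr (e := fun x y z => edir y z x) (fun x y z => IsDir_rot (IsDir_rot (edir_isDir y z x)))
    (edir_meas.comp (f := fun p : E × E × E => (p.2.1, p.2.2, p.1)) (by fun_prop))
  rw [← hm3, ← hV] at o1 o2 o3
  rw [← hK1] at o1
  rw [← hK2] at o2
  rw [← hK3] at o3
  have r2 : K2 = ∫ p, kap (ip (edir p.2.1 p.2.2 p.1) p.2.2 / r) (ip (edir p.2.1 p.2.2 p.1) p.1 / r) (ip (edir p.2.1 p.2.2 p.1) p.2.1 / r) ∂m3 := by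
    exact (rot_int μ (fun x y z => kr kap (fun x y z => edir z x y) r y z x)).symm
  have r3 : K3 = ∫ p, kap (ip (edir p.2.1 p.2.2 p.1) p.1 / r) (ip (edir p.2.1 p.2.2 p.1) p.2.1 / r) (ip (edir p.2.1 p.2.2 p.1) p.2.2 / r) ∂m3 :=
    rot_int μ (fun x y z => kr kap (fun x y z => edir y z x) r x y z)
  have ms : ∀ {f : ℝ → ℝ → ℝ → ℝ}, Measurable (fun q : ℝ × ℝ × ℝ => f q.1 q.2.1 q.2.2) → (∀ a b c, |f a b c| ≤ 216) → ∀ r : ℝ,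
      Integrable (fun p : E × E × E => kr f edir r p.2.1 p.2.2 p.1) m3 := fun hf hb r =>
    bdd_int (kr_meas hf edir_meas r (by fun_prop) (by fun_prop) (by fun_prop)) (C := 216) (fun q => hb _ _ _)
  have i1 := ms kap_meas kap_bdd r
  have i2 := ms (f := fun a b c => kap b c a) (kap_meas.comp (f := fun q : ℝ × ℝ × ℝ => (q.2.1, q.2.2, q.1)) (by fun_prop)) (fun _ _ _ => kap_bdd _ _ _) r
  have i3 := ms (f := fun a b c => kap c a b) (kap_meas.comp (f := fun q : ℝ × ℝ × ℝ => (q.2.2, q.1, q.2.1)) (by fun_prop)) (fun _ _ _ => kap_bdd _ _ _) r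
  have j1 := ms KK_meas KK_bdd r
  have j2 := ms KK_meas KK_bdd (2*r)
  have hsum : K1 + K2 + K3 = 3 * r^2 * (tau μ r - tau μ (2*r)) := by
    have e1 : K1 + K2 + K3 = ∫ p, (kr kap edir r p.2.1 p.2.2 p.1 + kr (fun a b c => kap b c a) edir r p.2.1 p.2.2 p.1
        + kr (fun a b c => kap c a b) edir r p.2.1 p.2.2 p.1) ∂m3 := by
      have i12 : Integrable (fun p : E × E × E => kr kap edir r p.2.1 p.2.2 p.1 + kr (fun a b c => kap b c a) edir r p.2.1 p.2.2 p.1) m3 := i1.add i2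
      rw [integral_add i12 i3, integral_add i1 i2, r2, r3]
      rfl
    have e2 : ∀ p : E × E × E, (kr kap edir r p.2.1 p.2.2 p.1 + kr (fun a b c => kap b c a) edir r p.2.1 p.2.2 p.1
        + kr (fun a b c => kap c a b) edir r p.2.1 p.2.2 p.1) = 3 * kr KK edir r p.2.1 p.2.2 p.1 - 3/4 * kr KK edir (2*r) p.2.1 p.2.2 p.1 := by
      intro p
      simp only [kr]
      have := KK_ident (ip (edir p.2.1 p.2.2 p.1) p.2.1 / r) (ip (edir p.2.1 p.2.2 p.1) p.2.2 / r) (ip (edir p.2.1 p.2.2 p.1) p.1 / r)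
      have hh : ∀ u : ℝ, u / (2*r) = u / r / 2 := fun u => by field_simp
      rw [hh, hh, hh]
      linarith
    rw [e1]
    simp only [e2]
    rw [integral_sub (j1.const_mul _) (j2.const_mul _), integral_const_mul, integral_const_mul]
    unfold tau
    rw [← hm3]
    field_simp
    ring
  have htot : ENNReal.ofReal (3 * V - 96 * (K1 + K2 + K3)) ≤ 3 * (ENNReal.ofReal (4000000 / r^2) * Err μ r) := by
    have : 3 * V - 96 * (K1 + K2 + K3) = (V - 96 * K1) + (V - 96 * K2) + (V - 96 * K3) := by ring
    rw [this]
    refine ENNReal.ofReal_add_le.trans ?_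
    refine (add_le_add (ENNReal.ofReal_add_le.trans (add_le_add o1 o2)) o3).trans (le_of_eq ?_)
    ring
  rw [hsum] at htot
  have e4 : (r^2)⁻¹ * V - 96 * (tau μ r - tau μ (2*r)) = (3*r^2)⁻¹ * (3 * V - 96 * (3 * r^2 * (tau μ r - tau μ (2*r)))) := by
    field_simp
  rw [e4, ENNReal.ofReal_mul (by positivity)]
  refine (mul_le_mul_right htot _).trans (le_of_eq ?_)
  have e5 : ENNReal.ofReal (4000000 * (r^4)⁻¹) = ENNReal.ofReal (3*r^2)⁻¹ * (3 * ENNReal.ofReal (4000000 / r^2)) := by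
    rw [show (3:ℝ≥0∞) = ENNReal.ofReal 3 by simp, ← ENNReal.ofReal_mul (by norm_num), ← ENNReal.ofReal_mul (by positivity)]
    congr 1; field_simp
  rw [e5]; ring

lemma tau_nonneg (μ : Measure E) (r : ℝ) : 0 ≤ tau μ r := by
  unfold tau
  exact mul_nonneg (by positivity) (integral_nonneg fun p => KK_nonneg _ _ _)

lemma tau_le (μ : Measure E) [IsFiniteMeasure μ] (hg : ∀ x (r : ℝ), 0 < r → μ (closedBall x r) ≤ ENNReal.ofReal r)
    {r : ℝ} (hr : 0 < r) : tau μ r ≤ 864 * μ.real univ := by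
  have hk : Integrable (fun p : E × E × E => kr KK edir r p.2.1 p.2.2 p.1) (μ.prod (μ.prod μ)) :=
    bdd_int (kr_meas KK_meas edir_meas r (by fun_prop) (by fun_prop) (by fun_prop)) (C := 216) (fun q => KK_bdd _ _ _)
  have hz : ∀ z, ∫ q, kr KK edir r q.1 q.2 z ∂(μ.prod μ) ≤ 864 * r^2 := by
    intro z
    have e1 : ∫ q, kr KK edir r q.1 q.2 z ∂(μ.prod μ) = ∫ q in closedBall z (2*r) ×ˢ closedBall z (2*r), kr KK edir r q.1 q.2 z ∂(μ.prod μ) := by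
      symm
      apply setIntegral_eq_integral_of_forall_compl_eq_zero
      intro q hq
      unfold kr
      apply KK_supp
      apply far_dir (edir_isDir _ _ _) hr _ (by norm_num)
      by_contra hc
      push Not at hc
      refine hq ⟨?_, ?_⟩
      · rw [mem_closedBall, dist_eq_norm]; exact hc.2.2
      · rw [mem_closedBall, dist_eq_norm]; exact hc.2.1
    have hb : μ.real (closedBall z (2*r)) ≤ 2*r := ENNReal.toReal_le_of_le_ofReal (by positivity) (hg z (2*r) (by positivity))
    rw [e1]
    refine (le_abs_self _).trans ((abs_int_le (C := 216) fun q => KK_bdd _ _ _).trans ?_)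
    rw [measureReal_restrict_apply_univ, measureReal_prod_prod]
    have : μ.real (closedBall z (2*r)) * μ.real (closedBall z (2*r)) ≤ (2*r)*(2*r) := by gcongr
    nlinarith
  unfold tau
  rw [integral_prod _ hk]
  have h2 : ∫ z, ∫ q, kr KK edir r q.1 q.2 z ∂(μ.prod μ) ∂μ ≤ ∫ z, 864 * r^2 ∂μ :=
    integral_mono hk.integral_prod_left (integrable_const _) hz
  rw [integral_const, smul_eq_mul] at h2
  rw [inv_mul_le_iff₀ (by positivity)]
  refine h2.trans (le_of_eq ?_); ring

def Dl (μ : Measure E) (k : ℤ) (z : E) : ℝ := ((2:ℝ)^k)⁻¹ * PG μ (2^k) z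

lemma Dl_meas (μ : Measure E) [IsFiniteMeasure μ] (k : ℤ) : Measurable (Dl μ k) := (PG_meas μ _).const_mul _

lemma int_window (s : Finset ℤ) : ∃ (a : ℤ) (m : ℕ), s ⊆ (Finset.range m).image (fun i : ℕ => a + (i:ℤ)) := by
  classical
  obtain ⟨a, ha⟩ := s.bddBelow
  obtain ⟨b, hb⟩ := s.bddAbove
  refine ⟨a, (b - a).toNat + 1, fun k hk => ?_⟩
  have h1 : a ≤ k := ha hk
  have h2 : k ≤ b := hb hk
  rw [Finset.mem_image]
  refine ⟨(k - a).toNat, ?_, ?_⟩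
  · rw [Finset.mem_range]; lia
  · lia

/-- part (3) -/
lemma sum_PG (μ : Measure E) [IsFiniteMeasure μ] (hg : ∀ x (r : ℝ), 0 < r → μ (closedBall x r) ≤ ENNReal.ofReal r) :
    ∑' k : ℤ, ∫⁻ z, ENNReal.ofReal (Dl μ k z ^ 2) ∂μ ≤
      ENNReal.ofReal 4000000 * (∑' k : ℤ, ENNReal.ofReal (((2:ℝ)^k)^4)⁻¹ * Err μ (2^k)) + ENNReal.ofReal 82944 * μ univ := by
  classical
  set V : ℤ → ℝ := fun k => (((2:ℝ)^k)^2)⁻¹ * ∫ z, PG μ (2^k) z ^2 ∂μ with hV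
  set R : ℤ → ℝ≥0∞ := fun k => ENNReal.ofReal (((2:ℝ)^k)^4)⁻¹ * Err μ (2^k) with hR
  set T : ℤ → ℝ := fun k => tau μ (2^k) with hT
  have hPi : ∀ k : ℤ, Integrable (fun z => PG μ (2^k) z ^2) μ := by
    intro k
    refine bdd_int ((PG_meas μ _).pow_const 2) (C := (72 * μ.real univ)^2) (fun z => ?_)
    rw [abs_pow]; exact pow_le_pow_left₀ (abs_nonneg _) (PG_bdd μ _ z) 2
  have hV0 : ∀ k, 0 ≤ V k := fun k => mul_nonneg (by positivity) (integral_nonneg fun _ => sq_nonneg _)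
  have hVl : ∀ k, ∫⁻ z, ENNReal.ofReal (Dl μ k z ^ 2) ∂μ = ENNReal.ofReal (V k) := by
    intro k
    rw [hV]
    simp only
    rw [← integral_const_mul, ofReal_integral_eq_lintegral_ofReal ((hPi k).const_mul _) (ae_of_all _ fun _ => by positivity)]
    congr 1; ext z
    unfold Dl
    congr 1; rw [mul_pow, inv_pow]
  have step : ∀ k, ENNReal.ofReal (V k - 96 * (T k - T (k+1))) ≤ ENNReal.ofReal 4000000 * R k := by
    intro k
    have := three_e μ (r := 2^k) (by positivity)
    rw [ENNReal.ofReal_mul (by norm_num), mul_assoc] at this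
    rw [hT, hR, hV]
    simp only
    rw [zpow_add_one₀ (by norm_num), mul_comm ((2:ℝ)^k) 2]
    exact this
  have win : ∀ (a : ℤ) (m : ℕ), ∑ i ∈ Finset.range m, ENNReal.ofReal (V (a + i)) ≤
      ENNReal.ofReal 4000000 * (∑' k, R k) + ENNReal.ofReal 82944 * μ univ := by
    intro a m
    rw [← ENNReal.ofReal_sum_of_nonneg (fun _ _ => hV0 _)]
    have tel : ∑ i ∈ Finset.range m, V (a + i) = ∑ i ∈ Finset.range m, (V (a + i) - 96 * (T (a+i) - T (a+i+1))) + 96 * (T a - T (a + m)) := by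
      have h1 : ∑ i ∈ Finset.range m, (T (a+i) - T (a+i+1)) = T a - T (a+m) := by
        have := Finset.sum_range_sub' (fun i : ℕ => T (a + i)) m
        simp only [Nat.cast_add, Nat.cast_one, Nat.cast_zero, add_zero, ← add_assoc] at this
        exact this
      rw [Finset.sum_sub_distrib, ← Finset.mul_sum, h1]; ring
    rw [tel]
    refine ENNReal.ofReal_add_le.trans (add_le_add ?_ ?_)
    · refine (Finset.le_sum_of_subadditive _ ENNReal.ofReal_zero.le (fun a b => ENNReal.ofReal_add_le) _ _).trans ?_
      refine (Finset.sum_le_sum fun (i:ℕ) _ => step (a + (i:ℤ))).trans ?_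
      rw [← Finset.mul_sum]
      gcongr
      rw [← Finset.sum_image (s := Finset.range m) (g := fun i : ℕ => a + (i:ℤ)) (f := R) (fun i _ j _ h => by simpa using h)]
      exact ENNReal.sum_le_tsum _
    · have h1 := tau_nonneg μ ((2:ℝ)^(a+(m:ℤ)))
      have h2 := tau_le μ hg (r := (2:ℝ)^a) (by positivity)
      rw [← ofReal_measureReal (μ := μ), ← ENNReal.ofReal_mul (by norm_num)]
      apply ENNReal.ofReal_le_ofReal
      simp only [hT]
      linarith
  rw [ENNReal.tsum_eq_iSup_sum]
  refine iSup_le fun s => ?_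
  obtain ⟨a, m, hs⟩ := int_window s
  refine (Finset.sum_le_sum_of_subset hs).trans ?_
  rw [Finset.sum_image (fun i _ j _ h => by simpa using h)]
  simp only [hVl]
  exact win a m

def s2 (x y z : E) : ℝ := det (y - x) (z - x) ^2 / (‖y - x‖^2 * ‖z - x‖^2)

lemma s2_nonneg (x y z : E) : 0 ≤ s2 x y z := by unfold s2; positivity

lemma det_ip (u v : E) : det u v ^2 + ip u v ^2 = ‖u‖^2 * ‖v‖^2 := by
  rw [nsq, nsq]; unfold det ip; ring

lemma det_meas {α : Type*} [MeasurableSpace α] {f g : α → E} (hf : Measurable f) (hg : Measurable g) :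
    Measurable (fun a => det (f a) (g a)) := by
  have h0 : ∀ {h : α → E}, Measurable h → ∀ i, Measurable (fun a => h a i) := by
    intro h hh i
    have : Measurable (fun x : E => x i) := by fun_prop
    exact this.comp hh
  unfold det
  exact ((h0 hf 0).mul (h0 hg 1)).sub ((h0 hf 1).mul (h0 hg 0))

lemma s2_meas {α : Type*} [MeasurableSpace α] {f g h : α → E} (hf : Measurable f) (hg : Measurable g) (hh : Measurable h) :
    Measurable (fun a => s2 (f a) (g a) (h a)) := by
  unfold s2
  exact ((det_meas (hg.sub hf) (hh.sub hf)).pow_const 2).div (((hg.sub hf).norm.pow_const 2).mul ((hh.sub hf).norm.pow_const 2))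

lemma s2_le_one (x y z : E) : s2 x y z ≤ 1 := by
  unfold s2
  apply div_le_one_of_le₀ _ (by positivity)
  rw [← det_ip]; nlinarith [sq_nonneg (ip (y-x) (z-x))]

lemma s2_tri {x y z w : E} (hw : w ≠ x) : s2 x y z ≤ 3/2 * s2 x y w + 3 * s2 x w z := by
  unfold s2
  set u := y - x
  set v := z - x
  have hw' : w - x ≠ 0 := sub_ne_zero.2 hw
  set t := w - x
  have ht : 0 < ‖t‖^2 := by positivity
  by_cases hu : u = 0
  · rw [hu]; simp [det]; positivity
  by_cases hv : v = 0
  · rw [hv]; simp [det]; positivity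
  have hu' : 0 < ‖u‖^2 := by positivity
  have hv' : 0 < ‖v‖^2 := by positivity
  have key : det u v * ‖t‖^2 = det u t * ip t v + ip u t * det t v := by
    rw [nsq]; unfold det ip; ring
  have h1 := det_ip t v
  have h2 := det_ip u t
  have k1 : ip t v ^2 ≤ ‖t‖^2 * ‖v‖^2 := by nlinarith [sq_nonneg (det t v)]
  have k2 : ip u t ^2 ≤ ‖u‖^2 * ‖t‖^2 := by nlinarith [sq_nonneg (det u t)]
  have main : (det u v)^2 * (‖t‖^2 * ‖t‖^2) ≤ 3/2 * (det u t)^2 * (‖t‖^2 * ‖v‖^2) + 3 * (det t v)^2 * (‖u‖^2 * ‖t‖^2) := by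
    calc (det u v)^2 * (‖t‖^2 * ‖t‖^2) = (det u t * ip t v + ip u t * det t v)^2 := by rw [← key]; ring
      _ ≤ 3/2 * (det u t)^2 * (ip t v)^2 + 3 * (det t v)^2 * (ip u t)^2 := by
        nlinarith [sq_nonneg (det u t * ip t v - 2 * (ip u t * det t v))]
      _ ≤ _ := by gcongr
  have e1 : det u v ^2 / (‖u‖^2 * ‖v‖^2) = (det u v)^2 * (‖t‖^2 * ‖t‖^2) / (‖u‖^2 * ‖v‖^2 * (‖t‖^2 * ‖t‖^2)) := by
    field_simp
  have e2 : 3/2 * (det u t ^2 / (‖u‖^2 * ‖t‖^2)) + 3 * (det t v ^2 / (‖t‖^2 * ‖v‖^2)) =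
      (3/2 * (det u t)^2 * (‖t‖^2 * ‖v‖^2) + 3 * (det t v)^2 * (‖u‖^2 * ‖t‖^2)) / (‖u‖^2 * ‖v‖^2 * (‖t‖^2 * ‖t‖^2)) := by
    field_simp
  rw [e1, e2]
  gcongr

/-- annuli-type double integrals -/
def SSe (μ : Measure E) (x : E) (A B : Set E) : ℝ≥0∞ := ∫⁻ y in A, ∫⁻ z in B, ENNReal.ofReal (s2 x y z) ∂μ ∂μ

lemma SSe_le (μ : Measure E) (x : E) (A B : Set E) : SSe μ x A B ≤ μ A * μ B := by
  unfold SSe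
  calc _ ≤ ∫⁻ y in A, ∫⁻ z in B, 1 ∂μ ∂μ := by
        gcongr with y z
        exact (ENNReal.ofReal_le_ofReal (s2_le_one x y z)).trans (by simp)
    _ = _ := by simp [mul_comm]

lemma SSe_mono (μ : Measure E) (x : E) {A B A' B' : Set E} (hA : A ⊆ A') (hB : B ⊆ B') : SSe μ x A B ≤ SSe μ x A' B' := by
  unfold SSe
  exact (lintegral_mono_set hA).trans (lintegral_mono fun y => lintegral_mono_set hB)

set_option maxHeartbeats 1000000 in
lemma SSe_tri (μ : Measure E) [IsFiniteMeasure μ] (x : E) {A B W : Set E} (hW : MeasurableSet W) (hx : x ∉ W) :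
    μ W * SSe μ x A B ≤ ENNReal.ofReal (3/2) * (μ B * SSe μ x A W) + 3 * (μ A * SSe μ x W B) := by
  have hm1 : Measurable (fun p : E × E => ENNReal.ofReal (s2 x p.1 p.2)) := (s2_meas measurable_const measurable_fst measurable_snd).ennreal_ofReal
  have hm2 : Measurable (fun p : E × E => ENNReal.ofReal (s2 x p.2 p.1)) := (s2_meas measurable_const measurable_snd measurable_fst).ennreal_ofReal
  have g1 : ∀ y, Measurable (fun z => ENNReal.ofReal (s2 x y z)) := fun y => (s2_meas measurable_const measurable_const measurable_id).ennreal_ofReal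
  have g2 : ∀ C : Set E, Measurable (fun y => ∫⁻ z in C, ENNReal.ofReal (s2 x y z) ∂μ) := fun C => hm1.lintegral_prod_right'
  calc μ W * SSe μ x A B = ∫⁻ w in W, SSe μ x A B ∂μ := by rw [setLIntegral_const, mul_comm]
    _ ≤ ∫⁻ w in W, ∫⁻ y in A, ∫⁻ z in B, (ENNReal.ofReal (3/2) * ENNReal.ofReal (s2 x y w) + 3 * ENNReal.ofReal (s2 x w z)) ∂μ ∂μ ∂μ := by
        refine setLIntegral_mono' hW fun w hw => ?_
        unfold SSe
        gcongr with y z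
        rw [show (3:ℝ≥0∞) = ENNReal.ofReal 3 by simp, ← ENNReal.ofReal_mul (by norm_num), ← ENNReal.ofReal_mul (by norm_num),
          ← ENNReal.ofReal_add (mul_nonneg (by norm_num) (s2_nonneg _ _ _)) (mul_nonneg (by norm_num) (s2_nonneg _ _ _))]
        exact ENNReal.ofReal_le_ofReal (s2_tri (fun h => hx (h ▸ hw)))
    _ = ∫⁻ w in W, (ENNReal.ofReal (3/2) * (∫⁻ y in A, ENNReal.ofReal (s2 x y w) ∂μ) * μ B + 3 * (∫⁻ z in B, ENNReal.ofReal (s2 x w z) ∂μ) * μ A) ∂μ := by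
        congr 1; ext w
        have : ∀ y, ∫⁻ z in B, (ENNReal.ofReal (3/2) * ENNReal.ofReal (s2 x y w) + 3 * ENNReal.ofReal (s2 x w z)) ∂μ =
            ENNReal.ofReal (3/2) * ENNReal.ofReal (s2 x y w) * μ B + 3 * ∫⁻ z in B, ENNReal.ofReal (s2 x w z) ∂μ := by
          intro y
          rw [lintegral_add_left measurable_const, setLIntegral_const, lintegral_const_mul _ (g1 w)]
        simp only [this]
        have m0 : Measurable (fun y => ENNReal.ofReal (s2 x y w)) := (s2_meas measurable_const measurable_id measurable_const).ennreal_ofReal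
        rw [lintegral_add_right _ measurable_const, setLIntegral_const, lintegral_mul_const _ (m0.const_mul _), lintegral_const_mul _ m0]
    _ = _ := by
        have m1 : Measurable (fun w => ∫⁻ y in A, ENNReal.ofReal (s2 x y w) ∂μ) := hm2.lintegral_prod_right'
        rw [lintegral_add_right _ (((g2 B).const_mul _).mul_const _), lintegral_mul_const _ (m1.const_mul _), lintegral_const_mul _ m1,
          lintegral_mul_const _ ((g2 B).const_mul _), lintegral_const_mul _ (g2 B)]
        have sw : ∫⁻ w in W, ∫⁻ y in A, ENNReal.ofReal (s2 x y w) ∂μ ∂μ = SSe μ x A W := by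
          unfold SSe
          rw [lintegral_lintegral_swap]
          exact hm2.aemeasurable
        rw [sw]
        unfold SSe
        ring

def Ag (μ : Measure E) (x : E) (i : ℤ) : ℝ := ((2:ℝ)^i)⁻¹ * ∫ y, gg (‖y - x‖ / 2^i) ∂μ

lemma gg_int (μ : Measure E) [IsFiniteMeasure μ] (x : E) (r : ℝ) : Integrable (fun y : E => gg (‖y - x‖ / r)) μ :=
  bdd_int (gg_meas.comp (by fun_prop)) (C := 8) fun y => by rw [abs_of_nonneg (gg_nonneg _)]; exact gg_le _

lemma Ag_nonneg (μ : Measure E) (x : E) (i : ℤ) : 0 ≤ Ag μ x i :=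
  mul_nonneg (by positivity) (integral_nonneg fun _ => gg_nonneg _)

lemma Dl_eq (μ : Measure E) [IsFiniteMeasure μ] (x : E) (i : ℤ) : Dl μ i x = Ag μ x i - Ag μ x (i+1) := by
  unfold Dl Ag PG
  simp only [GG_eq]
  have e : ∀ y : E, ‖y - x‖ / 2^i / 2 = ‖y - x‖ / 2^(i+1) := fun y => by
    rw [zpow_add_one₀ (by norm_num), div_div]
  simp only [e]
  rw [integral_sub (gg_int μ x _) ((gg_int μ x _).div_const _), integral_div, zpow_add_one₀ (by norm_num)]
  field_simp

lemma ball_le_Ag (μ : Measure E) [IsFiniteMeasure μ] (x : E) (i : ℤ) : μ.real (closedBall x (2^i)) ≤ 32 * 2^i * Ag μ x i := by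
  have hp : (0:ℝ) < 2^i := by positivity
  have h1 : ∫ y in closedBall x ((2:ℝ)^i), (1/32 : ℝ) ∂μ ≤ ∫ y in closedBall x ((2:ℝ)^i), gg (‖y - x‖ / 2^i) ∂μ := by
    apply setIntegral_mono_on (integrable_const _) (gg_int μ x _).integrableOn isClosed_closedBall.measurableSet
    intro y hy
    apply gg_lower
    rw [abs_of_nonneg (by positivity), div_le_one hp, ← dist_eq_norm]
    exact hy
  have h2 : ∫ y in closedBall x ((2:ℝ)^i), gg (‖y - x‖ / 2^i) ∂μ ≤ ∫ y, gg (‖y - x‖ / 2^i) ∂μ :=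
    setIntegral_le_integral (gg_int μ x _) (ae_of_all _ fun _ => gg_nonneg _)
  rw [setIntegral_const, smul_eq_mul] at h1
  unfold Ag
  have e : 32 * (2:ℝ)^i * (((2:ℝ)^i)⁻¹ * ∫ y, gg (‖y - x‖ / 2^i) ∂μ) = 32 * ∫ y, gg (‖y - x‖ / 2^i) ∂μ := by field_simp
  rw [e]; linarith

def Wn (x : E) (i : ℤ) : Set E := closedBall x (2*2^i) \ closedBall x (2^i/512)

lemma Wn_meas (x : E) (i : ℤ) : MeasurableSet (Wn x i) :=
  isClosed_closedBall.measurableSet.diff isClosed_closedBall.measurableSet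

lemma Wn_lower (μ : Measure E) [IsFiniteMeasure μ] (x : E) (i : ℤ) :
    2^i * Ag μ x i - 2^(i-1) * Ag μ x (i-1) ≤ 8 * μ.real (Wn x i) + 1/2000 * μ.real (closedBall x (2^i)) := by
  have hp : (0:ℝ) < 2^i := by positivity
  have e0 : 2^i * Ag μ x i - 2^(i-1) * Ag μ x (i-1) = ∫ y, (gg (‖y - x‖ / 2^i) - gg (‖y-x‖ / 2^(i-1))) ∂μ := by
    rw [integral_sub (gg_int μ x _) (gg_int μ x _)]
    unfold Ag
    rw [mul_inv_cancel_left₀ (by positivity), mul_inv_cancel_left₀ (by positivity)]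
  have hW := Wn_meas x i
  have hB : MeasurableSet (closedBall x ((2:ℝ)^i)) := isClosed_closedBall.measurableSet
  have i1 : Integrable ((Wn x i).indicator (fun _ => (8:ℝ))) μ := (integrable_const _).indicator hW
  have i2 : Integrable ((closedBall x ((2:ℝ)^i)).indicator (fun _ => (1/2000:ℝ))) μ := (integrable_const _).indicator hB
  have e1 : 8 * μ.real (Wn x i) + 1/2000 * μ.real (closedBall x (2^i)) =
      ∫ y, ((Wn x i).indicator (fun _ => (8:ℝ)) y + (closedBall x ((2:ℝ)^i)).indicator (fun _ => (1/2000:ℝ)) y) ∂μ := by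
    rw [integral_add i1 i2, integral_indicator hW, integral_indicator hB, setIntegral_const, setIntegral_const]
    simp only [smul_eq_mul]; ring
  rw [e0, e1]
  apply integral_mono ((gg_int μ x _).sub (gg_int μ x _)) (i1.add i2)
  intro y
  simp only [Pi.sub_apply, Pi.add_apply]
  have half : ‖y - x‖ / 2^(i-1) = 2 * (‖y-x‖ / 2^i) := by
    rw [zpow_sub_one₀ (by norm_num)]; field_simp
  rw [half]
  set s := ‖y - x‖ / 2^i with hs
  have hs0 : 0 ≤ s := by positivity
  have hys : dist y x = s * 2^i := by rw [hs, dist_eq_norm]; field_simp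
  have n1 : 0 ≤ (Wn x i).indicator (fun _ => (8:ℝ)) y := indicator_nonneg (by simp) _
  have n2 : 0 ≤ (closedBall x ((2:ℝ)^i)).indicator (fun _ => (1/2000:ℝ)) y := indicator_nonneg (fun _ _ => by norm_num) _
  by_cases c1 : 2 < s
  · rw [gg_supp (by rw [abs_of_nonneg hs0]; exact c1), gg_supp (by rw [abs_of_nonneg (by positivity)]; linarith)]
    linarith
  push Not at c1
  by_cases c2 : s ≤ 1/512
  · have hy : y ∈ closedBall x ((2:ℝ)^i) := by rw [mem_closedBall, hys]; nlinarith
    rw [indicator_of_mem hy]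
    have := gg_diff s (2*s)
    have h3 : |s^2 - (2*s)^2| = 3 * s^2 := by rw [show s^2 - (2*s)^2 = -(3*s^2) by ring, abs_neg, abs_of_nonneg (by positivity)]
    rw [h3] at this
    have h4 := (abs_le.1 this).2
    nlinarith
  · push Not at c2
    have hy : y ∈ Wn x i := by
      refine ⟨?_, ?_⟩
      · rw [mem_closedBall, hys]; gcongr
      · rw [mem_closedBall, hys]; push Not; nlinarith
    rw [indicator_of_mem hy]
    linarith [gg_le s, gg_nonneg (2*s)]

def Yn (x : E) (j : ℤ) : Set E := closedBall x (2^j) \ closedBall x (2^(j-1))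
def Un (x : E) (i : ℤ) : Set E := closedBall x (4*2^i) \ closedBall x (2^i/512)
def nn (μ : Measure E) (x : E) (i : ℤ) : ℝ≥0∞ := ENNReal.ofReal (((2:ℝ)^i)^2)⁻¹ * SSe μ x (Un x i) (Un x i)

lemma Yn_sub_Wn (x : E) (j : ℤ) : Yn x j ⊆ Wn x j := by
  have hp : (0:ℝ) < 2^j := by positivity
  apply sdiff_subset_sdiff
  · exact closedBall_subset_closedBall (by linarith)
  · apply closedBall_subset_closedBall
    rw [zpow_sub_one₀ (by norm_num)]; linarith

lemma Yn_sub_ball (x : E) (j : ℤ) : Yn x j ⊆ closedBall x (2^j) := sdiff_subset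

lemma Wn_sub_Un (x : E) (j : ℤ) : Wn x j ⊆ Un x j := by
  have hp : (0:ℝ) < 2^j := by positivity
  exact sdiff_subset_sdiff (closedBall_subset_closedBall (by linarith)) le_rfl

lemma Wn_succ_sub_Un (x : E) (j : ℤ) : Wn x (j+1) ⊆ Un x j := by
  have hp : (0:ℝ) < 2^j := by positivity
  apply sdiff_subset_sdiff
  · apply closedBall_subset_closedBall
    rw [zpow_add_one₀ (by norm_num)]; linarith
  · apply closedBall_subset_closedBall
    rw [zpow_add_one₀ (by norm_num)]; linarith

lemma not_mem_Wn (x : E) (j : ℤ) : x ∉ Wn x j := by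
  intro h
  apply h.2
  rw [mem_closedBall, dist_self]; positivity

lemma chain {w S T : ℕ → ℝ} {N : ℕ} (hw : ∀ l ≤ N, 0 < w l) (hT : ∀ l, 0 ≤ T l) (hS : 0 ≤ S 0)
    (h : ∀ m < N, w m * S (m+1) ≤ 3/2 * (w (m+1) * S m) + 3 * (w 0 * T m)) :
    ∀ m ≤ N, S m ≤ w 0 * w m * ((3/2)^m * (S 0 / (w 0)^2 + 3 * ∑ l ∈ Finset.range m, T l / (w l * w (l+1)))) := by
  intro m
  induction m with
  | zero =>
    intro hN
    have := hw 0 hN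
    simp
    field_simp
    rfl
  | succ m ih =>
    intro hN
    have h0 := hw 0 (by lia)
    have h1 := hw m (by lia)
    have h2 := hw (m+1) hN
    have i1 := ih (by lia)
    have i2 := h m (by lia)
    rw [Finset.sum_range_succ]
    set X := S 0 / (w 0)^2 + 3 * ∑ l ∈ Finset.range m, T l / (w l * w (l+1)) with hX
    have e1 : S 0 / (w 0)^2 + 3 * (∑ l ∈ Finset.range m, T l / (w l * w (l+1)) + T m / (w m * w (m+1))) =
      X + 3 * (T m / (w m * w (m+1))) := by rw [hX]; ring
    rw [e1]
    have hp : (1:ℝ) ≤ (3/2)^(m+1) := one_le_pow₀ (by norm_num)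
    have h3 : S (m+1) ≤ (3/2 * (w (m+1) * S m) + 3 * (w 0 * T m)) / w m := by
      rw [le_div_iff₀ h1]; linarith
    refine h3.trans ?_
    have hq : 0 ≤ 3 * (T m / (w m * w (m+1))) := by have := hT m; positivity
    calc (3/2 * (w (m+1) * S m) + 3 * (w 0 * T m)) / w m
        ≤ (3/2 * (w (m+1) * (w 0 * w m * ((3/2)^m * X))) + 3 * (w 0 * T m)) / w m := by gcongr
      _ = w 0 * w (m+1) * ((3/2)^(m+1) * X + 1 * (3 * (T m / (w m * w (m+1))))) := by field_simp; ring
      _ ≤ w 0 * w (m+1) * ((3/2)^(m+1) * X + (3/2)^(m+1) * (3 * (T m / (w m * w (m+1))))) := by gcongr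
      _ = _ := by ring

lemma SSe_fin (μ : Measure E) [IsFiniteMeasure μ] (x : E) (A B : Set E) : SSe μ x A B ≠ ⊤ :=
  ne_top_of_le_ne_top (ENNReal.mul_ne_top (measure_ne_top _ _) (measure_ne_top _ _)) (SSe_le μ x A B)

lemma SSr_tri (μ : Measure E) [IsFiniteMeasure μ] (x : E) {A B W : Set E} (hW : MeasurableSet W) (hx : x ∉ W) :
    μ.real W * (SSe μ x A B).toReal ≤ 3/2 * (μ.real B * (SSe μ x A W).toReal) + 3 * (μ.real A * (SSe μ x W B).toReal) := by
  have h := SSe_tri μ x (A := A) (B := B) hW hx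
  have f1 := SSe_fin μ x A W
  have f2 := SSe_fin μ x W B
  have t1 : ENNReal.ofReal (3/2) * (μ B * SSe μ x A W) ≠ ⊤ := ENNReal.mul_ne_top (by simp) (ENNReal.mul_ne_top (by simp) f1)
  have t2 : 3 * (μ A * SSe μ x W B) ≠ ⊤ := ENNReal.mul_ne_top (by simp) (ENNReal.mul_ne_top (by simp) f2)
  have := ENNReal.toReal_mono (ENNReal.add_ne_top.2 ⟨t1, t2⟩) h
  rw [ENNReal.toReal_add t1 t2] at this
  simp only [ENNReal.toReal_mul] at this
  rw [ENNReal.toReal_ofReal (by norm_num)] at this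
  simpa [measureReal_def] using this

set_option maxHeartbeats 800000 in
/-- the good case -/
lemma good_case (μ : Measure E) [IsFiniteMeasure μ] (x : E) (j : ℤ) (m : ℕ) (ha : 0 < Ag μ x j)
    (hgood : ∀ l : ℕ, l ≤ m + 2 → |Ag μ x (j - 1 + l) - Ag μ x j| ≤ Ag μ x j / 8) :
    (((2:ℝ)^(j+m))^2)⁻¹ * (SSe μ x (Yn x j) (Yn x (j+m))).toReal ≤
      22000000 * (3/4)^m * ∑ l ∈ Finset.range (m+1), (((2:ℝ)^(j+l))^2)⁻¹ * (SSe μ x (Un x (j+l)) (Un x (j+l))).toReal := by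
  set a := Ag μ x j with hadef
  set p : ℝ := 2^j with hp
  have hp0 : 0 < p := by positivity
  have hpl : ∀ l : ℕ, (2:ℝ)^(j+l) = p * 2^l := fun l => by rw [zpow_add₀ (by norm_num), zpow_natCast]
  set w : ℕ → ℝ := fun l => μ.real (Wn x (j+l)) with hw
  set S : ℕ → ℝ := fun l => (SSe μ x (Wn x j) (Wn x (j+l))).toReal with hS
  set T : ℕ → ℝ := fun l => (SSe μ x (Wn x (j+l)) (Wn x (j+l+1))).toReal with hT
  set N : ℕ → ℝ := fun l => (((2:ℝ)^(j+l))^2)⁻¹ * (SSe μ x (Un x (j+l)) (Un x (j+l))).toReal with hN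
  have gd : ∀ l : ℕ, l ≤ m + 2 → 7/8 * a ≤ Ag μ x (j - 1 + l) ∧ Ag μ x (j-1+l) ≤ 9/8 * a := by
    intro l hl
    have := abs_le.1 (hgood l hl)
    constructor <;> linarith [this.1, this.2]
  have hlow : ∀ l ≤ m, p * 2^l * a / 32 ≤ w l := by
    intro l hl
    have h1 := Wn_lower μ x (j+l)
    have h2 := ball_le_Ag μ x (j+l)
    have g1 := (gd (l+1) (by lia))
    have g0 := (gd l (by lia))
    have e1 : j - 1 + ((l+1:ℕ):ℤ) = j + l := by push_cast; ring
    rw [e1] at g1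
    rw [show j + (l:ℤ) - 1 = j - 1 + l by ring] at h1
    have e2 : (2:ℝ)^(j - 1 + (l:ℤ)) = p * 2^l / 2 := by
      rw [← hpl, show j - 1 + (l:ℤ) = j + l - 1 by ring, zpow_sub_one₀ (by norm_num)]; ring
    rw [e2, hpl] at h1
    rw [hpl] at h2
    set q := p * 2^l with hq
    have hq0 : 0 < q := by positivity
    have b1 : q * (7/8 * a) ≤ q * Ag μ x (j+l) := by gcongr; exact g1.1
    have b2 : q / 2 * Ag μ x (j-1+l) ≤ q/2 * (9/8*a) := by gcongr; exact g0.2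
    have b3 : 32 * q * Ag μ x (j+l) ≤ 32 * q * (9/8*a) := by gcongr; exact g1.2
    have hqa : 0 < q * a := by positivity
    simp only [hw]
    linarith
  have hup : ∀ l ≤ m, w l ≤ 72 * (p * 2^l * a) := by
    intro l hl
    have h2 := ball_le_Ag μ x (j+l+1)
    have g1 := (gd (l+2) (by lia)).2
    have e1 : j - 1 + ((l+2:ℕ):ℤ) = j + l + 1 := by push_cast; ring
    rw [e1] at g1
    have e2 : (2:ℝ)^(j+(l:ℤ)+1) = 2 * (p * 2^l) := by rw [zpow_add_one₀ (by norm_num), hpl]; ring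
    rw [e2] at h2
    have h3 : w l ≤ μ.real (closedBall x (2 * (p * 2^l))) := by
      rw [← hpl]
      exact measureReal_mono sdiff_subset (measure_ne_top _ _)
    have hq0 : 0 < p * 2^l := by positivity
    have b3 : 32 * (2 * (p * 2^l)) * Ag μ x (j+l+1) ≤ 32 * (2 * (p * 2^l)) * (9/8*a) := by gcongr
    linarith
  have hwpos : ∀ l ≤ m, 0 < w l := fun l hl => lt_of_lt_of_le (by positivity) (hlow l hl)
  have hNn : ∀ l, 0 ≤ N l := fun l => by simp only [hN]; positivity
  have hch := chain (w := w) (S := S) (T := T) (N := m) hwpos (fun l => ENNReal.toReal_nonneg) ENNReal.toReal_nonneg (by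
    intro l hl
    have := SSr_tri μ x (A := Wn x j) (B := Wn x (j+l+1)) (W := Wn x (j+l)) (Wn_meas _ _) (not_mem_Wn _ _)
    simp only [hw, hS, hT]
    push_cast
    simp only [add_zero, ← add_assoc]
    exact this) m le_rfl
  have hS0 : S 0 / (w 0)^2 ≤ 1024 / a^2 * N 0 := by
    have h1 : S 0 ≤ p^2 * N 0 := by
      simp only [hS, hN, Nat.cast_zero, add_zero, ← hp]
      rw [mul_inv_cancel_left₀ (by positivity)]
      exact ENNReal.toReal_mono (SSe_fin _ _ _ _) (SSe_mono μ x (Wn_sub_Un _ _) (Wn_sub_Un _ _))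
    have h2 := hlow 0 (by lia)
    rw [pow_zero, mul_one] at h2
    have h3 : (p * a / 32)^2 ≤ (w 0)^2 := by gcongr
    calc S 0 / (w 0)^2 ≤ p^2 * N 0 / (p * a / 32)^2 := by
          have := hNn 0
          gcongr
      _ = _ := by field_simp; ring
  have hTl : ∀ l < m, T l / (w l * w (l+1)) ≤ 1024 / a^2 * N l := by
    intro l hl
    have h1 : T l ≤ (p * 2^l)^2 * N l := by
      simp only [hT, hN, hpl]
      rw [mul_inv_cancel_left₀ (by positivity)]
      exact ENNReal.toReal_mono (SSe_fin _ _ _ _) (SSe_mono μ x (Wn_sub_Un _ _) (Wn_succ_sub_Un _ _))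
    have h2 := hlow l (by lia)
    have h3 : p * 2^l * a / 32 ≤ w (l+1) := by
      refine le_trans ?_ (hlow (l+1) (by lia))
      rw [pow_succ]
      have : 0 < p * 2^l * a := by positivity
      linarith
    have h4 : 0 < p * 2^l * a / 32 := by positivity
    calc T l / (w l * w (l+1)) ≤ (p * 2^l)^2 * N l / ((p * 2^l * a / 32) * (p * 2^l * a / 32)) := by
          have := hNn l
          gcongr
      _ = _ := by field_simp; ring
  have hX : S 0 / (w 0)^2 + 3 * ∑ l ∈ Finset.range m, T l / (w l * w (l+1)) ≤ 4096 / a^2 * ∑ l ∈ Finset.range (m+1), N l := by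
    have k1 : ∑ l ∈ Finset.range m, T l / (w l * w (l+1)) ≤ 1024 / a^2 * ∑ l ∈ Finset.range m, N l := by
      rw [Finset.mul_sum]
      exact Finset.sum_le_sum fun l hl => hTl l (Finset.mem_range.1 hl)
    have k2 : ∑ l ∈ Finset.range m, N l ≤ ∑ l ∈ Finset.range (m+1), N l :=
      Finset.sum_le_sum_of_subset_of_nonneg (Finset.range_mono (by lia)) (fun _ _ _ => hNn _)
    have k3 : N 0 ≤ ∑ l ∈ Finset.range (m+1), N l :=
      Finset.single_le_sum (f := N) (fun _ _ => hNn _) (Finset.mem_range.2 (Nat.succ_pos m))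
    have hc : 0 < 1024 / a^2 := by positivity
    have k4 := mul_le_mul_of_nonneg_left k2 hc.le
    have k5 := mul_le_mul_of_nonneg_left k3 hc.le
    have : 4096 / a^2 * ∑ l ∈ Finset.range (m+1), N l = 4 * (1024 / a^2 * ∑ l ∈ Finset.range (m+1), N l) := by ring
    rw [this]; linarith
  have hSN : 0 ≤ ∑ l ∈ Finset.range (m+1), N l := Finset.sum_nonneg fun _ _ => hNn _
  have hY : (SSe μ x (Yn x j) (Yn x (j+m))).toReal ≤ S m :=
    ENNReal.toReal_mono (SSe_fin _ _ _ _) (SSe_mono μ x (Yn_sub_Wn _ _) (Yn_sub_Wn _ _))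
  have u0 := hup 0 (by lia)
  rw [pow_zero, mul_one] at u0
  have um := hup m le_rfl
  have hw0 := hwpos 0 (by lia)
  have hwm := hwpos m le_rfl
  rw [hpl]
  generalize (SSe μ x (Yn x j) (Yn x (j+m))).toReal = Z at *
  clear_value S T N w a p
  have hfin : S m ≤ (72 * (p * a)) * (72 * (p * 2^m * a)) * ((3/2)^m * (4096 / a^2 * ∑ l ∈ Finset.range (m+1), N l)) := by
    refine hch.trans ?_
    refine (mul_le_mul_of_nonneg_left (mul_le_mul_of_nonneg_left hX (by positivity)) (by positivity)).trans ?_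
    gcongr
  calc ((p * 2^m)^2)⁻¹ * Z
      ≤ ((p * 2^m)^2)⁻¹ * ((72 * (p * a)) * (72 * (p * 2^m * a)) * ((3/2)^m * (4096 / a^2 * ∑ l ∈ Finset.range (m+1), N l))) := by
        exact mul_le_mul_of_nonneg_left (hY.trans hfin) (by positivity)
    _ = 21233664 * (3/4)^m * ∑ l ∈ Finset.range (m+1), N l := by
        have : (3/4:ℝ)^m = (3/2)^m / 2^m := by rw [← div_pow]; norm_num
        rw [this]; field_simp; ring
    _ ≤ _ := by gcongr; norm_num

lemma osc {f : ℕ → ℝ} {n a b : ℕ} (ha : a ≤ n) (hb : b ≤ n) : |f a - f b| ≤ ∑ i ∈ Finset.range n, |f i - f (i+1)| := by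
  wlog h : a ≤ b generalizing a b
  · rw [abs_sub_comm]; exact this hb ha (by lia)
  have h1 := dist_le_Ico_sum_dist f h
  simp only [Real.dist_eq] at h1
  refine h1.trans (Finset.sum_le_sum_of_subset_of_nonneg ?_ (fun _ _ _ => abs_nonneg _))
  intro i hi
  rw [Finset.mem_Ico] at hi
  exact Finset.mem_range.2 (by lia)

lemma unif_real (μ : Measure E) [IsFiniteMeasure μ] (x : E) (j : ℤ) (m : ℕ) :
    (((2:ℝ)^(j+m))^2)⁻¹ * (SSe μ x (Yn x j) (Yn x (j+m))).toReal ≤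
      22000000 * (3/4)^m * (m+2) * ∑ l ∈ Finset.range (m+2), (Dl μ (j-1+l) x ^2 + (((2:ℝ)^(j-1+l))^2)⁻¹ * (SSe μ x (Un x (j-1+l)) (Un x (j-1+l))).toReal) := by
  set N : ℕ → ℝ := fun l => (((2:ℝ)^(j-1+l))^2)⁻¹ * (SSe μ x (Un x (j-1+l)) (Un x (j-1+l))).toReal with hN
  have hNn : ∀ l, 0 ≤ N l := fun l => by simp only [hN]; positivity
  have hSN : 0 ≤ ∑ l ∈ Finset.range (m+2), N l := Finset.sum_nonneg fun _ _ => hNn _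
  have hSD : 0 ≤ ∑ l ∈ Finset.range (m+2), Dl μ (j-1+l) x ^2 := Finset.sum_nonneg fun _ _ => sq_nonneg _
  change _ ≤ 22000000 * (3/4)^m * (m+2) * ∑ l ∈ Finset.range (m+2), (Dl μ (j-1+l) x ^2 + N l)
  rw [Finset.sum_add_distrib]
  have hY : (SSe μ x (Yn x j) (Yn x (j+m))).toReal ≤ (32 * 2^j * Ag μ x j) * (32 * 2^(j+m) * Ag μ x (j+m)) := by
    have h1 := ENNReal.toReal_mono (by finiteness) (SSe_le μ x (Yn x j) (Yn x (j+m)))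
    rw [ENNReal.toReal_mul] at h1
    refine h1.trans (mul_le_mul ?_ ?_ (by positivity) ?_)
    · exact (measureReal_mono (Yn_sub_ball x j) (measure_ne_top _ _)).trans (ball_le_Ag μ x j)
    · exact (measureReal_mono (Yn_sub_ball x (j+m)) (measure_ne_top _ _)).trans (ball_le_Ag μ x (j+m))
    · exact mul_nonneg (by positivity) (Ag_nonneg _ _ _)
  have hA := Ag_nonneg μ x j
  have hk := Ag_nonneg μ x (j+m)
  by_cases hg : ∀ l : ℕ, l ≤ m + 2 → |Ag μ x (j - 1 + l) - Ag μ x j| ≤ Ag μ x j / 8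
  · rcases hA.eq_or_lt with h0 | h0
    · rw [← h0] at hY
      simp only [mul_zero, zero_mul] at hY
      have : (SSe μ x (Yn x j) (Yn x (j+m))).toReal = 0 := le_antisymm hY ENNReal.toReal_nonneg
      rw [this, mul_zero]
      positivity
    · refine (good_case μ x j m h0 hg).trans ?_
      have e : ∑ l ∈ Finset.range (m+1), (((2:ℝ)^(j+l))^2)⁻¹ * (SSe μ x (Un x (j+l)) (Un x (j+l))).toReal ≤ ∑ l ∈ Finset.range (m+2), N l := by
        rw [Finset.sum_range_succ' N]
        refine le_trans (le_of_eq ?_) (le_add_of_nonneg_right (hNn 0))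
        refine Finset.sum_congr rfl fun l _ => ?_
        simp only [hN]
        rw [show j - 1 + ((l+1:ℕ):ℤ) = j + l by push_cast; ring]
      have hm : (1:ℝ) ≤ m + 2 := by have : (0:ℝ) ≤ m := by positivity
                                    linarith
      calc _ ≤ 22000000 * (3/4)^m * 1 * (0 + ∑ l ∈ Finset.range (m+2), N l) := by
            rw [mul_one, zero_add]; gcongr
        _ ≤ _ := by gcongr
  · push Not at hg
    obtain ⟨l, hl, hbad⟩ := hg
    set f : ℕ → ℝ := fun l => Ag μ x (j - 1 + l) with hf
    set D := ∑ i ∈ Finset.range (m+2), |f i - f (i+1)| with hD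
    have hD0 : 0 ≤ D := Finset.sum_nonneg fun _ _ => abs_nonneg _
    have f1 : f 1 = Ag μ x j := by simp [hf]
    have fk : f (m+1) = Ag μ x (j+m) := by
      simp only [hf]; congr 1; push_cast; ring
    have o1 : |f l - f 1| ≤ D := osc hl (by lia)
    have o2 : |f (m+1) - f 1| ≤ D := osc (by lia) (by lia)
    rw [f1] at o1 o2
    rw [fk] at o2
    have a1 : Ag μ x j ≤ 8 * D := by
      have : Ag μ x j / 8 < D := hbad.trans_le o1
      linarith
    have a2 : Ag μ x (j+m) ≤ 9 * D := by have := (abs_le.1 o2).2; linarith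
    have hDD : D^2 ≤ (m+2) * ∑ l ∈ Finset.range (m+2), Dl μ (j-1+l) x ^2 := by
      have := sq_sum_le_card_mul_sum_sq (s := Finset.range (m+2)) (f := fun i => |f i - f (i+1)|)
      simp only [Finset.card_range, sq_abs] at this
      push_cast at this
      have e : ∀ i ∈ Finset.range (m+2), Dl μ (j-1+i) x ^2 = (f i - f (i+1))^2 := by
        intro i _
        rw [Dl_eq]
        simp only [hf]
        push_cast
        rw [add_assoc]
      rw [Finset.sum_congr rfl e]
      exact this
    have hpow : (2:ℝ)^(j+(m:ℤ)) = 2^j * 2^m := by rw [zpow_add₀ (by norm_num), zpow_natCast]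
    have hp : (0:ℝ) < 2^j := by positivity
    calc (((2:ℝ)^(j+m))^2)⁻¹ * (SSe μ x (Yn x j) (Yn x (j+m))).toReal
        ≤ (((2:ℝ)^(j+m))^2)⁻¹ * ((32 * 2^j * (8 * D)) * (32 * 2^(j+m) * (9 * D))) := by
          refine mul_le_mul_of_nonneg_left (hY.trans ?_) (by positivity)
          gcongr
      _ = 73728 * (1/2)^m * D^2 := by
          rw [hpow, one_div, inv_pow]; field_simp; ring
      _ ≤ 22000000 * (3/4)^m * ((m+2) * ∑ l ∈ Finset.range (m+2), Dl μ (j-1+l) x ^2) := by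
          refine mul_le_mul (mul_le_mul (by norm_num) (pow_le_pow_left₀ (by norm_num) (by norm_num) m) (by positivity) (by norm_num)) hDD (by positivity) (by positivity)
      _ ≤ _ := by
          rw [← mul_assoc]
          gcongr
          linarith

def hh (μ : Measure E) (x : E) (i : ℤ) : ℝ≥0∞ := ENNReal.ofReal (Dl μ i x ^2) + nn μ x i

lemma unif (μ : Measure E) [IsFiniteMeasure μ] (x : E) (j : ℤ) (m : ℕ) :
    ENNReal.ofReal (((2:ℝ)^(j+m))^2)⁻¹ * SSe μ x (Yn x j) (Yn x (j+m)) ≤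
      ENNReal.ofReal (22000000 * (3/4)^m * (m+2)) * ∑ l ∈ Finset.range (m+2), hh μ x (j-1+l) := by
  have h := ENNReal.ofReal_le_ofReal (unif_real μ x j m)
  rw [ENNReal.ofReal_mul (by positivity), ENNReal.ofReal_toReal (SSe_fin _ _ _ _), ENNReal.ofReal_mul (by positivity),
    ENNReal.ofReal_sum_of_nonneg (fun _ _ => by positivity)] at h
  refine h.trans (le_of_eq ?_)
  congr 1
  refine Finset.sum_congr rfl fun l _ => ?_
  rw [ENNReal.ofReal_add (by positivity) (by positivity), ENNReal.ofReal_mul (by positivity), ENNReal.ofReal_toReal (SSe_fin _ _ _ _)]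
  rfl

def KS : ℝ := ∑' n : ℕ, 22000000 * (3/4:ℝ)^n * (n+2) * (n+2)

lemma KS_sum : Summable (fun n : ℕ => 22000000 * (3/4:ℝ)^n * (n+2) * (n+2)) := by
  have h : ∀ k : ℕ, Summable (fun n : ℕ => (n:ℝ)^k * (3/4:ℝ)^n) := fun k =>
    summable_pow_mul_geometric_of_norm_lt_one k (by rw [Real.norm_eq_abs, abs_of_pos] <;> norm_num)
  refine ((((h 2).add ((h 1).mul_left 4)).add ((h 0).mul_left 4)).mul_left 22000000).congr fun n => ?_
  ring

lemma sum_all (μ : Measure E) [IsFiniteMeasure μ] (x : E) :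
    ∑' (j : ℤ), ∑' (n : ℕ), ENNReal.ofReal (((2:ℝ)^(j+n))^2)⁻¹ * SSe μ x (Yn x j) (Yn x (j+n)) ≤
      ENNReal.ofReal KS * ∑' i, hh μ x i := by
  calc _ ≤ ∑' (j : ℤ), ∑' (n : ℕ), ENNReal.ofReal (22000000 * (3/4)^n * (n+2)) * ∑ l ∈ Finset.range (n+2), hh μ x (j-1+l) :=
        ENNReal.tsum_le_tsum fun j => ENNReal.tsum_le_tsum fun n => unif μ x j n
    _ = ∑' (n : ℕ), ENNReal.ofReal (22000000 * (3/4)^n * (n+2)) * ∑ l ∈ Finset.range (n+2), ∑' j : ℤ, hh μ x (j-1+l) := by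
        rw [ENNReal.tsum_comm]
        refine tsum_congr fun n => ?_
        rw [ENNReal.tsum_mul_left]
        congr 1
        exact Summable.tsum_finsetSum fun _ _ => ENNReal.summable
    _ = ∑' (n : ℕ), ENNReal.ofReal (22000000 * (3/4)^n * (n+2) * (n+2)) * ∑' i : ℤ, hh μ x i := by
        refine tsum_congr fun n => ?_
        have : ∀ l : ℕ, ∑' j : ℤ, hh μ x (j-1+l) = ∑' i : ℤ, hh μ x i := by
          intro l
          rw [← (Equiv.addRight (-1 + (l:ℤ))).tsum_eq (fun i => hh μ x i)]
          refine tsum_congr fun j => ?_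
          congr 1
          simp; ring
        simp only [this, Finset.sum_const, Finset.card_range, nsmul_eq_mul]
        rw [← mul_assoc, ENNReal.ofReal_mul (p := 22000000 * (3/4:ℝ)^n * (n+2)) (by positivity)]
        congr 2
        rw [← ENNReal.ofReal_natCast]
        push_cast
        rfl
    _ = _ := by
        rw [ENNReal.tsum_mul_right, KS, ENNReal.ofReal_tsum_of_nonneg (fun n => by positivity) KS_sum]

lemma Yn_meas (x : E) (i : ℤ) : MeasurableSet (Yn x i) :=
  isClosed_closedBall.measurableSet.diff isClosed_closedBall.measurableSet

lemma SSe_prod (μ : Measure E) [IsFiniteMeasure μ] (x : E) (A B : Set E) :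
    SSe μ x A B = ∫⁻ p in A ×ˢ B, ENNReal.ofReal (s2 x p.1 p.2) ∂(μ.prod μ) := by
  unfold SSe
  rw [setLIntegral_prod]
  exact (s2_meas measurable_const measurable_fst measurable_snd).ennreal_ofReal.aemeasurable

open Classical in
def phi (x : E) (p : E × E) : ℝ≥0∞ := if ‖p.1 - x‖ ≤ ‖p.2 - x‖ then ENNReal.ofReal (s2 x p.1 p.2 / ‖p.2 - x‖^2) else 0

lemma mem_Yn {x y : E} (h : y ≠ x) : ∃ j : ℤ, y ∈ Yn x j := by
  have : 0 < dist y x := dist_pos.2 h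
  obtain ⟨n, hn⟩ := exists_mem_Ioc_zpow this (one_lt_two (α := ℝ))
  refine ⟨n+1, hn.2, ?_⟩
  rw [mem_closedBall, not_le]
  simpa using hn.1

lemma phi_le (x : E) (p : E × E) : phi x p ≤ ∑' (j : ℤ), ∑' (n : ℕ),
    (Yn x j ×ˢ Yn x (j+n)).indicator (fun p => ENNReal.ofReal (4 * (((2:ℝ)^(j+n))^2)⁻¹) * ENNReal.ofReal (s2 x p.1 p.2)) p := by
  unfold phi
  split_ifs with h
  swap
  · exact zero_le
  by_cases h1 : p.1 = x
  · have : s2 x p.1 p.2 = 0 := by unfold s2 det; simp [h1]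
    rw [this]; simp
  by_cases h2 : p.2 = x
  · have : s2 x p.1 p.2 = 0 := by unfold s2 det; simp [h2]
    rw [this]; simp
  obtain ⟨j, hj⟩ := mem_Yn h1
  obtain ⟨k, hk⟩ := mem_Yn h2
  have hjk : j ≤ k := by
    have a1 := hj.2
    have a2 := hk.1
    rw [mem_closedBall, dist_eq_norm] at a1 a2
    have : (2:ℝ)^(j-1) < 2^k := by linarith [not_le.1 a1]
    have := (zpow_lt_zpow_iff_right₀ (one_lt_two (α := ℝ))).1 this
    lia
  obtain ⟨n, rfl⟩ := Int.le.dest hjk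
  refine le_trans ?_ (ENNReal.le_tsum j)
  refine le_trans ?_ (ENNReal.le_tsum n)
  rw [indicator_of_mem (show p ∈ Yn x j ×ˢ Yn x (j+n) from ⟨hj, hk⟩), ← ENNReal.ofReal_mul (by positivity)]
  apply ENNReal.ofReal_le_ofReal
  have b := hk.2
  rw [mem_closedBall, dist_eq_norm, not_le, zpow_sub_one₀ (by norm_num)] at b
  set q : ℝ := 2^(j+(n:ℤ)) with hq
  have hq0 : 0 < q := by positivity
  have hs := s2_nonneg x p.1 p.2
  calc s2 x p.1 p.2 / ‖p.2 - x‖^2 ≤ s2 x p.1 p.2 / (q * 2⁻¹)^2 := by gcongr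
    _ = _ := by field_simp; ring

def Phi (μ : Measure E) (x : E) : ℝ≥0∞ := ∫⁻ p, phi x p ∂(μ.prod μ)

lemma Phi_le (μ : Measure E) [IsFiniteMeasure μ] (x : E) : Phi μ x ≤ ENNReal.ofReal (4 * KS) * ∑' i, hh μ x i := by
  have hm : ∀ c : ℝ≥0∞, Measurable (fun p : E × E => c * ENNReal.ofReal (s2 x p.1 p.2)) := fun c =>
    (s2_meas measurable_const measurable_fst measurable_snd).ennreal_ofReal.const_mul c
  calc Phi μ x ≤ ∫⁻ p, ∑' (j : ℤ), ∑' (n : ℕ),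
    (Yn x j ×ˢ Yn x (j+n)).indicator (fun p => ENNReal.ofReal (4 * (((2:ℝ)^(j+n))^2)⁻¹) * ENNReal.ofReal (s2 x p.1 p.2)) p ∂(μ.prod μ) :=
        lintegral_mono (phi_le x)
    _ = ∑' (j : ℤ), ∑' (n : ℕ), ENNReal.ofReal 4 * (ENNReal.ofReal (((2:ℝ)^(j+n))^2)⁻¹ * SSe μ x (Yn x j) (Yn x (j+n))) := by
        rw [lintegral_tsum]
        · refine tsum_congr fun j => ?_
          rw [lintegral_tsum]
          · refine tsum_congr fun n => ?_
            rw [lintegral_indicator ((Yn_meas _ _).prod (Yn_meas _ _)), lintegral_const_mul' _ _ ENNReal.ofReal_ne_top, ← SSe_prod,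
              ENNReal.ofReal_mul (by norm_num), mul_assoc]
          · exact fun n => ((hm _).indicator ((Yn_meas _ _).prod (Yn_meas _ _))).aemeasurable
        · exact fun j => (Measurable.tsum fun n => ((hm _).indicator ((Yn_meas _ _).prod (Yn_meas _ _)))).aemeasurable
    _ = ENNReal.ofReal 4 * ∑' (j : ℤ), ∑' (n : ℕ), ENNReal.ofReal (((2:ℝ)^(j+n))^2)⁻¹ * SSe μ x (Yn x j) (Yn x (j+n)) := by
        simp only [ENNReal.tsum_mul_left]
    _ ≤ _ := by
        rw [ENNReal.ofReal_mul (by norm_num), mul_assoc]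
        gcongr
        exact sum_all μ x

lemma nn_meas (μ : Measure E) [IsFiniteMeasure μ] (i : ℤ) : Measurable (fun x => nn μ x i) := by
  unfold nn
  apply Measurable.const_mul
  have hU : ∀ x, MeasurableSet (Un x i) := fun x => isClosed_closedBall.measurableSet.diff isClosed_closedBall.measurableSet
  have e : ∀ x, SSe μ x (Un x i) (Un x i) = ∫⁻ p, {q : E × (E × E) | q.2.1 ∈ Un q.1 i ∧ q.2.2 ∈ Un q.1 i}.indicator
      (fun q => ENNReal.ofReal (s2 q.1 q.2.1 q.2.2)) (x, p) ∂(μ.prod μ) := by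
    intro x
    rw [SSe_prod, ← lintegral_indicator ((hU x).prod (hU x))]
    rfl
  simp only [e]
  apply Measurable.lintegral_prod_right'
  apply (s2_meas measurable_fst (measurable_fst.comp measurable_snd) (measurable_snd.comp measurable_snd)).ennreal_ofReal.indicator
  have d1 : Measurable (fun q : E × (E × E) => dist q.2.1 q.1) := by fun_prop
  have d2 : Measurable (fun q : E × (E × E) => dist q.2.2 q.1) := by fun_prop
  exact ((measurableSet_le d1 measurable_const).diff (measurableSet_le d1 measurable_const)).inter
    ((measurableSet_le d2 measurable_const).diff (measurableSet_le d2 measurable_const))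

lemma int_nn (μ : Measure E) [IsFiniteMeasure μ] (i : ℤ) :
    ∫⁻ x, nn μ x i ∂μ ≤ ENNReal.ofReal (512^4 * 384) * (ENNReal.ofReal (((2:ℝ)^i)^4)⁻¹ * Err μ (2^i)) := by
  have hp : (0:ℝ) < 2^i := by positivity
  set q : ℝ := 2^i with hq
  have hU : ∀ x, MeasurableSet (Un x i) := fun x => isClosed_closedBall.measurableSet.diff isClosed_closedBall.measurableSet
  have h1 : ∀ x, nn μ x i ≤ ENNReal.ofReal ((q^2)⁻¹ * (512^4 * (q^4)⁻¹)) *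
      ∫⁻ y in closedBall x (4*q), ∫⁻ z in closedBall x (4*q), ENNReal.ofReal (det (y-x) (z-x)^2) ∂μ ∂μ := by
    intro x
    unfold nn SSe
    rw [← hq, ENNReal.ofReal_mul (by positivity), mul_assoc]
    gcongr
    rw [← lintegral_const_mul' _ _ ENNReal.ofReal_ne_top]
    simp only [← lintegral_const_mul' _ _ (ENNReal.ofReal_ne_top (r := 512^4 * (q^4)⁻¹))]
    refine le_trans (setLIntegral_mono' (hU x) fun y hy => setLIntegral_mono' (g := fun z => ENNReal.ofReal (512^4 * (q^4)⁻¹) * ENNReal.ofReal (det (y-x) (z-x)^2)) (hU x) fun z hz => ?_) ?_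
    · rw [← ENNReal.ofReal_mul (by positivity)]
      apply ENNReal.ofReal_le_ofReal
      have a1 := hy.2
      have a2 := hz.2
      rw [mem_closedBall, dist_eq_norm, not_le, ← hq] at a1 a2
      unfold s2
      calc det (y-x) (z-x)^2 / (‖y-x‖^2 * ‖z-x‖^2) ≤ det (y-x) (z-x)^2 / ((q/512)^2 * (q/512)^2) := by gcongr
        _ = _ := by field_simp
    · exact (lintegral_mono_set sdiff_subset).trans (lintegral_mono fun y => lintegral_mono_set sdiff_subset)
  calc _ ≤ ∫⁻ x, ENNReal.ofReal ((q^2)⁻¹ * (512^4 * (q^4)⁻¹)) *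
      ∫⁻ y in closedBall x (4*q), ∫⁻ z in closedBall x (4*q), ENNReal.ofReal (det (y-x) (z-x)^2) ∂μ ∂μ ∂μ := lintegral_mono h1
    _ ≤ ENNReal.ofReal ((q^2)⁻¹ * (512^4 * (q^4)⁻¹)) * (ENNReal.ofReal (384*q^2) * Err μ q) := by
        rw [lintegral_const_mul' _ _ ENNReal.ofReal_ne_top]
        gcongr
        exact near_det μ hp
    _ = _ := by
        rw [← mul_assoc (ENNReal.ofReal _), ← ENNReal.ofReal_mul (by positivity),
          ← mul_assoc (ENNReal.ofReal (512^4*384)), ← ENNReal.ofReal_mul (by positivity)]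
        congr 2
        field_simp

lemma int_Phi (μ : Measure E) [IsFiniteMeasure μ] (hg : ∀ x (r : ℝ), 0 < r → μ (closedBall x r) ≤ ENNReal.ofReal r) :
    ∫⁻ x, Phi μ x ∂μ ≤ ENNReal.ofReal (4 * KS) * (ENNReal.ofReal (4000000 + 512^4*384) * (ENNReal.ofReal (2^46) * jonesEnergy μ) + ENNReal.ofReal 82944 * μ univ) := by
  calc ∫⁻ x, Phi μ x ∂μ ≤ ∫⁻ x, ENNReal.ofReal (4 * KS) * ∑' i, hh μ x i ∂μ := lintegral_mono (Phi_le μ)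
    _ = ENNReal.ofReal (4 * KS) * (∑' i, ∫⁻ x, ENNReal.ofReal (Dl μ i x^2) ∂μ + ∑' i, ∫⁻ x, nn μ x i ∂μ) := by
        rw [lintegral_const_mul' _ _ ENNReal.ofReal_ne_top, lintegral_tsum]
        · rw [← ENNReal.tsum_add]
          congr 1
          refine tsum_congr fun i => ?_
          unfold hh
          rw [lintegral_add_right _ (nn_meas μ i)]
        · intro i
          exact ((((Dl_meas μ i).pow_const 2).ennreal_ofReal).add (nn_meas μ i)).aemeasurable
    _ ≤ ENNReal.ofReal (4 * KS) * ((ENNReal.ofReal 4000000 * (∑' k:ℤ, ENNReal.ofReal (((2:ℝ)^k)^4)⁻¹ * Err μ (2^k)) + ENNReal.ofReal 82944 * μ univ)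
          + ENNReal.ofReal (512^4 * 384) * (∑' k:ℤ, ENNReal.ofReal (((2:ℝ)^k)^4)⁻¹ * Err μ (2^k))) := by
        gcongr
        · exact sum_PG μ hg
        · rw [← ENNReal.tsum_mul_left]
          exact ENNReal.tsum_le_tsum fun i => int_nn μ i
    _ = ENNReal.ofReal (4 * KS) * (ENNReal.ofReal (4000000 + 512^4*384) * (∑' k:ℤ, ENNReal.ofReal (((2:ℝ)^k)^4)⁻¹ * Err μ (2^k)) + ENNReal.ofReal 82944 * μ univ) := by
        rw [ENNReal.ofReal_add (by norm_num) (by norm_num)]; ring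
    _ ≤ _ := by
        gcongr
        exact Err_jones μ

def cc (x y z : E) : ℝ := 4 * det (y-x) (z-x) ^2 / (‖y-x‖^2 * ‖z-y‖^2 * ‖z-x‖^2)

lemma cc_nonneg (x y z : E) : 0 ≤ cc x y z := by unfold cc; positivity

lemma cc_rot (x y z : E) : cc x y z = cc y z x := by
  unfold cc
  have h1 : det (y-x) (z-x) = det (z-y) (x-y) := by simp [det]; ring
  rw [h1, norm_sub_rev x y, norm_sub_rev x z]
  congr 1; ring

lemma cc_meas {α : Type*} [MeasurableSpace α] {f g h : α → E} (hf : Measurable f) (hg : Measurable g) (hh : Measurable h) :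
    Measurable (fun a => cc (f a) (g a) (h a)) := by
  unfold cc
  exact (((det_meas (hg.sub hf) (hh.sub hf)).pow_const 2).const_mul 4).div
    ((((hg.sub hf).norm.pow_const 2).mul ((hh.sub hg).norm.pow_const 2)).mul ((hh.sub hf).norm.pow_const 2))

lemma inv_eq {x y z : E} (hy : y ≠ x) (hz : z ≠ x) : invCircumradius x y z ^2 = cc x y z := by
  unfold invCircumradius cc EuclideanGeometry.angle
  have hu : y - x ≠ 0 := sub_ne_zero.2 hy
  have hv : z - x ≠ 0 := sub_ne_zero.2 hz
  have hu' : 0 < ‖y - x‖ := norm_pos_iff.2 hu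
  have hv' : 0 < ‖z - x‖ := norm_pos_iff.2 hv
  have h1 := InnerProductGeometry.cos_angle_mul_norm_mul_norm (y - x) (z - x)
  have hi : inner ℝ (y-x) (z-x) = ip (y-x) (z-x) := by
    simp [ip, PiLp.inner_apply, Fin.sum_univ_two]; ring
  rw [hi] at h1
  have h2 := det_ip (y-x) (z-x)
  have h3 := Real.sin_sq_add_cos_sq (InnerProductGeometry.angle (y - x) (z - x))
  simp only [vsub_eq_sub]
  set s := Real.sin (InnerProductGeometry.angle (y - x) (z - x))
  set c := Real.cos (InnerProductGeometry.angle (y - x) (z - x))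
  have h4 : det (y-x) (z-x)^2 = s^2 * (‖y-x‖^2 * ‖z-x‖^2) := by
    rw [← h1] at h2
    have : s^2 = 1 - c^2 := by linarith
    rw [this]; linarith
  rw [h4, dist_eq_norm, norm_sub_rev y z]
  by_cases h : z - y = 0
  · simp [h]
  have h' : 0 < ‖z - y‖ := norm_pos_iff.2 h
  field_simp
  ring

lemma noatoms (μ : Measure E) (hg : ∀ x (r : ℝ), 0 < r → μ (closedBall x r) ≤ ENNReal.ofReal r) (x : E) : μ {x} = 0 := by
  by_contra h
  have hle : ∀ r : ℝ, 0 < r → μ {x} ≤ ENNReal.ofReal r := fun r hr =>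
    (measure_mono (by simpa using hr.le)).trans (hg x r hr)
  have ht : μ {x} ≠ ⊤ := ne_top_of_le_ne_top ENNReal.ofReal_ne_top (hle 1 one_pos)
  have hp : 0 < (μ {x}).toReal := ENNReal.toReal_pos h ht
  have := hle ((μ {x}).toReal/2) (by linarith)
  rw [ENNReal.le_ofReal_iff_toReal_le ht (by linarith)] at this
  linarith

lemma ae_ne (μ : Measure E) (hg : ∀ x (r : ℝ), 0 < r → μ (closedBall x r) ≤ ENNReal.ofReal r) (x : E) : ∀ᵐ y ∂μ, y ≠ x :=
  compl_mem_ae_iff.2 (noatoms μ hg x)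

lemma menger_eq (μ : Measure E) [IsFiniteMeasure μ] (hg : ∀ x (r : ℝ), 0 < r → μ (closedBall x r) ≤ ENNReal.ofReal r) :
    mengerCurvature μ = ∫⁻ p, ENNReal.ofReal (cc p.1 p.2.1 p.2.2) ∂(μ.prod (μ.prod μ)) := by
  unfold mengerCurvature
  have hm : Measurable (fun p : E × (E × E) => ENNReal.ofReal (cc p.1 p.2.1 p.2.2)) :=
    (cc_meas measurable_fst (measurable_fst.comp measurable_snd) (measurable_snd.comp measurable_snd)).ennreal_ofReal
  have e1 : ∫⁻ p, ENNReal.ofReal (cc p.1 p.2.1 p.2.2) ∂(μ.prod (μ.prod μ)) = ∫⁻ x, ∫⁻ q : E × E, ENNReal.ofReal (cc x q.1 q.2) ∂(μ.prod μ) ∂μ :=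
    lintegral_prod _ hm.aemeasurable
  have e2 : ∀ x, ∫⁻ q : E × E, ENNReal.ofReal (cc x q.1 q.2) ∂(μ.prod μ) = ∫⁻ y, ∫⁻ z, ENNReal.ofReal (cc x y z) ∂μ ∂μ := fun x => by
    have hx : Measurable (fun q : E × E => ENNReal.ofReal (cc x q.1 q.2)) := (cc_meas measurable_const measurable_fst measurable_snd).ennreal_ofReal
    exact lintegral_prod _ hx.aemeasurable
  rw [e1]
  refine lintegral_congr fun x => ?_
  rw [e2]
  have hx := ae_ne μ hg x
  refine lintegral_congr_ae (hx.mono fun y hy => ?_)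
  refine lintegral_congr_ae (hx.mono fun z hz => ?_)
  change ENNReal.ofReal _ = ENNReal.ofReal _
  rw [inv_eq hy hz]

lemma rot_lint (μ : Measure E) [IsFiniteMeasure μ] {f : E → E → E → ℝ≥0∞} (hf : Measurable (fun p : E × (E × E) => f p.1 p.2.1 p.2.2)) :
    ∫⁻ p, f p.2.1 p.2.2 p.1 ∂(μ.prod (μ.prod μ)) = ∫⁻ p, f p.1 p.2.1 p.2.2 ∂(μ.prod (μ.prod μ)) := by
  have hf' : Measurable (fun p : E × (E × E) => f p.2.1 p.2.2 p.1) :=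
    hf.comp (f := fun p : E × (E × E) => ((p.2.1, (p.2.2, p.1)) : E × (E × E))) (by fun_prop)
  rw [lintegral_prod_symm _ hf'.aemeasurable, lintegral_prod _ hf.aemeasurable]
  rw [lintegral_prod _ (Measurable.aemeasurable ?_)]
  · refine lintegral_congr fun x => ?_
    have hx : Measurable (fun q : E × E => f x q.1 q.2) := hf.comp measurable_prodMk_left
    rw [lintegral_prod (fun q : E × E => f x q.1 q.2) hx.aemeasurable]
  · exact Measurable.lintegral_prod_left' hf'

open Classical in
def Sh (x y z : E) : ℝ≥0∞ := if ‖x - y‖ ≤ ‖y - z‖ ∧ ‖x - y‖ ≤ ‖z - x‖ then ENNReal.ofReal (cc x y z) else 0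

lemma Sh_meas : Measurable (fun p : E × (E × E) => Sh p.1 p.2.1 p.2.2) := by
  unfold Sh
  apply Measurable.ite
  · have d1 : Measurable (fun q : E × (E × E) => ‖q.1 - q.2.1‖) := by fun_prop
    have d2 : Measurable (fun q : E × (E × E) => ‖q.2.1 - q.2.2‖) := by fun_prop
    have d3 : Measurable (fun q : E × (E × E) => ‖q.2.2 - q.1‖) := by fun_prop
    exact (measurableSet_le d1 d2).inter (measurableSet_le d1 d3)
  · exact (cc_meas measurable_fst (measurable_fst.comp measurable_snd) (measurable_snd.comp measurable_snd)).ennreal_ofReal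
  · exact measurable_const

lemma cc_le_Sh (x y z : E) : ENNReal.ofReal (cc x y z) ≤ Sh x y z + Sh y z x + Sh z x y := by
  have e1 := cc_rot x y z
  have e2 := cc_rot y z x
  rcases le_total ‖x-y‖ ‖y-z‖ with h1 | h1 <;> rcases le_total ‖y-z‖ ‖z-x‖ with h2 | h2 <;> rcases le_total ‖z-x‖ ‖x-y‖ with h3 | h3
  all_goals first
    | (have : ENNReal.ofReal (cc x y z) = Sh x y z := by
         unfold Sh; rw [if_pos ⟨by linarith, by linarith⟩]
       rw [this, add_assoc]; exact le_self_add)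
    | (have : ENNReal.ofReal (cc x y z) = Sh y z x := by
         unfold Sh; rw [if_pos ⟨by linarith, by linarith⟩, e1]
       rw [this, add_right_comm]; exact le_add_self)
    | (have : ENNReal.ofReal (cc x y z) = Sh z x y := by
         unfold Sh; rw [if_pos ⟨by linarith, by linarith⟩, e1, e2]
       rw [this]; exact le_add_self)

lemma Sh_le_phi (x y z : E) : Sh x y z ≤ ENNReal.ofReal 16 * phi x (y, z) := by
  unfold Sh phi
  split_ifs with h1 h2 h2
  · rw [← ENNReal.ofReal_mul (by norm_num)]
    apply ENNReal.ofReal_le_ofReal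
    have e : cc x y z = 4 * s2 x y z / ‖z-y‖^2 := by
      unfold cc s2
      rw [mul_div_assoc', div_div]; congr 1; ring
    simp only
    rw [e]
    have hs := s2_nonneg x y z
    rcases eq_or_ne (z - y) 0 with h | h
    · rw [h]; simp; positivity
    have hp : 0 < ‖z - y‖ := norm_pos_iff.2 h
    have ht : ‖z - x‖ ≤ 2 * ‖z - y‖ := by
      have := norm_sub_le_norm_sub_add_norm_sub z y x
      rw [norm_sub_rev y x] at this
      rw [norm_sub_rev y z] at h1
      linarith [h1.1]
    rcases eq_or_ne (z - x) 0 with h' | h'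
    · have : s2 x y z = 0 := by unfold s2; rw [h']; simp
      rw [this]; simp
    have hp' : 0 < ‖z - x‖ := norm_pos_iff.2 h'
    calc 4 * s2 x y z / ‖z-y‖^2 ≤ 4 * s2 x y z / (‖z-x‖/2)^2 := by
          gcongr; linarith
      _ = _ := by field_simp; ring
  · exact absurd (by rw [norm_sub_rev y x]; exact h1.2) h2
  · exact zero_le
  · exact zero_le

lemma menger_le_Phi (μ : Measure E) [IsFiniteMeasure μ] (hg : ∀ x (r : ℝ), 0 < r → μ (closedBall x r) ≤ ENNReal.ofReal r) :
    mengerCurvature μ ≤ ENNReal.ofReal 48 * ∫⁻ x, Phi μ x ∂μ := by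
  have hS := Sh_meas
  have hS2 : Measurable (fun p : E × (E × E) => Sh p.2.1 p.2.2 p.1) :=
    hS.comp (f := fun p : E × (E × E) => ((p.2.1, (p.2.2, p.1)) : E × (E × E))) (by fun_prop)
  have hS3 : Measurable (fun p : E × (E × E) => Sh p.2.2 p.1 p.2.1) :=
    hS.comp (f := fun p : E × (E × E) => ((p.2.2, (p.1, p.2.1)) : E × (E × E))) (by fun_prop)
  have r1 := rot_lint μ hS
  have r2 := rot_lint μ (f := fun x y z => Sh y z x) hS2
  rw [menger_eq μ hg]
  calc _ ≤ ∫⁻ p, (Sh p.1 p.2.1 p.2.2 + Sh p.2.1 p.2.2 p.1 + Sh p.2.2 p.1 p.2.1) ∂(μ.prod (μ.prod μ)) := lintegral_mono fun p => cc_le_Sh _ _ _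
    _ = ENNReal.ofReal 3 * ∫⁻ p, Sh p.1 p.2.1 p.2.2 ∂(μ.prod (μ.prod μ)) := by
        rw [lintegral_add_right _ hS3, lintegral_add_right _ hS2, r1]
        rw [r2, r1, show (3:ℝ) = ((3:ℕ):ℝ) by norm_num, ENNReal.ofReal_natCast]
        push_cast
        ring
    _ = ENNReal.ofReal 3 * ∫⁻ x, ∫⁻ p, Sh x p.1 p.2 ∂(μ.prod μ) ∂μ := by rw [lintegral_prod _ hS.aemeasurable]
    _ ≤ ENNReal.ofReal 3 * ∫⁻ x, ENNReal.ofReal 16 * Phi μ x ∂μ := by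
        gcongr with x
        unfold Phi
        rw [← lintegral_const_mul' _ _ ENNReal.ofReal_ne_top]
        exact lintegral_mono fun p => Sh_le_phi _ _ _
    _ = _ := by
        rw [lintegral_const_mul' _ _ ENNReal.ofReal_ne_top, ← mul_assoc, ← ENNReal.ofReal_mul (by norm_num)]
        norm_num

lemma KS_nonneg : 0 ≤ KS := tsum_nonneg fun n => by positivity

lemma upper : ∃ C : ℝ, 0 ≤ C ∧ ∀ μ : Measure E, IsFiniteMeasure μ → (∀ x (r : ℝ), 0 < r → μ (closedBall x r) ≤ ENNReal.ofReal r) →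
    mengerCurvature μ ≤ ENNReal.ofReal C * (jonesEnergy μ + μ univ) := by
  have hK := KS_nonneg
  refine ⟨48 * (4 * KS) * ((4000000 + 512^4*384) * 2^46 + 82944), by positivity, ?_⟩
  intro μ _ hg
  refine (menger_le_Phi μ hg).trans ?_
  refine (mul_le_mul_right (int_Phi μ hg) _).trans ?_
  rw [ENNReal.ofReal_mul (q := (4000000 + 512^4*384) * 2^46 + 82944) (by positivity), ENNReal.ofReal_mul (p := 48) (by positivity), mul_assoc, mul_assoc]
  gcongr
  rw [mul_add, ← mul_assoc, ← ENNReal.ofReal_mul (by positivity)]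
  gcongr <;> norm_num

lemma cover (μ : Measure E) [IsFiniteMeasure μ] (w : E) {r : ℝ} (hr : 0 < r) :
    ∫⁻ x in closedBall w r, (μ (closedBall x r))⁻¹ ∂μ ≤ 121 := by
  set s := r / 2 with hs
  have hs0 : 0 < s := by positivity
  set n := cidx s w with hn
  have hsub : closedBall w r ⊆ ⋃ j : JJ, Qc s (n + j.1) := by
    intro x hx
    have hx' : ‖x - w‖ ≤ 4 * s := by
      rw [← dist_eq_norm]; have := mem_closedBall.1 hx; rw [hs]; linarith
    have := Bc_sub s n (near_mem_Bc hs0 (show w ∈ Qc s n from rfl) hx')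
    simp only [mem_iUnion] at this ⊢
    obtain ⟨j, hj, h⟩ := this
    exact ⟨⟨j, hj⟩, h⟩
  have hQ : ∀ m, ∫⁻ x in Qc s m, (μ (closedBall x r))⁻¹ ∂μ ≤ 1 := by
    intro m
    calc _ ≤ ∫⁻ x in Qc s m, (μ (Qc s m))⁻¹ ∂μ := by
          refine setLIntegral_mono' (Qc_meas s m) fun x hx => ?_
          apply ENNReal.inv_le_inv.2
          apply measure_mono
          intro y hy
          have e : cidx s x = cidx s y := by
            rw [show cidx s x = m from hx, show cidx s y = m from hy]
          have := idx_far hs0 (x := y) (y := x) (M := 0) (by rw [e]; simp) (by rw [e]; simp)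
          rw [mem_closedBall]
          refine this.trans ?_
          rw [hs]; push_cast; linarith
      _ ≤ 1 := by
          rw [setLIntegral_const]
          exact ENNReal.inv_mul_le_one _
  calc _ ≤ ∫⁻ x in ⋃ j : JJ, Qc s (n + j.1), (μ (closedBall x r))⁻¹ ∂μ := lintegral_mono_set hsub
    _ ≤ ∑' j : JJ, ∫⁻ x in Qc s (n + j.1), (μ (closedBall x r))⁻¹ ∂μ := lintegral_iUnion_le _ _
    _ ≤ ∑' j : JJ, 1 := ENNReal.tsum_le_tsum fun j => hQ _
    _ ≤ 121 := by
        rw [tsum_fintype, Finset.sum_const]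
        have : (Finset.univ : Finset JJ).card = 121 := by rw [Finset.card_univ, Fintype.card_coe]; rfl
        rw [this]; simp

lemma r_int {t : ℝ} (ht : 0 < t) : ∫⁻ r in Ici t, ENNReal.ofReal (r^5)⁻¹ ≤ ENNReal.ofReal ((t^4)⁻¹ / 4) := by
  have e : ∀ r ∈ Ioi t, (r^5)⁻¹ = r^(-5:ℝ) := by
    intro r hr
    have : 0 < r := ht.trans hr
    rw [Real.rpow_neg this.le]; norm_cast
  rw [setLIntegral_congr Ioi_ae_eq_Ici.symm]
  rw [setLIntegral_congr_fun measurableSet_Ioi (g := fun r => ENNReal.ofReal (r^(-5:ℝ))) (fun r hr => by simp only; rw [e r hr])]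
  rw [← ofReal_integral_eq_lintegral_ofReal (integrableOn_Ioi_rpow_of_lt (by norm_num) ht)]
  · rw [integral_Ioi_rpow_of_lt (by norm_num) ht]
    apply ENNReal.ofReal_le_ofReal
    rw [show (-5:ℝ) + 1 = -4 by norm_num, Real.rpow_neg ht.le]
    norm_cast
    apply le_of_eq
    push_cast
    ring
  · refine (ae_restrict_iff' measurableSet_Ioi).2 (ae_of_all _ fun r hr => ?_)
    exact Real.rpow_nonneg (ht.trans hr).le _

def psi (w y z : E) : ℝ := det (y-w) (z-w)^2 / ‖z-y‖^2

lemma psi_meas {α : Type*} [MeasurableSpace α] {f g h : α → E} (hf : Measurable f) (hg : Measurable g) (hh : Measurable h) :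
    Measurable (fun a => psi (f a) (g a) (h a)) := by
  unfold psi
  exact ((det_meas (hg.sub hf) (hh.sub hf)).pow_const 2).div ((hh.sub hg).norm.pow_const 2)

lemma beta_le (μ : Measure E) {x y z : E} (h : z ≠ y) {r : ℝ} (hr : 0 < r) :
    beta2sq μ x r ≤ ENNReal.ofReal (r^3)⁻¹ * ∫⁻ w in closedBall x r, ENNReal.ofReal (psi w y z) ∂μ := by
  obtain ⟨L, hL⟩ := thru h.symm
  unfold beta2sq
  refine (iInf_le _ L).trans (le_of_eq ?_)
  rw [div_ofReal _ hr, ← lintegral_const_mul' _ _ ENNReal.ofReal_ne_top, ← lintegral_const_mul' _ _ ENNReal.ofReal_ne_top]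
  refine lintegral_congr fun w => ?_
  rw [← ENNReal.ofReal_mul (by positivity), ← ENNReal.ofReal_mul (by positivity), div_pow, hL]
  congr 1
  unfold psi
  rw [dist_eq_norm, norm_sub_rev y z]
  field_simp

def tri (μ : Measure E) (x : E) (r : ℝ) : ℝ≥0∞ :=
  ∫⁻ p in closedBall x r ×ˢ (closedBall x r ×ˢ closedBall x r), ENNReal.ofReal (psi p.1 p.2.1 p.2.2) ∂(μ.prod (μ.prod μ))

lemma beta_tri (μ : Measure E) [IsFiniteMeasure μ] (hg : ∀ x (r : ℝ), 0 < r → μ (closedBall x r) ≤ ENNReal.ofReal r) (x : E) {r : ℝ} (hr : 0 < r) :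
    beta2sq μ x r * μ (closedBall x r) * μ (closedBall x r) ≤ ENNReal.ofReal (r^3)⁻¹ * tri μ x r := by
  unfold tri
  rw [← Measure.prod_restrict, ← Measure.prod_restrict]
  set ν := μ.restrict (closedBall x r) with hν
  have hm : Measurable (fun p : E × (E × E) => ENNReal.ofReal (psi p.1 p.2.1 p.2.2)) :=
    (psi_meas measurable_fst (measurable_fst.comp measurable_snd) (measurable_snd.comp measurable_snd)).ennreal_ofReal
  have e1 : ∫⁻ p, ENNReal.ofReal (psi p.1 p.2.1 p.2.2) ∂(ν.prod (ν.prod ν)) = ∫⁻ q : E × E, ∫⁻ w, ENNReal.ofReal (psi w q.1 q.2) ∂ν ∂(ν.prod ν) :=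
    lintegral_prod_symm _ hm.aemeasurable
  have hm2 : Measurable (fun q : E × E => ∫⁻ w, ENNReal.ofReal (psi w q.1 q.2) ∂ν) := Measurable.lintegral_prod_left' hm
  have e2 : ∫⁻ q : E × E, ∫⁻ w, ENNReal.ofReal (psi w q.1 q.2) ∂ν ∂(ν.prod ν) = ∫⁻ y, ∫⁻ z, ∫⁻ w, ENNReal.ofReal (psi w y z) ∂ν ∂ν ∂ν :=
    lintegral_prod _ hm2.aemeasurable
  rw [e1, e2, ← lintegral_const_mul' _ _ ENNReal.ofReal_ne_top]
  have e3 : beta2sq μ x r * μ (closedBall x r) * μ (closedBall x r) = ∫⁻ y, ∫⁻ z, beta2sq μ x r ∂ν ∂ν := by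
    simp [hν]
  rw [e3]
  refine lintegral_mono fun y => ?_
  simp only
  rw [← lintegral_const_mul' _ _ ENNReal.ofReal_ne_top]
  refine lintegral_mono_ae ?_
  refine (ae_restrict_of_ae (ae_ne μ hg y)).mono fun z hz => ?_
  exact beta_le μ hz hr

open Classical in
def hk (μ : Measure E) (x : E) (r : ℝ) (p : E × (E × E)) : ℝ≥0∞ :=
  ENNReal.ofReal (r^5)⁻¹ * (μ (closedBall x r))⁻¹ * (if dist p.1 x ≤ r ∧ dist p.2.1 x ≤ r ∧ dist p.2.2 x ≤ r then ENNReal.ofReal (psi p.1 p.2.1 p.2.2) else 0)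

lemma Fj_le (μ : Measure E) [IsFiniteMeasure μ] (hg : ∀ x (r : ℝ), 0 < r → μ (closedBall x r) ≤ ENNReal.ofReal r) (x : E) {r : ℝ} (hr : 0 < r) :
    Fj μ x r ≤ ∫⁻ p, hk μ x r p ∂(μ.prod (μ.prod μ)) := by
  by_cases h0 : μ (closedBall x r) = 0
  · unfold Fj; rw [h0]; simp
  have ht : μ (closedBall x r) ≠ ⊤ := measure_ne_top _ _
  have e : ∫⁻ p, hk μ x r p ∂(μ.prod (μ.prod μ)) = ENNReal.ofReal (r^5)⁻¹ * (μ (closedBall x r))⁻¹ * tri μ x r := by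
    unfold hk tri
    rw [lintegral_const_mul' _ _ (ENNReal.mul_ne_top ENNReal.ofReal_ne_top (ENNReal.inv_ne_top.2 h0)),
      ← lintegral_indicator (isClosed_closedBall.measurableSet.prod (isClosed_closedBall.measurableSet.prod isClosed_closedBall.measurableSet))]
    congr 1
    refine lintegral_congr fun a => ?_
    by_cases hc : dist a.1 x ≤ r ∧ dist a.2.1 x ≤ r ∧ dist a.2.2 x ≤ r
    · rw [if_pos hc, indicator_of_mem (show a ∈ closedBall x r ×ˢ (closedBall x r ×ˢ closedBall x r) from hc)]
    · rw [if_neg hc, indicator_of_notMem (show a ∉ closedBall x r ×ˢ (closedBall x r ×ˢ closedBall x r) from hc)]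
  rw [e]
  unfold Fj
  rw [div_ofReal _ hr, div_ofReal _ hr]
  have hb := beta_tri μ hg x hr
  set m := μ (closedBall x r)
  set b := beta2sq μ x r
  calc ENNReal.ofReal r⁻¹ * (b * (ENNReal.ofReal r⁻¹ * m)) = ENNReal.ofReal r⁻¹ * ENNReal.ofReal r⁻¹ * m⁻¹ * (b * m * m) := by
        have : m⁻¹ * m = 1 := ENNReal.inv_mul_cancel h0 ht
        calc _ = ENNReal.ofReal r⁻¹ * (b * (ENNReal.ofReal r⁻¹ * m)) * 1 := by rw [mul_one]
          _ = _ := by rw [← this]; ring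
    _ ≤ ENNReal.ofReal r⁻¹ * ENNReal.ofReal r⁻¹ * m⁻¹ * (ENNReal.ofReal (r^3)⁻¹ * tri μ x r) := by gcongr
    _ = (ENNReal.ofReal r⁻¹ * ENNReal.ofReal r⁻¹ * ENNReal.ofReal (r^3)⁻¹) * m⁻¹ * tri μ x r := by ring
    _ = _ := by
        rw [← ENNReal.ofReal_mul (by positivity), ← ENNReal.ofReal_mul (by positivity)]
        congr 3
        field_simp

lemma hk_meas (μ : Measure E) [IsFiniteMeasure μ] : Measurable (fun q : (E × ℝ) × (E × (E × E)) => hk μ q.1.1 q.1.2 q.2) := by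
  unfold hk
  have m1 : Measurable (fun a : E × ℝ => μ (closedBall a.1 a.2)) := by
    have hs : MeasurableSet {q : (E × ℝ) × E | dist q.2 q.1.1 ≤ q.1.2} := by
      apply measurableSet_le <;> fun_prop
    exact measurable_measure_prodMk_left hs
  refine Measurable.mul (Measurable.mul ?_ ?_) ?_
  · exact ((measurable_snd.comp measurable_fst).pow_const 5).inv.ennreal_ofReal
  · exact (m1.comp measurable_fst).inv
  · apply Measurable.ite
    · have d0 : Measurable (fun q : (E × ℝ) × (E × (E × E)) => q.1.2) := by fun_prop
      have d1 : Measurable (fun q : (E × ℝ) × (E × (E × E)) => dist q.2.1 q.1.1) := by fun_prop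
      have d2 : Measurable (fun q : (E × ℝ) × (E × (E × E)) => dist q.2.2.1 q.1.1) := by fun_prop
      have d3 : Measurable (fun q : (E × ℝ) × (E × (E × E)) => dist q.2.2.2 q.1.1) := by fun_prop
      exact (measurableSet_le d1 d0).inter ((measurableSet_le d2 d0).inter (measurableSet_le d3 d0))
    · exact (psi_meas (by fun_prop) (by fun_prop) (by fun_prop)).ennreal_ofReal
    · exact measurable_const

lemma psi_cc (w y z : E) (hy : y ≠ w) (hz : z ≠ w) : psi w y z = cc w y z * (‖y-w‖^2 * ‖z-w‖^2) / 4 := by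
  have h1 : 0 < ‖y-w‖ := norm_pos_iff.2 (sub_ne_zero.2 hy)
  have h2 : 0 < ‖z-w‖ := norm_pos_iff.2 (sub_ne_zero.2 hz)
  unfold psi cc
  rcases eq_or_ne (z - y) 0 with h | h
  · simp [h]
  have h3 : 0 < ‖z-y‖ := norm_pos_iff.2 h
  field_simp

lemma inner_bd (μ : Measure E) [IsFiniteMeasure μ] (w y z : E) :
    ∫⁻ r in Ioi (0:ℝ), ∫⁻ x, hk μ x r (w, (y, z)) ∂μ ≤ ENNReal.ofReal 121 * ENNReal.ofReal (cc w y z) := by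
  by_cases h : y = w ∨ z = w
  · have hp : psi w y z = 0 := by
      unfold psi det
      rcases h with h | h <;> simp [h]
    unfold hk
    simp [hp]
  push Not at h
  obtain ⟨hy, hz⟩ := h
  set t := max ‖y-w‖ ‖z-w‖ with ht
  have h1 : 0 < ‖y-w‖ := norm_pos_iff.2 (sub_ne_zero.2 hy)
  have h2 : 0 < ‖z-w‖ := norm_pos_iff.2 (sub_ne_zero.2 hz)
  have ht0 : 0 < t := lt_max_of_lt_left h1
  have hmeas : MeasurableSet (Ici (t/2)) := measurableSet_Ici
  have key : ∀ r ∈ Ioi (0:ℝ), ∫⁻ x, hk μ x r (w, (y, z)) ∂μ ≤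
      (Ici (t/2)).indicator (fun r => ENNReal.ofReal (r^5)⁻¹) r * (121 * ENNReal.ofReal (psi w y z)) := by
    intro r hr
    by_cases htr : t/2 ≤ r
    · rw [indicator_of_mem (show r ∈ Ici (t/2) from htr)]
      have hle : ∀ x, hk μ x r (w, (y, z)) ≤ (ENNReal.ofReal (r^5)⁻¹ * ENNReal.ofReal (psi w y z)) * (closedBall w r).indicator (fun x => (μ (closedBall x r))⁻¹) x := by
        intro x
        unfold hk
        simp only
        split_ifs with hc
        · rw [indicator_of_mem (show x ∈ closedBall w r by rw [mem_closedBall, dist_comm]; exact hc.1)]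
          apply le_of_eq; ring
        · simp
      refine (lintegral_mono hle).trans ?_
      rw [lintegral_const_mul' _ _ (ENNReal.mul_ne_top ENNReal.ofReal_ne_top ENNReal.ofReal_ne_top), lintegral_indicator isClosed_closedBall.measurableSet]
      calc _ ≤ ENNReal.ofReal (r^5)⁻¹ * ENNReal.ofReal (psi w y z) * 121 := by
            gcongr; exact cover μ w hr
        _ = _ := by ring
    · have : ∀ x, hk μ x r (w, (y, z)) = 0 := by
        intro x
        unfold hk
        rw [if_neg, mul_zero]
        rintro ⟨a, b, c⟩
        simp only at a b c
        apply htr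
        have q1 := dist_triangle_right y w x
        have q2 := dist_triangle_right z w x
        rw [dist_eq_norm y w] at q1
        rw [dist_eq_norm z w] at q2
        have : t ≤ 2 * r := max_le (by linarith) (by linarith)
        linarith
      simp [this]
  calc _ ≤ ∫⁻ r in Ioi (0:ℝ), (Ici (t/2)).indicator (fun r => ENNReal.ofReal (r^5)⁻¹) r * (121 * ENNReal.ofReal (psi w y z)) :=
        setLIntegral_mono' measurableSet_Ioi key
    _ = (∫⁻ r in Ioi (0:ℝ), (Ici (t/2)).indicator (fun r => ENNReal.ofReal (r^5)⁻¹) r) * (121 * ENNReal.ofReal (psi w y z)) := by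
        rw [lintegral_mul_const' _ _ (ENNReal.mul_ne_top (by simp) ENNReal.ofReal_ne_top)]
    _ ≤ (∫⁻ r, (Ici (t/2)).indicator (fun r => ENNReal.ofReal (r^5)⁻¹) r) * (121 * ENNReal.ofReal (psi w y z)) := by
        gcongr; exact Measure.restrict_le_self
    _ ≤ ENNReal.ofReal (((t/2)^4)⁻¹ / 4) * (121 * ENNReal.ofReal (psi w y z)) := by
        rw [lintegral_indicator hmeas]
        gcongr
        exact r_int (by positivity)
    _ = ENNReal.ofReal 121 * ENNReal.ofReal ((((t/2)^4)⁻¹ / 4) * psi w y z) := by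
        rw [ENNReal.ofReal_mul (by positivity), show (121:ℝ≥0∞) = ENNReal.ofReal 121 by simp]; ring
    _ ≤ _ := by
        gcongr
        rw [psi_cc w y z hy hz]
        have hcc := cc_nonneg w y z
        have b : ‖y-w‖^2 * ‖z-w‖^2 ≤ t^2 * t^2 := by
          gcongr
          · exact le_max_left _ _
          · exact le_max_right _ _
        calc (((t/2)^4)⁻¹ / 4) * (cc w y z * (‖y-w‖^2 * ‖z-w‖^2) / 4) ≤ (((t/2)^4)⁻¹ / 4) * (cc w y z * (t^2 * t^2) / 4) := by gcongr
          _ = cc w y z := by field_simp; ring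

lemma lower (μ : Measure E) [IsFiniteMeasure μ] (hg : ∀ x (r : ℝ), 0 < r → μ (closedBall x r) ≤ ENNReal.ofReal r) :
    jonesEnergy μ ≤ ENNReal.ofReal 121 * mengerCurvature μ := by
  have hm := hk_meas μ
  set ν := (volume : Measure ℝ).restrict (Ioi 0) with hν
  set P := μ.prod (μ.prod μ) with hP
  have hm1 : Measurable (fun a : E × ℝ => ∫⁻ p, hk μ a.1 a.2 p ∂P) := Measurable.lintegral_prod_right' hm
  have e1 : ∫⁻ a, ∫⁻ p, hk μ a.1 a.2 p ∂P ∂(μ.prod ν) = ∫⁻ x, ∫⁻ r, ∫⁻ p, hk μ x r p ∂P ∂ν ∂μ := lintegral_prod _ hm1.aemeasurable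
  have e2 : ∫⁻ a, ∫⁻ p, hk μ a.1 a.2 p ∂P ∂(μ.prod ν) = ∫⁻ p, ∫⁻ a, hk μ a.1 a.2 p ∂(μ.prod ν) ∂P := lintegral_lintegral_swap hm.aemeasurable
  have e3 : ∀ p, ∫⁻ a, hk μ a.1 a.2 p ∂(μ.prod ν) = ∫⁻ r, ∫⁻ x, hk μ x r p ∂μ ∂ν := fun p => by
    have : Measurable (fun a : E × ℝ => hk μ a.1 a.2 p) := hm.comp (f := fun a : E × ℝ => (a, p)) (by fun_prop)
    exact lintegral_prod_symm _ this.aemeasurable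
  calc jonesEnergy μ ≤ ∫⁻ x, ∫⁻ r, ∫⁻ p, hk μ x r p ∂P ∂ν ∂μ := by
        unfold jonesEnergy
        refine lintegral_mono fun x => ?_
        exact setLIntegral_mono' measurableSet_Ioi fun r hr => Fj_le μ hg x hr
    _ = ∫⁻ p, ∫⁻ r, ∫⁻ x, hk μ x r p ∂μ ∂ν ∂P := by rw [← e1, e2]; simp only [e3]
    _ ≤ ∫⁻ p, ENNReal.ofReal 121 * ENNReal.ofReal (cc p.1 p.2.1 p.2.2) ∂P := lintegral_mono fun p => inner_bd μ p.1 p.2.1 p.2.2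
    _ = _ := by rw [lintegral_const_mul' _ _ ENNReal.ofReal_ne_top, menger_eq μ hg]

end MJ

/-- For a finite, compactly supported measure on `ℝ²` with linear growth,
`c²(μ) + ‖μ‖ ∼ ∬ β_{μ,2}² Θ_μ¹ dr/r dμ + ‖μ‖` with absolute constants. -/
theorem stmt7 :
    ∃ C : ℝ, 0 < C ∧
    ∀ μ : Measure (EuclideanSpace ℝ (Fin 2)), IsFiniteMeasure μ →
      (∃ K : Set (EuclideanSpace ℝ (Fin 2)), IsCompact K ∧ μ Kᶜ = 0) →
      (∀ x (r : ℝ), 0 < r → μ (closedBall x r) ≤ ENNReal.ofReal r) →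
      mengerCurvature μ + μ Set.univ ≤
          ENNReal.ofReal C * (jonesEnergy μ + μ Set.univ) ∧
      jonesEnergy μ + μ Set.univ ≤
          ENNReal.ofReal C * (mengerCurvature μ + μ Set.univ) := by
  obtain ⟨C, hC, hup⟩ := MJ.upper
  refine ⟨C + 122, by linarith, ?_⟩
  intro μ hfin _ hg
  have h1 := hup μ hfin hg
  have h2 := MJ.lower μ hg
  have hCE : ENNReal.ofReal (C + 122) = ENNReal.ofReal C + 122 := by
    rw [ENNReal.ofReal_add hC (by norm_num)]; simp
  rw [hCE]
  constructor
  · calc mengerCurvature μ + μ Set.univ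
        ≤ ENNReal.ofReal C * (jonesEnergy μ + μ Set.univ) + 122 * (jonesEnergy μ + μ Set.univ) := by
          refine add_le_add h1 ?_
          calc μ Set.univ ≤ jonesEnergy μ + μ Set.univ := le_add_self
            _ = 1 * (jonesEnergy μ + μ Set.univ) := (one_mul _).symm
            _ ≤ 122 * (jonesEnergy μ + μ Set.univ) := by gcongr; norm_num
      _ = _ := by rw [add_mul]
  · calc jonesEnergy μ + μ Set.univ
        ≤ 122 * mengerCurvature μ + 122 * μ Set.univ := by
          refine add_le_add (h2.trans ?_) ?_
          · gcongr
            simp only [ENNReal.ofReal_ofNat]; norm_num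
          · calc μ Set.univ = 1 * μ Set.univ := (one_mul _).symm
              _ ≤ 122 * μ Set.univ := by gcongr; norm_num
      _ = 122 * (mengerCurvature μ + μ Set.univ) := by rw [mul_add]
      _ ≤ _ := by gcongr; exact le_add_self

end
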